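/- arXiv:2305.04882 — 5 statements merged into one kernel-verified Lean document; each statement's English description precedes it below -/
import Mathlib

section
/- For every prime p ∉ {2, 3} one has the identity m_3^{(2,2)}(p) = p³·m_2^6(p) − 2p⁶ − 2p⁴ − p². -/
open Complex

/-- `Kl p K n a` is the Kloosterman sum `Kl_{n+1}(a; #K)` in `n` variables over the finite
field `K` of characteristic `p`, i.e. `∑_{x ∈ (Kˣ)ⁿ} ψ(x₁ + ⋯ + xₙ + a/(x₁⋯xₙ))` where
`ψ(x) = exp(2πi·Tr_{K/𝔽_p}(x)/p)`. -/
noncomputable def Kl (p : ℕ) (K : Type*) [CommRing K] [Finite K] [Algebra (ZMod p) K]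
    (n : ℕ) (a : Kˣ) : ℂ :=
  letI := Fintype.ofFinite K
  letI := Classical.decEq K
  ∑ x : Fin n → Kˣ,
    Complex.exp (2 * (Real.pi : ℂ) * Complex.I *
      (((Algebra.trace (ZMod p) K
          ((∑ i, ((x i : K))) + ((a * (∏ i, x i)⁻¹ : Kˣ) : K))).val : ℂ)) / (p : ℂ))

/-- `s₁(a) = Kl₃(a; p)`. -/
noncomputable def s₁ (p : ℕ) [Fact p.Prime] (a : (ZMod p)ˣ) : ℂ := Kl p (ZMod p) 2 a

/-- `s₂(a) = p · Kl₃(−a; p)`. -/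
noncomputable def s₂ (p : ℕ) [Fact p.Prime] (a : (ZMod p)ˣ) : ℂ :=
  (p : ℂ) * Kl p (ZMod p) 2 (-a)

/-- `K(a) = Kl₂(a; p)`. -/
noncomputable def Kcl (p : ℕ) [Fact p.Prime] (a : (ZMod p)ˣ) : ℂ := Kl p (ZMod p) 1 a

/-- The moment of the Kloosterman sheaf `Kl₃^{(2,2)}`:
`m_3^{(2,2)}(p) = Σ_{a ∈ 𝔽_p^×} ((s₁(a)² − s₂(a))·(s₂(a)² − p³·s₁(a)) − p³·s₁(a)·s₂(a))`. -/
noncomputable def m322 (p : ℕ) [Fact p.Prime] : ℂ :=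
  ∑ a : (ZMod p)ˣ,
    ((s₁ p a ^ 2 - s₂ p a) * (s₂ p a ^ 2 - (p : ℂ) ^ 3 * s₁ p a)
      - (p : ℂ) ^ 3 * s₁ p a * s₂ p a)

/-- The 6th symmetric power moment of `Kl₂`:
`m_2^6(p) = Σ_{a ∈ 𝔽_p^×} (K(a)⁶ − 5p·K(a)⁴ + 6p²·K(a)² − p³)`. -/
noncomputable def m26 (p : ℕ) [Fact p.Prime] : ℂ :=
  ∑ a : (ZMod p)ˣ,
    (Kcl p a ^ 6 - 5 * (p : ℂ) * Kcl p a ^ 4 + 6 * (p : ℂ) ^ 2 * Kcl p a ^ 2 - (p : ℂ) ^ 3)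

set_option linter.unusedSectionVars false

section Helpers

variable {F : Type*} [Field F] [Fintype F] [DecidableEq F]

/-- Indicator function of a proposition, with values in `ℂ`. -/
noncomputable def ind (P : Prop) : ℂ := by
  classical exact if P then 1 else 0

theorem ind_true {P : Prop} (h : P) : ind P = 1 := by simp [ind, h]

theorem ind_false {P : Prop} (h : ¬ P) : ind P = 0 := by simp [ind, h]

theorem ind_congr {P Q : Prop} (h : P ↔ Q) : ind P = ind Q := by
  rw [propext h]

theorem ind_and (P Q : Prop) : ind (P ∧ Q) = ind P * ind Q := by
  by_cases hP : P <;> by_cases hQ : Q <;> simp [ind, hP, hQ]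

theorem sum_ind_eq {α : Type*} [Fintype α] (b : α) (f : α → ℂ) :
    ∑ x, ind (x = b) * f x = f b := by
  classical
  rw [Finset.sum_eq_single b]
  · simp [ind]
  · intro x _ hx; simp [ind, hx]
  · simp

theorem sum_ind_eq' {α : Type*} [Fintype α] (b : α) (f : α → ℂ) :
    ∑ x, ind (b = x) * f x = f b := by
  rw [← sum_ind_eq b f]
  exact Finset.sum_congr rfl fun x _ => by rw [ind_congr eq_comm]

theorem sum_ind_one {α : Type*} [Fintype α] (b : α) :
    ∑ x, ind (x = b) = 1 := by
  simpa using sum_ind_eq b (fun _ => (1 : ℂ))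

/-- The character `ψ` satisfies orthogonality, with `q` the cardinality. -/
structure Orth (ψ : AddChar F ℂ) (q : ℂ) : Prop where
  card : (Fintype.card Fˣ : ℂ) = q - 1
  sum : ∀ c : F, ∑ x : Fˣ, ψ (c * x) = q * ind (c = 0) - 1

theorem sum_units_add (f : F → ℂ) : ∑ u : Fˣ, f u = ∑ u : F, f u - f 0 := by
  have h := Fintype.sum_eq_add_sum_subtype_ne f 0
  rw [h, add_sub_cancel_left]
  exact Fintype.sum_equiv unitsEquivNeZero _ _ (fun x => rfl)

/-! ### Kloosterman sums in one variable -/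

/-- `∑ ψ(c x + d / x)`. -/
noncomputable def S2 (ψ : AddChar F ℂ) (c d : F) : ℂ := ∑ x : Fˣ, ψ (c * x + d * (x : F)⁻¹)

theorem sum_inv_units (g : F → ℂ) : ∑ x : Fˣ, g ((x : F)⁻¹) = ∑ x : Fˣ, g x :=
  Fintype.sum_equiv (Equiv.inv Fˣ) _ _ (fun x => by simp)

theorem sum_mul_units (u : Fˣ) (g : Fˣ → ℂ) : ∑ x : Fˣ, g (u * x) = ∑ x : Fˣ, g x :=
  Fintype.sum_equiv (Equiv.mulLeft u) _ _ (fun x => by simp)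

variable {ψ : AddChar F ℂ} {q : ℂ}

theorem S2_unit (c d : F) (hc : c ≠ 0) : S2 ψ c d = S2 ψ 1 (c * d) := by
  unfold S2
  rw [← sum_mul_units (Units.mk0 c hc) (fun x => ψ (1 * x + c * d * (x : F)⁻¹))]
  refine Finset.sum_congr rfl fun x _ => ?_
  congr 1
  have := x.ne_zero
  simp only [Units.val_mul, Units.val_mk0]
  field_simp

theorem S2_zero_left (h : Orth ψ q) (d : F) : S2 ψ 0 d = q * ind (d = 0) - 1 := by
  rw [← h.sum, ← sum_inv_units (fun x => ψ (d * x))]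
  simp [S2]

theorem S2_zero_right (h : Orth ψ q) (d : F) : S2 ψ d 0 = q * ind (d = 0) - 1 := by
  rw [← h.sum]
  simp [S2]

/-- Value of `S2` in terms of the basic sum. -/
theorem S2_val (h : Orth ψ q) (a : Fˣ) (c d : F) :
    S2 ψ c (a * d) = q * ind (c = 0 ∧ d = 0) - ind (c * d = 0)
      + ∑ u : Fˣ, ind (c * d = u) * S2 ψ 1 (a * u) := by
  by_cases hc : c = 0
  · subst hc
    rw [S2_zero_left h]
    have : ∀ u : Fˣ, ind (0 * d = (u : F)) = 0 := fun u => ind_false (by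
      rw [zero_mul]; exact u.ne_zero.symm)
    simp_rw [this]
    simp [ind_true]
  by_cases hd : d = 0
  · subst hd
    rw [mul_zero, S2_zero_right h]
    have : ∀ u : Fˣ, ind (c * 0 = (u : F)) = 0 := fun u => ind_false (by
      rw [mul_zero]; exact u.ne_zero.symm)
    simp_rw [this]
    simp [ind_true]
  rw [S2_unit _ _ hc]
  have hcd : c * d ≠ 0 := mul_ne_zero hc hd
  have : ∀ u : Fˣ, ind (c * d = u) = ind (Units.mk0 (c * d) hcd = u) := fun u =>
    ind_congr (by rw [Units.ext_iff]; rfl)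
  simp_rw [this]
  rw [sum_ind_eq', ind_false hcd, ind_false (fun H => hc H.1)]
  simp only [Units.val_mk0]
  rw [mul_left_comm]; ring

/-- Fibre counts. -/
noncomputable def cnt {J : Type*} [Fintype J] (g : J → F) (u : F) : ℂ := ∑ j, ind (g j = u)

theorem sum_cnt {J : Type*} [Fintype J] (g : J → F) : ∑ u, cnt g u = Fintype.card J := by
  unfold cnt
  rw [Finset.sum_comm]
  have : ∀ j, ∑ u, ind (g j = u) = 1 := fun j => by
    simpa using sum_ind_eq' (g j) (fun _ => (1 : ℂ))
  simp [this]

theorem S2_sum (h : Orth ψ q) {J : Type*} [Fintype J] (c d : J → F) (a : Fˣ) :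
    ∑ j, S2 ψ (c j) (a * d j) = q * ∑ j, ind (c j = 0 ∧ d j = 0)
      - cnt (fun j => c j * d j) 0
      + ∑ u : Fˣ, cnt (fun j => c j * d j) u * S2 ψ 1 (a * u) := by
  rw [Finset.sum_congr rfl fun j _ => S2_val h a (c j) (d j)]
  rw [Finset.sum_add_distrib, Finset.sum_sub_distrib, Finset.mul_sum, Finset.sum_comm]
  simp_rw [cnt, Finset.sum_mul]

theorem sum_psi (h : Orth ψ q) : ∑ x : Fˣ, ψ x = -1 := by
  have := h.sum 1
  rw [ind_false one_ne_zero] at this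
  simpa using this

theorem sum_S2 (h : Orth ψ q) (u : Fˣ) : ∑ a : Fˣ, S2 ψ 1 (a * u) = 1 := by
  unfold S2
  rw [Finset.sum_comm]
  have : ∀ x : Fˣ, ∑ a : Fˣ, ψ (1 * x + a * u * (x : F)⁻¹) = ψ x * (-1) := by
    intro x
    have := h.sum (u * (x : F)⁻¹)
    rw [ind_false (mul_ne_zero u.ne_zero (inv_ne_zero x.ne_zero))] at this
    simp only [AddChar.map_add_eq_mul, one_mul]
    rw [← Finset.mul_sum]
    congr 1
    rw [← zero_sub, ← mul_zero q, ← this]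
    exact Finset.sum_congr rfl fun a _ => by congr 1; ring
  simp_rw [this]
  rw [← Finset.sum_mul, sum_psi h]; norm_num

theorem S2_orth (h : Orth ψ q) (u v : Fˣ) :
    ∑ a : Fˣ, S2 ψ 1 (a * u) * S2 ψ 1 (a * v) = q ^ 2 * ind (u = v) - (q + 1) := by
  have key : ∀ x y : Fˣ, ∑ a : Fˣ, ψ (1 * x + a * u * (x : F)⁻¹) * ψ (1 * y + a * v * (y : F)⁻¹)
      = q * (ind (y = -(v * u⁻¹) * x) * ψ ((x : F) + y)) - ψ x * ψ y := by
    intro x y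
    have h1 := h.sum (u * (x : F)⁻¹ + v * (y : F)⁻¹)
    have h2 : (u * (x : F)⁻¹ + v * (y : F)⁻¹ = 0) ↔ (y = -(v * u⁻¹) * x) := by
      have := x.ne_zero; have := y.ne_zero; have := u.ne_zero
      rw [Units.ext_iff]
      simp only [Units.val_neg, Units.val_mul, Units.val_inv_eq_inv_val]
      field_simp
      constructor <;> intro H <;> linear_combination H
    rw [ind_congr h2] at h1
    have : ∀ a : Fˣ, ψ (1 * x + a * u * (x : F)⁻¹) * ψ (1 * y + a * v * (y : F)⁻¹)
        = ψ ((x : F) + y) * ψ ((u * (x : F)⁻¹ + v * (y : F)⁻¹) * a) := by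
      intro a
      rw [← AddChar.map_add_eq_mul, ← AddChar.map_add_eq_mul]
      congr 1; ring
    simp_rw [this]
    rw [← Finset.mul_sum, h1, AddChar.map_add_eq_mul]; ring
  unfold S2
  simp_rw [Finset.sum_mul_sum]
  rw [Finset.sum_comm]
  have : ∀ x : Fˣ, ∑ a : Fˣ, ∑ y : Fˣ,
      ψ (1 * x + a * u * (x : F)⁻¹) * ψ (1 * y + a * v * (y : F)⁻¹)
      = q * ψ ((1 - v * (u : F)⁻¹) * x) + ψ x := by
    intro x
    rw [Finset.sum_comm]
    simp_rw [key]
    rw [Finset.sum_sub_distrib, ← Finset.mul_sum, ← Finset.mul_sum, sum_psi h,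
      sum_ind_eq _ (fun y : Fˣ => ψ ((x : F) + y))]
    rw [mul_neg_one, sub_neg_eq_add]
    congr 3
    simp only [Units.val_neg, Units.val_mul, Units.val_inv_eq_inv_val]
    ring
  simp_rw [this]
  rw [Finset.sum_add_distrib, ← Finset.mul_sum, h.sum, sum_psi h]
  have : (1 - v * (u : F)⁻¹ = 0) ↔ u = v := by
    have := u.ne_zero
    rw [Units.ext_iff]; field_simp; rw [mul_zero, sub_eq_zero]
  rw [ind_congr this]; ring

/-- Abstract second moment. -/
theorem abstract_moment (κ κ' : Fˣ → Fˣ → ℂ) (C m A B : ℂ) (N : Fˣ → ℂ)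
    (hcard : (Fintype.card Fˣ : ℂ) = q - 1)
    (h1 : ∀ u, ∑ a, κ a u = m) (h1' : ∀ u, ∑ a, κ' a u = m)
    (h2 : ∀ u v, ∑ a, κ a u * κ' a v = A * ind (u = v) - B) :
    ∑ a, (C + ∑ u, N u * κ a u) * (C + ∑ u, N u * κ' a u)
      = (q - 1) * C ^ 2 + 2 * C * m * (∑ u, N u) + A * ∑ u, N u ^ 2 - B * (∑ u, N u) ^ 2 := by
  have e1 : ∑ a, ∑ u, N u * κ a u = m * ∑ u, N u := by
    rw [Finset.sum_comm]; simp_rw [← Finset.mul_sum, h1]; rw [← Finset.sum_mul]; ring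
  have e2 : ∑ a, ∑ u, N u * κ' a u = m * ∑ u, N u := by
    rw [Finset.sum_comm]; simp_rw [← Finset.mul_sum, h1']; rw [← Finset.sum_mul]; ring
  have e3 : ∑ a, (∑ u, N u * κ a u) * (∑ u, N u * κ' a u)
      = A * ∑ u, N u ^ 2 - B * (∑ u, N u) ^ 2 := by
    simp_rw [Finset.sum_mul_sum]
    rw [Finset.sum_comm]
    have : ∀ u, ∑ a, ∑ v, N u * κ a u * (N v * κ' a v) = A * N u ^ 2 - B * (N u * ∑ v, N v) := by
      intro u
      rw [Finset.sum_comm]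
      have : ∀ v, ∑ a, N u * κ a u * (N v * κ' a v)
          = A * N u * (ind (u = v) * N v) - B * N u * N v := by
        intro v
        have : ∀ a, N u * κ a u * (N v * κ' a v) = N u * N v * (κ a u * κ' a v) := fun a => by ring
        simp_rw [this]
        rw [← Finset.mul_sum, h2]; ring
      simp_rw [this]
      rw [Finset.sum_sub_distrib, ← Finset.mul_sum, ← Finset.mul_sum, sum_ind_eq']
      ring
    simp_rw [this]
    rw [Finset.sum_sub_distrib, ← Finset.mul_sum, ← Finset.mul_sum, ← Finset.sum_mul]
    ring
  have : ∀ a, (C + ∑ u, N u * κ a u) * (C + ∑ u, N u * κ' a u)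
      = C ^ 2 + C * (∑ u, N u * κ a u) + C * (∑ u, N u * κ' a u)
        + (∑ u, N u * κ a u) * (∑ u, N u * κ' a u) := fun a => by ring
  simp_rw [this]
  rw [Finset.sum_add_distrib, Finset.sum_add_distrib, Finset.sum_add_distrib, ← Finset.mul_sum,
    ← Finset.mul_sum, e1, e2, e3, Finset.sum_const, Finset.card_univ, nsmul_eq_mul, hcard]
  ring

theorem S2_sq (a : F) : S2 ψ 1 a ^ 2 = ∑ t : Fˣ, S2 ψ (1 + t) (a * (1 + (t : F)⁻¹)) := by
  unfold S2
  rw [sq, Finset.sum_mul_sum]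
  conv_rhs => rw [Finset.sum_comm]
  refine Finset.sum_congr rfl fun x _ => ?_
  rw [← sum_mul_units x]
  refine Finset.sum_congr rfl fun t _ => ?_
  rw [← AddChar.map_add_eq_mul]
  congr 1
  simp only [Units.val_mul, mul_inv]
  ring

theorem S2_cube (a : F) : S2 ψ 1 a ^ 3 = ∑ j : Fˣ × Fˣ,
    S2 ψ (1 + j.1 + j.2) (a * (1 + (j.1 : F)⁻¹ + (j.2 : F)⁻¹)) := by
  rw [pow_succ, S2_sq, Fintype.sum_prod_type, Finset.sum_mul]
  refine Finset.sum_congr rfl fun t _ => ?_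
  unfold S2
  rw [Finset.sum_mul_sum]
  conv_rhs => rw [Finset.sum_comm]
  refine Finset.sum_congr rfl fun x _ => ?_
  rw [← sum_mul_units x]
  refine Finset.sum_congr rfl fun s _ => ?_
  rw [← AddChar.map_add_eq_mul]
  congr 1
  simp only [Units.val_mul, mul_inv]
  ring


/-! ### Kloosterman sums in two variables -/

/-- `∑ ψ(c₁ x + c₂ y + c₃ / (x y))`. -/
noncomputable def S3 (ψ : AddChar F ℂ) (c d e : F) : ℂ :=
  ∑ x : Fˣ, ∑ y : Fˣ, ψ (c * x + d * y + e * ((x : F)⁻¹ * (y : F)⁻¹))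

theorem S3_unit (c d e : F) (hc : c ≠ 0) (hd : d ≠ 0) : S3 ψ c d e = S3 ψ 1 1 (c * d * e) := by
  unfold S3
  conv_rhs => rw [← sum_mul_units (Units.mk0 c hc)]
  refine Finset.sum_congr rfl fun x _ => ?_
  conv_rhs => rw [← sum_mul_units (Units.mk0 d hd)]
  refine Finset.sum_congr rfl fun y _ => ?_
  congr 1
  have := x.ne_zero
  have := y.ne_zero
  simp only [Units.val_mul, Units.val_mk0]
  field_simp

theorem sum_prod_psi (h : Orth ψ q) (c d : F) : ∑ x : Fˣ, ∑ y : Fˣ, ψ (c * x + d * y)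
    = (q * ind (c = 0) - 1) * (q * ind (d = 0) - 1) := by
  rw [← h.sum, ← h.sum, Finset.sum_mul_sum]
  simp_rw [AddChar.map_add_eq_mul]

theorem S3_zero_right (h : Orth ψ q) (c d : F) : S3 ψ c d 0
    = (q * ind (c = 0) - 1) * (q * ind (d = 0) - 1) := by
  rw [← sum_prod_psi h]
  simp [S3]

theorem S3_swap (c d e : F) : S3 ψ c d e = S3 ψ d c e := by
  unfold S3
  rw [Finset.sum_comm]
  refine Finset.sum_congr rfl fun x _ => Finset.sum_congr rfl fun y _ => ?_
  congr 1; ring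

theorem S3_zero_left (h : Orth ψ q) (d e : F) : S3 ψ 0 d e
    = (q * ind (d = 0) - 1) * (q * ind (e = 0) - 1) := by
  rw [← sum_prod_psi h]
  unfold S3
  rw [Finset.sum_comm]
  refine Finset.sum_congr rfl fun y _ => ?_
  rw [← sum_mul_units y⁻¹ (fun x => ψ (d * y + e * x)),
    ← Fintype.sum_equiv (Equiv.inv Fˣ) _ _ (fun x => rfl)]
  refine Finset.sum_congr rfl fun x _ => ?_
  congr 1
  simp
  left
  ring

/-- Value of `S3` in terms of the basic sum. -/
theorem S3_val (h : Orth ψ q) (a : Fˣ) (c d e : F) (hne : ¬ (c = 0 ∧ d = 0 ∧ e = 0)) :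
    S3 ψ c d (a * e) = ind (c * d * e = 0)
      - q * (ind (c = 0 ∧ d = 0) + ind (c = 0 ∧ e = 0) + ind (d = 0 ∧ e = 0))
      + ∑ u : Fˣ, ind (c * d * e = u) * S3 ψ 1 1 (a * u) := by
  have hz : c * d * e = 0 → ∑ u : Fˣ, ind (c * d * e = u) * S3 ψ 1 1 (a * u) = 0 := by
    intro H
    refine Finset.sum_eq_zero fun u _ => ?_
    rw [ind_false (by rw [H]; exact u.ne_zero.symm), zero_mul]
  by_cases hc : c = 0
  · rw [hz (by rw [hc, zero_mul, zero_mul])]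
    subst hc
    rw [S3_zero_left h]
    by_cases hd : d = 0 <;> by_cases he : e = 0 <;> simp [ind, hd, he]
    exact absurd ⟨rfl, hd, he⟩ hne
  by_cases hd : d = 0
  · rw [hz (by rw [hd, mul_zero, zero_mul])]
    subst hd
    rw [S3_swap, S3_zero_left h]
    by_cases he : e = 0 <;> simp [ind, hc, he]
  by_cases he : e = 0
  · rw [hz (by rw [he, mul_zero])]
    subst he
    rw [mul_zero, S3_zero_right h]
    simp [ind, hc, hd]
  rw [S3_unit _ _ _ hc hd]
  have hcd : c * d * e ≠ 0 := mul_ne_zero (mul_ne_zero hc hd) he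
  have : ∀ u : Fˣ, ind (c * d * e = u) = ind (Units.mk0 (c * d * e) hcd = u) := fun u =>
    ind_congr (by rw [Units.ext_iff]; rfl)
  simp_rw [this]
  rw [sum_ind_eq', ind_false hcd, ind_false (fun H => hc H.1), ind_false (fun H => hc H.1),
    ind_false (fun H => hd H.1)]
  simp only [Units.val_mk0]
  rw [mul_left_comm]; ring

theorem S3_sq (a : F) : S3 ψ 1 1 a ^ 2 = ∑ j : Fˣ × Fˣ,
    S3 ψ (1 + j.1) (1 + j.2) (a * (1 + (j.1 : F)⁻¹ * (j.2 : F)⁻¹)) := by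
  have h1 : S3 ψ 1 1 a = ∑ x : Fˣ × Fˣ,
      ψ (1 * x.1 + 1 * x.2 + a * ((x.1 : F)⁻¹ * (x.2 : F)⁻¹)) := by
    rw [Fintype.sum_prod_type]; rfl
  have h2 : ∀ c d e : F, S3 ψ c d e = ∑ x : Fˣ × Fˣ,
      ψ (c * x.1 + d * x.2 + e * ((x.1 : F)⁻¹ * (x.2 : F)⁻¹)) := by
    intro c d e
    rw [Fintype.sum_prod_type]; rfl
  simp_rw [h2]
  rw [sq, Finset.sum_mul_sum]
  conv_rhs => rw [Finset.sum_comm]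
  refine Finset.sum_congr rfl fun x _ => ?_
  rw [← Fintype.sum_equiv (Equiv.mulLeft x) _ _ (fun t => rfl)]
  refine Finset.sum_congr rfl fun t _ => ?_
  rw [← AddChar.map_add_eq_mul]
  congr 1
  simp only [Equiv.coe_mulLeft, Prod.fst_mul, Prod.snd_mul, Units.val_mul, mul_inv]
  ring

theorem sum_S3 (h : Orth ψ q) (u : Fˣ) : ∑ a : Fˣ, S3 ψ 1 1 (a * u) = -1 := by
  unfold S3
  rw [Finset.sum_comm]
  have : ∀ x y : Fˣ, ∑ a : Fˣ, ψ (1 * x + 1 * y + a * u * ((x : F)⁻¹ * (y : F)⁻¹))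
      = ψ (1 * x + 1 * y) * (-1) := by
    intro x y
    have := h.sum (u * ((x : F)⁻¹ * (y : F)⁻¹))
    rw [ind_false (mul_ne_zero u.ne_zero (mul_ne_zero (inv_ne_zero x.ne_zero)
      (inv_ne_zero y.ne_zero)))] at this
    simp_rw [fun a : Fˣ => AddChar.map_add_eq_mul ψ (1 * (x : F) + 1 * y)
      (a * u * ((x : F)⁻¹ * (y : F)⁻¹))]
    rw [← Finset.mul_sum]
    congr 1
    rw [← zero_sub, ← mul_zero q, ← this]
    exact Finset.sum_congr rfl fun a _ => by congr 1; ring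
  have h2 : ∀ x : Fˣ, ∑ a : Fˣ, ∑ y : Fˣ, ψ (1 * x + 1 * y + a * u * ((x : F)⁻¹ * (y : F)⁻¹))
      = ∑ y : Fˣ, ψ (1 * x + 1 * y) * (-1) := by
    intro x
    rw [Finset.sum_comm]
    exact Finset.sum_congr rfl fun y _ => this x y
  simp_rw [h2, ← Finset.sum_mul]
  rw [sum_prod_psi h, ind_false one_ne_zero]; norm_num

theorem S3_neg (b : F) : S3 ψ 1 1 (-b)
    = ∑ x : Fˣ, ∑ y : Fˣ, ψ (-(x + y + b * ((x : F)⁻¹ * (y : F)⁻¹))) := by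
  unfold S3
  rw [← Fintype.sum_equiv (Equiv.neg Fˣ) _ _ (fun x => rfl)]
  refine Finset.sum_congr rfl fun x _ => ?_
  rw [← Fintype.sum_equiv (Equiv.neg Fˣ) _ _ (fun x => rfl)]
  refine Finset.sum_congr rfl fun y _ => ?_
  congr 1
  simp [inv_neg]
  ring

theorem S3_orth (h : Orth ψ q) (u v : Fˣ) :
    ∑ a : Fˣ, S3 ψ 1 1 (a * u) * S3 ψ 1 1 (-(a * v))
      = q ^ 3 * ind (u = v) - (q ^ 2 + q + 1) := by
  have key : ∀ x y z w : Fˣ, ∑ a : Fˣ,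
      ψ (1 * x + 1 * y + a * u * ((x : F)⁻¹ * (y : F)⁻¹))
        * ψ (-(z + w + a * v * ((z : F)⁻¹ * (w : F)⁻¹)))
      = q * (ind (w = v * u⁻¹ * x * y * z⁻¹) * ψ ((x : F) + y - z - w))
        - ψ (1 * x + 1 * y) * ψ ((-1) * z + (-1) * w) := by
    intro x y z w
    have h1 := h.sum (u * ((x : F)⁻¹ * (y : F)⁻¹) - v * ((z : F)⁻¹ * (w : F)⁻¹))
    have h2 : (u * ((x : F)⁻¹ * (y : F)⁻¹) - v * ((z : F)⁻¹ * (w : F)⁻¹) = 0)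
        ↔ (w = v * u⁻¹ * x * y * z⁻¹) := by
      have := x.ne_zero; have := y.ne_zero; have := u.ne_zero
      have := z.ne_zero; have := w.ne_zero
      rw [Units.ext_iff]
      simp only [Units.val_mul, Units.val_inv_eq_inv_val]
      field_simp
      constructor <;> intro H <;> linear_combination H
    rw [ind_congr h2] at h1
    have : ∀ a : Fˣ, ψ (1 * x + 1 * y + a * u * ((x : F)⁻¹ * (y : F)⁻¹))
        * ψ (-(z + w + a * v * ((z : F)⁻¹ * (w : F)⁻¹)))
        = ψ ((x : F) + y - z - w)
          * ψ ((u * ((x : F)⁻¹ * (y : F)⁻¹) - v * ((z : F)⁻¹ * (w : F)⁻¹)) * a) := by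
      intro a
      rw [← AddChar.map_add_eq_mul, ← AddChar.map_add_eq_mul]
      congr 1; ring
    simp_rw [this]
    rw [← Finset.mul_sum, h1, ← AddChar.map_add_eq_mul]
    rw [show 1 * (x : F) + 1 * y + ((-1) * z + (-1) * w) = (x : F) + y - z - w by ring]
    ring
  have step1 : ∑ a : Fˣ, S3 ψ 1 1 (a * u) * S3 ψ 1 1 (-(a * v))
      = ∑ x : Fˣ, ∑ y : Fˣ, ∑ z : Fˣ, ∑ w : Fˣ,
        (q * (ind (w = v * u⁻¹ * x * y * z⁻¹) * ψ ((x : F) + y - z - w))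
        - ψ (1 * x + 1 * y) * ψ ((-1) * z + (-1) * w)) := by
    simp_rw [← key, S3_neg]
    unfold S3
    simp_rw [Finset.sum_mul, Finset.mul_sum]
    rw [Finset.sum_comm]
    refine Finset.sum_congr rfl fun x _ => ?_
    rw [Finset.sum_comm]
    refine Finset.sum_congr rfl fun y _ => ?_
    rw [Finset.sum_comm]
    refine Finset.sum_congr rfl fun z _ => ?_
    rw [Finset.sum_comm]
  have step2 : ∀ x y : Fˣ, ∑ z : Fˣ, ∑ w : Fˣ,
        (q * (ind (w = v * u⁻¹ * x * y * z⁻¹) * ψ ((x : F) + y - z - w))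
        - ψ (1 * x + 1 * y) * ψ ((-1) * z + (-1) * w))
      = q * (∑ z : Fˣ, ψ ((x : F) + y - z - v * (u : F)⁻¹ * x * y * (z : F)⁻¹))
        - ψ (1 * x + 1 * y) := by
    intro x y
    simp_rw [Finset.sum_sub_distrib, ← Finset.mul_sum]
    rw [sum_prod_psi h, ind_false (by simp)]
    simp_rw [fun z : Fˣ => sum_ind_eq (v * u⁻¹ * x * y * z⁻¹)
      (fun w : Fˣ => ψ ((x : F) + y - z - w))]
    simp
  have step3 : ∀ y z : Fˣ, ∑ x : Fˣ, ψ ((x : F) + y - z - v * (u : F)⁻¹ * x * y * (z : F)⁻¹)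
      = q * (ind (z = v * u⁻¹ * y) * ψ ((y : F) - z)) - ψ (1 * y + (-1) * z) := by
    intro y z
    have h1 := h.sum (1 - v * (u : F)⁻¹ * y * (z : F)⁻¹)
    have h2 : (1 - v * (u : F)⁻¹ * y * (z : F)⁻¹ = 0) ↔ (z = v * u⁻¹ * y) := by
      have := z.ne_zero; have := u.ne_zero
      rw [Units.ext_iff]
      simp only [Units.val_mul, Units.val_inv_eq_inv_val]
      field_simp
      constructor <;> intro H <;> linear_combination H
    rw [ind_congr h2] at h1
    have : ∀ x : Fˣ, ψ ((x : F) + y - z - v * (u : F)⁻¹ * x * y * (z : F)⁻¹)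
        = ψ ((y : F) - z) * ψ ((1 - v * (u : F)⁻¹ * y * (z : F)⁻¹) * x) := by
      intro x
      rw [← AddChar.map_add_eq_mul]
      congr 1; ring
    simp_rw [this]
    rw [← Finset.mul_sum, h1, show 1 * (y : F) + (-1) * z = y - z by ring]
    ring
  rw [step1]
  simp_rw [step2]
  simp_rw [Finset.sum_sub_distrib, ← Finset.mul_sum]
  rw [sum_prod_psi h, ind_false one_ne_zero]
  have step4 : ∑ x : Fˣ, ∑ y : Fˣ, ∑ z : Fˣ,
      ψ ((x : F) + y - z - v * (u : F)⁻¹ * x * y * (z : F)⁻¹)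
      = q * (q * ind (u = v) - 1) - 1 := by
    have : ∑ x : Fˣ, ∑ y : Fˣ, ∑ z : Fˣ,
      ψ ((x : F) + y - z - v * (u : F)⁻¹ * x * y * (z : F)⁻¹)
      = ∑ y : Fˣ, ∑ z : Fˣ, ∑ x : Fˣ,
      ψ ((x : F) + y - z - v * (u : F)⁻¹ * x * y * (z : F)⁻¹) := by
      rw [Finset.sum_comm]
      refine Finset.sum_congr rfl fun y _ => ?_
      rw [Finset.sum_comm]
    rw [this]
    simp_rw [step3]
    simp_rw [Finset.sum_sub_distrib, ← Finset.mul_sum]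
    rw [sum_prod_psi h, ind_false one_ne_zero, ind_false (by simp)]
    simp_rw [fun y : Fˣ => sum_ind_eq (v * u⁻¹ * y) (fun z : Fˣ => ψ ((y : F) - z))]
    have h1 := h.sum (1 - v * (u : F)⁻¹)
    have h2 : (1 - v * (u : F)⁻¹ = 0) ↔ u = v := by
      have := u.ne_zero
      rw [Units.ext_iff]; field_simp; rw [mul_zero, sub_eq_zero]
    rw [ind_congr h2] at h1
    have h3 : ∀ y : Fˣ, ψ ((y : F) - ((v * u⁻¹ * y : Fˣ) : F))
        = ψ ((1 - v * (u : F)⁻¹) * y) := by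
      intro y
      congr 1
      simp only [Units.val_mul, Units.val_inv_eq_inv_val]
      ring
    simp_rw [h3]
    rw [h1]; ring
  rw [step4]; ring

/-! ### Counting -/

theorem sum_ind_units (c : F) : ∑ s : Fˣ, ind ((s : F) = c) = 1 - ind (c = 0) := by
  rw [sum_units_add (fun s => ind (s = c)), sum_ind_one, ind_congr eq_comm]

/-- Number of pairs with `1 + t + s = 0` and `1 + 1/t + 1/s = 0`. -/
noncomputable def eps (F : Type*) [Field F] [Fintype F] [DecidableEq F] : ℂ :=
  ∑ j : Fˣ × Fˣ, ind ((1 + j.1 + j.2 : F) = 0 ∧ (1 + (j.1 : F)⁻¹ + (j.2 : F)⁻¹) = 0)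

theorem eps_eq : eps F = ∑ t : Fˣ, ind ((t : F) ^ 2 + t + 1 = 0) := by
  unfold eps
  rw [Fintype.sum_prod_type]
  refine Finset.sum_congr rfl fun t _ => ?_
  have : ∀ s : Fˣ, ind ((1 + t + s : F) = 0 ∧ (1 + (t : F)⁻¹ + (s : F)⁻¹) = 0)
      = ind (s = t ^ 2) * ind ((t : F) ^ 2 + t + 1 = 0) := by
    intro s
    rw [← ind_and]
    apply ind_congr
    have ht := t.ne_zero
    have hs := s.ne_zero
    rw [Units.ext_iff]
    simp only [Units.val_pow_eq_pow_val]
    constructor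
    · rintro ⟨h1, h2⟩
      field_simp at h2
      constructor
      · linear_combination h1 - h1 * (1 + t) + h2
      · linear_combination h1 * (1 + t) - h2
    · rintro ⟨h1, h2⟩
      constructor
      · rw [h1]; linear_combination h2
      · field_simp
        rw [h1]; linear_combination h2 * t
  simp_rw [this]
  exact sum_ind_eq (t ^ 2) (fun _ => ind ((t : F) ^ 2 + t + 1 = 0))

theorem eps_val (h3 : (3 : F) ≠ 0) : eps F * (eps F - 2) = 0 := by
  rw [eps_eq]
  by_cases hr : ∃ r : Fˣ, (r : F) ^ 2 + r + 1 = 0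
  · obtain ⟨r, hr⟩ := hr
    have hne : r ≠ r ^ 2 := by
      intro H
      have : r = 1 := by
        have h2 : r * 1 = r * r := by rw [mul_one, ← sq]; exact H
        exact (mul_left_cancel h2).symm
      rw [this] at hr
      apply h3
      simp at hr
      linear_combination hr
    have : ∀ t : Fˣ, ind ((t : F) ^ 2 + t + 1 = 0) = ind (t = r) + ind (t = r ^ 2) := by
      intro t
      by_cases h1 : t = r
      · rw [ind_true h1, h1, ind_true hr, ind_false hne, add_zero]
      · by_cases h2 : t = r ^ 2
        · rw [ind_true h2, ind_false h1, ind_true, zero_add]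
          rw [h2]
          simp only [Units.val_pow_eq_pow_val]
          linear_combination ((r : F) ^ 2 - r + 1) * hr
        · rw [ind_false h1, ind_false h2, ind_false, zero_add]
          intro H
          have : ((t : F) - r) * (t - r ^ 2) = 0 := by
            linear_combination H - (1 + (t : F) - r) * hr - hr + hr
          rcases mul_eq_zero.mp this with H1 | H1
          · exact h1 (Units.ext (sub_eq_zero.mp H1))
          · exact h2 (Units.ext (by simpa using sub_eq_zero.mp H1))
    simp_rw [this]
    rw [Finset.sum_add_distrib, sum_ind_one, sum_ind_one]
    norm_num
  · have : ∀ t : Fˣ, ind ((t : F) ^ 2 + t + 1 = 0) = 0 := fun t =>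
      ind_false fun H => hr ⟨t, H⟩
    simp [this]

/-- `(1 + t + s)(1 + 1/t + 1/s)`. -/
noncomputable def g2 (j : Fˣ × Fˣ) : F := (1 + j.1 + j.2) * (1 + (j.1 : F)⁻¹ + (j.2 : F)⁻¹)

/-- `(1 + t)(1 + s)(1 + 1/(ts))`. -/
noncomputable def g3 (j : Fˣ × Fˣ) : F :=
  (1 + j.1) * (1 + j.2) * (1 + (j.1 : F)⁻¹ * (j.2 : F)⁻¹)

theorem cnt_g3 (u : F) : cnt (g3 (F := F)) u = cnt (g2 (F := F)) (u + 1) := by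
  unfold cnt
  rw [Fintype.sum_prod_type, Fintype.sum_prod_type]
  refine Finset.sum_congr rfl fun t _ => ?_
  rw [← sum_mul_units t⁻¹]
  refine Finset.sum_congr rfl fun s _ => ?_
  apply ind_congr
  have : g3 (t, t⁻¹ * s) = g2 (t, s) - 1 := by
    have ht := t.ne_zero
    have hs := s.ne_zero
    simp only [g3, g2, Units.val_mul, Units.val_inv_eq_inv_val]
    field_simp
    ring
  rw [this, sub_eq_iff_eq_add]

theorem sum_const_units {ψ : AddChar F ℂ} (h : Orth ψ q) (c : ℂ) : ∑ _t : Fˣ, c = (q - 1) * c := by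
  rw [Finset.sum_const, Finset.card_univ, nsmul_eq_mul, h.card]

theorem sum_lin (h : Orth ψ q) : ∑ j : Fˣ × Fˣ, ind ((1 + j.1 + j.2 : F) = 0) = q - 2 := by
  rw [Fintype.sum_prod_type]
  have : ∀ t s : Fˣ, ind ((1 + t + s : F) = 0) = ind ((s : F) = -(1 + t)) := fun t s =>
    ind_congr (by rw [add_eq_zero_iff_eq_neg']; )
  simp_rw [this, sum_ind_units]
  have h2 : ∀ t : Fˣ, ind (-(1 + t : F) = 0) = ind ((t : F) = -1) := fun t =>
    ind_congr (by rw [neg_eq_zero, add_eq_zero_iff_eq_neg'])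
  simp_rw [h2]
  rw [Finset.sum_sub_distrib, sum_ind_units, sum_const_units h, ind_false (by simp)]
  ring

theorem sum_lin' (h : Orth ψ q) :
    ∑ j : Fˣ × Fˣ, ind ((1 + (j.1 : F)⁻¹ + (j.2 : F)⁻¹ : F) = 0) = q - 2 := by
  rw [← sum_lin h]
  exact Fintype.sum_equiv (Equiv.inv (Fˣ × Fˣ)) _ _ (fun j => by simp)

theorem cnt_g2_zero (h : Orth ψ q) : cnt (g2 (F := F)) 0 = 2 * (q - 2) - eps F := by
  have : ∀ j : Fˣ × Fˣ, ind (g2 j = 0) = ind ((1 + j.1 + j.2 : F) = 0)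
      + ind ((1 + (j.1 : F)⁻¹ + (j.2 : F)⁻¹ : F) = 0)
      - ind ((1 + j.1 + j.2 : F) = 0 ∧ (1 + (j.1 : F)⁻¹ + (j.2 : F)⁻¹) = 0) := by
    intro j
    rw [g2, ind_congr mul_eq_zero]
    by_cases h1 : (1 + j.1 + j.2 : F) = 0 <;>
    by_cases h2 : (1 + (j.1 : F)⁻¹ + (j.2 : F)⁻¹ : F) = 0 <;> simp [ind, h1, h2]
  unfold cnt
  simp_rw [this]
  rw [Finset.sum_sub_distrib, Finset.sum_add_distrib, sum_lin h, sum_lin' h, eps]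
  ring

theorem one_add_iff (t : Fˣ) : (1 + t : F) = 0 ↔ t = -1 := by
  rw [add_eq_zero_iff_eq_neg', Units.ext_iff]; simp

theorem one_add_inv_iff (t s : Fˣ) : (1 + (t : F)⁻¹ * (s : F)⁻¹ : F) = 0 ↔ s = -t⁻¹ := by
  have ht := t.ne_zero
  have hs := s.ne_zero
  rw [Units.ext_iff]
  simp only [Units.val_neg, Units.val_inv_eq_inv_val]
  field_simp
  constructor <;> intro H <;> linear_combination H

theorem g3_ne (h2 : (2 : F) ≠ 0) (j : Fˣ × Fˣ) :
    ¬ ((1 + j.1 : F) = 0 ∧ (1 + j.2 : F) = 0 ∧ (1 + (j.1 : F)⁻¹ * (j.2 : F)⁻¹ : F) = 0) := by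
  rintro ⟨a, b, c⟩
  rw [add_eq_zero_iff_eq_neg'] at a b
  rw [a, b] at c
  apply h2
  rw [← c]
  norm_num

theorem pairs_val :
    ∑ j : Fˣ × Fˣ, (ind ((1 + j.1 : F) = 0 ∧ (1 + j.2 : F) = 0)
      + ind ((1 + j.1 : F) = 0 ∧ (1 + (j.1 : F)⁻¹ * (j.2 : F)⁻¹ : F) = 0)
      + ind ((1 + j.2 : F) = 0 ∧ (1 + (j.1 : F)⁻¹ * (j.2 : F)⁻¹ : F) = 0)) = 3 := by
  rw [Fintype.sum_prod_type]
  have e1 : ∀ t s : Fˣ, ind ((1 + t : F) = 0 ∧ (1 + s : F) = 0) = ind (s = -1) * ind (t = -1) := by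
    intro t s
    rw [ind_and, ind_congr (one_add_iff t), ind_congr (one_add_iff s), mul_comm]
  have e2 : ∀ t s : Fˣ, ind ((1 + t : F) = 0 ∧ (1 + (t : F)⁻¹ * (s : F)⁻¹ : F) = 0)
      = ind (s = - t⁻¹) * ind (t = -1) := by
    intro t s
    rw [ind_and, ind_congr (one_add_iff t), ind_congr (one_add_inv_iff t s), mul_comm]
  have e3 : ∀ t s : Fˣ, ind ((1 + s : F) = 0 ∧ (1 + (t : F)⁻¹ * (s : F)⁻¹ : F) = 0)
      = ind (s = -1) * ind (t = 1) := by
    intro t s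
    rw [← ind_and, ind_congr (and_congr (one_add_iff s) (one_add_inv_iff t s))]
    apply ind_congr
    constructor
    · rintro ⟨rfl, h⟩
      refine ⟨rfl, ?_⟩
      rw [neg_inj] at h
      rw [← inv_inv t, ← h, inv_one]
    · rintro ⟨rfl, rfl⟩
      simp
  simp_rw [e1, e2, e3, Finset.sum_add_distrib, ← Finset.sum_mul, sum_ind_one, one_mul, sum_ind_one]
  norm_num

theorem cnt_g3_zero (h : Orth ψ q) (h2 : (2 : F) ≠ 0) : cnt (g3 (F := F)) 0 = 3 * q - 6 := by
  have : ∀ j : Fˣ × Fˣ, ind (g3 j = 0) = ind (j.1 = -1) + ind (j.2 = -1) + ind (j.2 = -j.1⁻¹)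
      - (ind ((1 + j.1 : F) = 0 ∧ (1 + j.2 : F) = 0)
      + ind ((1 + j.1 : F) = 0 ∧ (1 + (j.1 : F)⁻¹ * (j.2 : F)⁻¹ : F) = 0)
      + ind ((1 + j.2 : F) = 0 ∧ (1 + (j.1 : F)⁻¹ * (j.2 : F)⁻¹ : F) = 0)) := by
    intro j
    have hne := g3_ne h2 j
    rw [g3, ind_congr mul_eq_zero, ind_congr (or_congr_left mul_eq_zero),
      ← ind_congr (one_add_iff j.1), ← ind_congr (one_add_iff j.2),
      ← ind_congr (one_add_inv_iff j.1 j.2)]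
    by_cases h1 : (1 + j.1 : F) = 0 <;> by_cases h2 : (1 + j.2 : F) = 0 <;>
    by_cases h3 : (1 + (j.1 : F)⁻¹ * (j.2 : F)⁻¹ : F) = 0
    · exact absurd ⟨h1, h2, h3⟩ hne
    all_goals simp only [ind, h1, h2, h3]; norm_num
  unfold cnt
  simp_rw [this]
  rw [Finset.sum_sub_distrib, pairs_val, Finset.sum_add_distrib, Finset.sum_add_distrib]
  simp_rw [Fintype.sum_prod_type]
  simp_rw [sum_ind_one]
  rw [Finset.sum_comm]
  simp_rw [sum_ind_one]
  rw [sum_const_units h]; ring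

/-! ### Moments -/

theorem S3_sq_val (h : Orth ψ q) (h2 : (2 : F) ≠ 0) (a : Fˣ) :
    S3 ψ 1 1 a ^ 2 = -6 + ∑ u : Fˣ, cnt (g3 (F := F)) u * S3 ψ 1 1 (a * u) := by
  rw [S3_sq, Finset.sum_congr rfl fun j _ => S3_val h a _ _ _ (g3_ne h2 j)]
  rw [Finset.sum_add_distrib, Finset.sum_sub_distrib, ← Finset.mul_sum, pairs_val,
    Finset.sum_comm]
  have h0 := cnt_g3_zero h h2
  unfold cnt g3 at h0
  rw [h0]
  simp_rw [cnt, g3, Finset.sum_mul]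
  ring

theorem card_J (h : Orth ψ q) : (Fintype.card (Fˣ × Fˣ) : ℂ) = (q - 1) ^ 2 := by
  rw [Fintype.card_prod, Nat.cast_mul, h.card]; ring

theorem fourth_S3 (h : Orth ψ q) (h2 : (2 : F) ≠ 0) :
    ∑ a : Fˣ, S3 ψ 1 1 a ^ 2 * S3 ψ 1 1 (-a) ^ 2
      = (q - 1) * 36 + 12 * ((q - 1) ^ 2 - (3 * q - 6))
        + q ^ 3 * ∑ u : Fˣ, cnt (g3 (F := F)) u ^ 2
        - (q ^ 2 + q + 1) * ((q - 1) ^ 2 - (3 * q - 6)) ^ 2 := by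
  have e : ∀ a : Fˣ, S3 ψ 1 1 (-a) ^ 2
      = -6 + ∑ u : Fˣ, cnt (g3 (F := F)) u * S3 ψ 1 1 (-(a * u)) := by
    intro a
    have := S3_sq_val h h2 (-a)
    simpa [neg_mul] using this
  have hT : ∑ u : Fˣ, cnt (g3 (F := F)) u = (q - 1) ^ 2 - (3 * q - 6) := by
    rw [sum_units_add, sum_cnt, card_J h, cnt_g3_zero h h2]
  simp_rw [S3_sq_val h h2, e]
  have hm := abstract_moment (q := q) (fun a u : Fˣ => S3 ψ 1 1 (a * u))
    (fun a u : Fˣ => S3 ψ 1 1 (-(a * u))) (-6) (-1) (q ^ 3) (q ^ 2 + q + 1)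
    (fun u => cnt (g3 (F := F)) u) h.card (sum_S3 h)
    (fun u => by
      have := sum_S3 h (-u)
      simpa using this) (S3_orth h)
  rw [hm, hT]; ring

theorem third_S3 (h : Orth ψ q) (h2 : (2 : F) ≠ 0) :
    ∑ a : Fˣ, S3 ψ 1 1 a ^ 3
      = 6 + q ^ 3 * cnt (g2 (F := F)) 0 - (q ^ 2 + q + 1) * ((q - 1) ^ 2 - (3 * q - 6)) := by
  have hT : ∑ u : Fˣ, cnt (g3 (F := F)) u = (q - 1) ^ 2 - (3 * q - 6) := by
    rw [sum_units_add, sum_cnt, card_J h, cnt_g3_zero h h2]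
  have e : ∀ a : Fˣ, S3 ψ 1 1 a ^ 3 = (-6) * S3 ψ 1 1 (a * ((1 : Fˣ) : F))
      + ∑ u : Fˣ, cnt (g3 (F := F)) u * (S3 ψ 1 1 (a * u) * S3 ψ 1 1 (-(a * ((-1 : Fˣ) : F)))) := by
    intro a
    rw [pow_succ, S3_sq_val h h2, add_mul, Finset.sum_mul]
    simp [mul_assoc]
  simp_rw [e]
  rw [Finset.sum_add_distrib, ← Finset.mul_sum, sum_S3 h, Finset.sum_comm]
  simp_rw [← Finset.mul_sum, S3_orth h]
  have e2 : ∀ u : Fˣ, cnt (g3 (F := F)) u * (q ^ 3 * ind (u = -1) - (q ^ 2 + q + 1))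
      = q ^ 3 * (ind (u = -1) * cnt (g3 (F := F)) u)
        - (q ^ 2 + q + 1) * cnt (g3 (F := F)) u := fun u => by ring
  simp_rw [e2]
  rw [Finset.sum_sub_distrib, ← Finset.mul_sum, ← Finset.mul_sum, hT,
    sum_ind_eq (-1 : Fˣ) (fun u : Fˣ => cnt (g3 (F := F)) u), cnt_g3]
  simp
  ring

theorem sixth_S2 (h : Orth ψ q) :
    ∑ a : Fˣ, S2 ψ 1 a ^ 6
      = (q - 1) * (q * eps F - cnt (g2 (F := F)) 0) ^ 2
        + 2 * (q * eps F - cnt (g2 (F := F)) 0) * ((q - 1) ^ 2 - cnt (g2 (F := F)) 0)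
        + q ^ 2 * ∑ u : Fˣ, cnt (g2 (F := F)) u ^ 2
        - (q + 1) * ((q - 1) ^ 2 - cnt (g2 (F := F)) 0) ^ 2 := by
  have e : ∀ a : Fˣ, S2 ψ 1 a ^ 3 = (q * eps F - cnt (g2 (F := F)) 0)
      + ∑ u : Fˣ, cnt (g2 (F := F)) u * S2 ψ 1 (a * u) := by
    intro a
    rw [S2_cube, S2_sum h]
    rfl
  have hT : ∑ u : Fˣ, cnt (g2 (F := F)) u = (q - 1) ^ 2 - cnt (g2 (F := F)) 0 := by
    rw [sum_units_add, sum_cnt, card_J h]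
  have hm := abstract_moment (q := q) (fun a u : Fˣ => S2 ψ 1 (a * u))
    (fun a u : Fˣ => S2 ψ 1 (a * u)) (q * eps F - cnt (g2 (F := F)) 0) 1 (q ^ 2) (q + 1)
    (fun u => cnt (g2 (F := F)) u) h.card (sum_S2 h) (sum_S2 h) (S2_orth h)
  rw [hT] at hm
  rw [show ∑ a : Fˣ, S2 ψ 1 a ^ 6 = ∑ a : Fˣ, S2 ψ 1 a ^ 3 * S2 ψ 1 a ^ 3 from
    Finset.sum_congr rfl fun a _ => by ring]
  simp_rw [e]
  rw [hm]; ring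

/-- `(1 + t)(1 + 1/t)`. -/
noncomputable def g1 (t : Fˣ) : F := (1 + t) * (1 + (t : F)⁻¹)

theorem g1_zero (t : Fˣ) : g1 t = 0 ↔ t = -1 := by
  have ht := t.ne_zero
  rw [← one_add_iff, g1, mul_eq_zero]
  constructor
  · rintro (H | H)
    · exact H
    · field_simp at H; linear_combination H
  · exact Or.inl

theorem cnt_g1_zero : cnt (g1 (F := F)) 0 = 1 := by
  unfold cnt
  simp_rw [fun t : Fˣ => ind_congr (g1_zero t), sum_ind_one]

theorem cnt_g1_sq (h : Orth ψ q) (h2 : (2 : F) ≠ 0) :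
    ∑ u : F, cnt (g1 (F := F)) u ^ 2 = 2 * q - 4 := by
  have e1 : ∀ u : F, cnt (g1 (F := F)) u ^ 2
      = ∑ t : Fˣ, ∑ s : Fˣ, ind (g1 t = u) * ind (g1 s = u) := by
    intro u
    rw [sq, cnt, Finset.sum_mul_sum]
  simp_rw [e1]
  rw [Finset.sum_comm]
  have e2 : ∀ t : Fˣ, ∑ u : F, ∑ s : Fˣ, ind (g1 t = u) * ind (g1 s = u)
      = 2 - (ind (t = 1) + ind (t = -1)) := by
    intro t
    rw [Finset.sum_comm]
    simp_rw [sum_ind_eq']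
    have : ∀ s : Fˣ, ind (g1 s = g1 t) = ind (s = t) + ind (s = t⁻¹)
        - ind (s = t) * (ind (t = 1) + ind (t = -1)) := by
      intro s
      have ht := t.ne_zero
      have hs := s.ne_zero
      have k1 : g1 s = g1 t ↔ s = t ∨ s = t⁻¹ := by
        simp only [g1, Units.ext_iff, Units.val_inv_eq_inv_val]
        constructor
        · intro H
          field_simp at H
          have : ((s : F) - t) * (s * t - 1) = 0 := by linear_combination H
          rcases mul_eq_zero.mp this with H | H
          · left; exact sub_eq_zero.mp H
          · right; field_simp; linear_combination H
        · rintro (H | H)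
          · rw [H]
          · rw [H, inv_inv, mul_comm]
      by_cases hst : s = t
      · have k2 : ind (t = t⁻¹) = ind (t = 1) + ind (t = -1) := by
          have k3 : t = t⁻¹ ↔ t = 1 ∨ t = -1 := by
            simp only [Units.ext_iff, Units.val_inv_eq_inv_val, Units.val_one, Units.val_neg]
            rw [← sq_eq_one_iff]
            field_simp
          rw [ind_congr k3]
          by_cases h1 : t = 1
          · have h3 : t ≠ -1 := by
              rw [h1, Ne, Units.ext_iff]
              intro H
              apply h2
              simp at H
              linear_combination H
            rw [ind_true (Or.inl h1), ind_true h1, ind_false h3, add_zero]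
          · rw [ind_false h1, zero_add]
            apply ind_congr
            simp [h1]
        rw [ind_true (by rw [hst]), ind_true hst, hst, k2]; ring
      · rw [ind_congr k1, ind_false hst]
        simp [hst]
    simp_rw [this]
    rw [Finset.sum_sub_distrib, Finset.sum_add_distrib, ← Finset.sum_mul]
    simp_rw [sum_ind_one]
    ring
  simp_rw [e2]
  rw [Finset.sum_sub_distrib, Finset.sum_add_distrib, sum_const_units h, sum_ind_one, sum_ind_one]
  ring

theorem fourth_S2 (h : Orth ψ q) (h2 : (2 : F) ≠ 0) :
    ∑ a : Fˣ, S2 ψ 1 a ^ 4 = 2 * q ^ 3 - 3 * q ^ 2 - 3 * q - 1 := by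
  have e0 : ∑ t : Fˣ, ind ((1 + t : F) = 0 ∧ (1 + (t : F)⁻¹ : F) = 0) = 1 := by
    rw [← sum_ind_one (-1 : Fˣ)]
    refine Finset.sum_congr rfl fun t _ => ind_congr ?_
    rw [← one_add_iff]
    refine ⟨fun H => H.1, fun H => ⟨H, ?_⟩⟩
    have ht := t.ne_zero
    field_simp
    linear_combination H
  have e : ∀ a : Fˣ, S2 ψ 1 a ^ 2 = (q - 1)
      + ∑ u : Fˣ, cnt (g1 (F := F)) u * S2 ψ 1 (a * u) := by
    intro a
    have h0 := cnt_g1_zero (F := F)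
    unfold cnt g1 at h0
    rw [S2_sq, S2_sum h, e0, cnt, h0, mul_one]
    rfl
  have hT : ∑ u : Fˣ, cnt (g1 (F := F)) u = q - 2 := by
    rw [sum_units_add, sum_cnt, h.card, cnt_g1_zero]; ring
  have hT2 : ∑ u : Fˣ, cnt (g1 (F := F)) u ^ 2 = 2 * q - 5 := by
    rw [sum_units_add (fun u => cnt (g1 (F := F)) u ^ 2), cnt_g1_sq h h2, cnt_g1_zero]; ring
  have hm := abstract_moment (q := q) (fun a u : Fˣ => S2 ψ 1 (a * u))
    (fun a u : Fˣ => S2 ψ 1 (a * u)) (q - 1) 1 (q ^ 2) (q + 1)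
    (fun u => cnt (g1 (F := F)) u) h.card (sum_S2 h) (sum_S2 h) (S2_orth h)
  rw [hT, hT2] at hm
  rw [show ∑ a : Fˣ, S2 ψ 1 a ^ 4 = ∑ a : Fˣ, S2 ψ 1 a ^ 2 * S2 ψ 1 a ^ 2 from
    Finset.sum_congr rfl fun a _ => by ring]
  simp_rw [e]
  rw [hm]; ring

theorem second_S2 (h : Orth ψ q) : ∑ a : Fˣ, S2 ψ 1 a ^ 2 = q ^ 2 - q - 1 := by
  have := S2_orth h 1 1
  rw [ind_true rfl] at this
  simp only [Units.val_one, mul_one] at this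
  simp_rw [sq (S2 ψ 1 _)]
  rw [this]; ring

theorem sum_sq_rel : ∑ u : Fˣ, cnt (g3 (F := F)) u ^ 2 + cnt (g3 (F := F)) 0 ^ 2
    = ∑ u : Fˣ, cnt (g2 (F := F)) u ^ 2 + cnt (g2 (F := F)) 0 ^ 2 := by
  rw [sum_units_add (fun u => cnt (g3 (F := F)) u ^ 2),
    sum_units_add (fun u => cnt (g2 (F := F)) u ^ 2), sub_add_cancel, sub_add_cancel]
  exact Fintype.sum_equiv (Equiv.addRight (1 : F)) _ _ (fun u => by rw [cnt_g3]; rfl)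

theorem main_identity (h : Orth ψ q) (h2 : (2 : F) ≠ 0) (h3 : (3 : F) ≠ 0) :
    ∑ a : Fˣ, ((S3 ψ 1 1 a ^ 2 - q * S3 ψ 1 1 (-a)) * ((q * S3 ψ 1 1 (-a)) ^ 2
      - q ^ 3 * S3 ψ 1 1 a) - q ^ 3 * S3 ψ 1 1 a * (q * S3 ψ 1 1 (-a)))
    = q ^ 3 * ∑ a : Fˣ, (S2 ψ 1 a ^ 6 - 5 * q * S2 ψ 1 a ^ 4 + 6 * q ^ 2 * S2 ψ 1 a ^ 2 - q ^ 3)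
      - 2 * q ^ 6 - 2 * q ^ 4 - q ^ 2 := by
  have hneg : ∑ a : Fˣ, S3 ψ 1 1 (-a) ^ 3 = ∑ a : Fˣ, S3 ψ 1 1 a ^ 3 :=
    Fintype.sum_equiv (Equiv.neg Fˣ) _ _ (fun a => by simp)
  have e1 : ∀ a : Fˣ, (S3 ψ 1 1 a ^ 2 - q * S3 ψ 1 1 (-a)) * ((q * S3 ψ 1 1 (-a)) ^ 2
      - q ^ 3 * S3 ψ 1 1 a) - q ^ 3 * S3 ψ 1 1 a * (q * S3 ψ 1 1 (-a))
      = q ^ 2 * (S3 ψ 1 1 a ^ 2 * S3 ψ 1 1 (-a) ^ 2) - q ^ 3 * S3 ψ 1 1 a ^ 3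
        - q ^ 3 * S3 ψ 1 1 (-a) ^ 3 := fun a => by ring
  simp_rw [e1]
  rw [Finset.sum_sub_distrib, Finset.sum_sub_distrib, ← Finset.mul_sum, ← Finset.mul_sum,
    ← Finset.mul_sum, hneg, Finset.sum_sub_distrib, Finset.sum_add_distrib,
    Finset.sum_sub_distrib, ← Finset.mul_sum, ← Finset.mul_sum, sum_const_units h,
    fourth_S3 h h2, third_S3 h h2, sixth_S2 h, fourth_S2 h h2, second_S2 h]
  have r1 := sum_sq_rel (F := F)
  have r2 := eps_val h3
  rw [cnt_g3_zero h h2, cnt_g2_zero h] at r1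
  rw [cnt_g2_zero h]
  linear_combination q ^ 5 * r1 - q ^ 6 * r2

end Helpers

theorem orth_std (p : ℕ) [Fact p.Prime] : Orth (ZMod.stdAddChar (N := p)) (p : ℂ) where
  card := by
    rw [ZMod.card_units, Nat.cast_sub (Fact.out : p.Prime).one_le, Nat.cast_one]
  sum c := by
    rw [sum_units_add (fun x => ZMod.stdAddChar (N := p) (c * x))]
    have := AddChar.sum_mulShift c (ZMod.isPrimitive_stdAddChar p)
    simp_rw [mul_comm c, this]
    by_cases hc : c = 0 <;> simp [ind, hc, ZMod.card]

theorem exp_eq_std (p : ℕ) [Fact p.Prime] (x : ZMod p) :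
    Complex.exp (2 * (Real.pi : ℂ) * Complex.I *
      ((Algebra.trace (ZMod p) (ZMod p) x).val : ℂ) / (p : ℂ)) = ZMod.stdAddChar x := by
  rw [Algebra.trace_self_apply, ZMod.stdAddChar_apply, ZMod.toCircle_apply]

theorem sum_equiv_any {α β : Type*} (i : Fintype α) (j : Fintype β) (e : α ≃ β) (f : α → ℂ)
    (g : β → ℂ) (h : ∀ x, f x = g (e x)) : ∑ x, f x = ∑ y, g y :=
  Fintype.sum_equiv e f g h

theorem Kl_two (p : ℕ) [Fact p.Prime] (a : (ZMod p)ˣ) :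
    Kl p (ZMod p) 2 a = S3 (ZMod.stdAddChar (N := p)) 1 1 a := by
  unfold Kl S3
  rw [← Fintype.sum_prod_type' (f := fun x y : (ZMod p)ˣ => ZMod.stdAddChar (N := p)
    (1 * (x : ZMod p) + 1 * y + a * ((x : ZMod p)⁻¹ * (y : ZMod p)⁻¹)))]
  refine sum_equiv_any _ _ (finTwoArrowEquiv _) _ _ (fun x => ?_)
  rw [exp_eq_std]
  congr 1
  rw [Fin.sum_univ_two, Fin.prod_univ_two]
  simp only [finTwoArrowEquiv_apply, Units.val_mul, Units.val_inv_eq_inv_val, mul_inv, one_mul]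
  rfl

theorem Kl_one (p : ℕ) [Fact p.Prime] (a : (ZMod p)ˣ) :
    Kl p (ZMod p) 1 a = S2 (ZMod.stdAddChar (N := p)) 1 a := by
  unfold Kl S2
  refine sum_equiv_any _ _ (Equiv.funUnique (Fin 1) _) _ _ (fun x => ?_)
  rw [exp_eq_std]
  congr 1
  rw [Fin.sum_univ_one, Fin.prod_univ_one]
  simp only [Equiv.funUnique_apply, Units.val_mul, Units.val_inv_eq_inv_val, one_mul]
  rfl

theorem m322_eq_m26 :
    ∀ (p : ℕ) [Fact p.Prime], p ≠ 2 → p ≠ 3 →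
      m322 p = (p : ℂ) ^ 3 * m26 p - 2 * (p : ℂ) ^ 6 - 2 * (p : ℂ) ^ 4 - (p : ℂ) ^ 2 := by
  intro p hp h2 h3
  have hP : p.Prime := hp.out
  have h2' : (2 : ZMod p) ≠ 0 := by
    intro H
    have : ((2 : ℕ) : ZMod p) = 0 := by exact_mod_cast H
    rw [ZMod.natCast_eq_zero_iff] at this
    exact h2 ((Nat.prime_dvd_prime_iff_eq hP Nat.prime_two).mp this)
  have h3' : (3 : ZMod p) ≠ 0 := by
    intro H
    have : ((3 : ℕ) : ZMod p) = 0 := by exact_mod_cast H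
    rw [ZMod.natCast_eq_zero_iff] at this
    exact h3 ((Nat.prime_dvd_prime_iff_eq hP Nat.prime_three).mp this)
  have := main_identity (orth_std p) h2' h3'
  simp only [m322, m26, s₁, s₂, Kcl, Kl_two, Kl_one, Units.val_neg]
  exact this
end

section
/- The subgroup G₆₄₈ of GL₃(ℂ) generated by the matrices S, T, V and U is a finite group of order 648, and every normal subgroup of G₆₄₈ has order belonging to the set {1, 3, 27, 54, 216, 648}; in particular, G₆₄₈ has no normal subgroup of order 81. -/
open Matrix
open scoped MatrixGroups

/-- `ζ₉ = exp(2πi/9)`. -/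
noncomputable def ζ₉ : ℂ := Complex.exp (2 * (Real.pi : ℂ) * Complex.I / 9)

/-- `ω = ζ₉⁶`, a primitive cube root of unity. -/
noncomputable def ω : ℂ := ζ₉ ^ 6

/-- `ε = ζ₉⁴`. -/
noncomputable def ε : ℂ := ζ₉ ^ 4

/-- `S = diag(1, ω, ω²)`. -/
noncomputable def Smat : Matrix (Fin 3) (Fin 3) ℂ := !![1, 0, 0; 0, ω, 0; 0, 0, ω ^ 2]

/-- `T`, the cyclic permutation matrix with rows `(0,1,0), (0,0,1), (1,0,0)`. -/
noncomputable def Tmat : Matrix (Fin 3) (Fin 3) ℂ := !![0, 1, 0; 0, 0, 1; 1, 0, 0]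

/-- `U = diag(ε, ε, εω)`. -/
noncomputable def Umat : Matrix (Fin 3) (Fin 3) ℂ := !![ε, 0, 0; 0, ε, 0; 0, 0, ε * ω]

/-- `V = (ω − ω²)⁻¹·[[1,1,1],[1,ω,ω²],[1,ω²,ω]]`. -/
noncomputable def Vmat : Matrix (Fin 3) (Fin 3) ℂ :=
  (ω - ω ^ 2)⁻¹ • !![1, 1, 1; 1, ω, ω ^ 2; 1, ω ^ 2, ω]

/-- `G₁₀₈`, the subgroup of `GL₃(ℂ)` generated by `S`, `T` and `V`. -/
noncomputable def G108 : Subgroup (GL (Fin 3) ℂ) :=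
  Subgroup.closure {g : GL (Fin 3) ℂ |
    (g : Matrix (Fin 3) (Fin 3) ℂ) = Smat ∨ (g : Matrix (Fin 3) (Fin 3) ℂ) = Tmat ∨
      (g : Matrix (Fin 3) (Fin 3) ℂ) = Vmat}

/-- `G₂₁₆`, the subgroup of `GL₃(ℂ)` generated by `S`, `T`, `V` and `UVU⁻¹`. -/
noncomputable def G216 : Subgroup (GL (Fin 3) ℂ) :=
  Subgroup.closure {g : GL (Fin 3) ℂ |
    (g : Matrix (Fin 3) (Fin 3) ℂ) = Smat ∨ (g : Matrix (Fin 3) (Fin 3) ℂ) = Tmat ∨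
      (g : Matrix (Fin 3) (Fin 3) ℂ) = Vmat ∨
      (g : Matrix (Fin 3) (Fin 3) ℂ) = Umat * Vmat * Umat⁻¹}

/-- `G₆₄₈`, the subgroup of `GL₃(ℂ)` generated by `S`, `T`, `V` and `U`. -/
noncomputable def G648 : Subgroup (GL (Fin 3) ℂ) :=
  Subgroup.closure {g : GL (Fin 3) ℂ |
    (g : Matrix (Fin 3) (Fin 3) ℂ) = Smat ∨ (g : Matrix (Fin 3) (Fin 3) ℂ) = Tmat ∨
      (g : Matrix (Fin 3) (Fin 3) ℂ) = Vmat ∨ (g : Matrix (Fin 3) (Fin 3) ℂ) = Umat}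

/-- `D₁`, the subgroup of `GL₃(ℂ)` generated by `S` and `T`. -/
noncomputable def D1 : Subgroup (GL (Fin 3) ℂ) :=
  Subgroup.closure {g : GL (Fin 3) ℂ |
    (g : Matrix (Fin 3) (Fin 3) ℂ) = Smat ∨ (g : Matrix (Fin 3) (Fin 3) ℂ) = Tmat}


abbrev F3 := ZMod 3
abbrev SL23 := Matrix.SpecialLinearGroup (Fin 2) (ZMod 3)

def su : SL23 := ⟨!![1, -1; 0, 1], by decide⟩
def sv : SL23 := ⟨!![0, -1; 1, 0], by decide⟩

set_option maxRecDepth 100000 in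
theorem SL23_card : Fintype.card SL23 = 24 := by decide +kernel

set_option maxRecDepth 100000 in
theorem SL23_word : ∀ m : SL23, ∃ a b c d : Fin 3,
    m = su ^ a.val * (sv * su * sv⁻¹) ^ b.val * su ^ c.val * (sv * su * sv⁻¹) ^ d.val := by
  decide +kernel

set_option maxRecDepth 100000 in
theorem SL23_order3 : ∀ m : SL23, m ^ 4 ≠ 1 → ∃ g : SL23, g * m ^ 4 * g⁻¹ = su ∨ 
   g * m ^ 4 * g⁻¹ = su⁻¹ := by
  decide +kernel

set_option maxRecDepth 100000 in
theorem SL23_order4 : ∀ m x : SL23, m ^ 4 = 1 → m ^ 2 ≠ 1 → x ^ 4 = 1 →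
    x = 1 ∨ x = m ^ 2 ∨ ∃ g : SL23, g * m * g⁻¹ = x := by
  decide +kernel

set_option maxRecDepth 100000 in
theorem SL23_order2 : ∀ m : SL23, m ^ 2 = 1 → m = 1 ∨ m = -1 := by
  decide +kernel

set_option maxRecDepth 100000 in
theorem SL23_Q8_card : Fintype.card {x : SL23 // x ^ 4 = 1} = 8 := by
  decide +kernel

set_option maxRecDepth 100000 in
theorem SL23_trans : ∀ v w : Fin 2 → F3, v ≠ 0 → w ≠ 0 → ∃ m : SL23, m.1 *ᵥ v = w := by
  decide +kernel

theorem SL23_top (K : Subgroup SL23) (hu : su ∈ K) (hv : sv * su * sv⁻¹ ∈ K) : K = ⊤ := by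
  rw [eq_top_iff]
  intro m _
  obtain ⟨a, b, c, d, rfl⟩ := SL23_word m
  exact K.mul_mem (K.mul_mem (K.mul_mem (K.pow_mem hu _) (K.pow_mem hv _)) (K.pow_mem hu _))
    (K.pow_mem hv _)

theorem SL23_normal (K : Subgroup SL23) (hK : K.Normal) :
    Nat.card K = 1 ∨ Nat.card K = 2 ∨ Nat.card K = 8 ∨ Nat.card K = 24 := by
  by_cases h4 : ∀ m ∈ K, m ^ 4 = 1
  · by_cases h2 : ∀ m ∈ K, m ^ 2 = 1
    · have hle : K ≤ Subgroup.zpowers (-1 : SL23) := by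
        intro m hm
        rcases SL23_order2 m (h2 m hm) with h | h
        · rw [h]; exact one_mem _
        · rw [h]; exact Subgroup.mem_zpowers _
      have h := Subgroup.card_dvd_of_le hle
      rw [Nat.card_zpowers] at h
      have h' : orderOf (-1 : SL23) ∣ 2 := orderOf_dvd_of_pow_eq_one (by simp)
      have := (Nat.dvd_prime Nat.prime_two).1 (h.trans h')
      tauto
    · push Not at h2
      obtain ⟨m, hm, hm2⟩ := h2
      right; right; left
      have : ∀ x, x ∈ K ↔ x ^ 4 = 1 := by
        intro x
        refine ⟨h4 x, fun hx => ?_⟩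
        rcases SL23_order4 m x (h4 m hm) hm2 hx with h | h | ⟨g, h⟩
        · rw [h]; exact K.one_mem
        · rw [h]; exact K.pow_mem hm 2
        · rw [← h]; exact hK.conj_mem m hm g
      rw [Nat.card_congr (Equiv.subtypeEquivRight this), Nat.card_eq_fintype_card]
      exact SL23_Q8_card
  · push Not at h4
    obtain ⟨m, hm, hm4⟩ := h4
    right; right; right
    have hu : su ∈ K := by
      obtain ⟨g, h | h⟩ := SL23_order3 m hm4
      · rw [← h]; exact hK.conj_mem _ (K.pow_mem hm 4) g
      · rw [← inv_inv su, ← h]; exact K.inv_mem (hK.conj_mem _ (K.pow_mem hm 4) g)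
    rw [SL23_top K hu (hK.conj_mem _ hu sv), Subgroup.card_top, Nat.card_eq_fintype_card]
    exact SL23_card

set_option linter.unusedSimpArgs false
set_option linter.unusedTactic false
set_option linter.unreachableTactic false

theorem zeta_prim : IsPrimitiveRoot ζ₉ 9 := by
  have := Complex.isPrimitiveRoot_exp 9 (by norm_num)
  simpa [ζ₉] using this

theorem omega_prim : IsPrimitiveRoot ω 3 := by
  have h := zeta_prim
  have h3 : IsPrimitiveRoot (ζ₉ ^ 3) 3 := h.pow (by norm_num) (by norm_num)
  have : ω = (ζ₉ ^ 3) ^ 2 := by rw [ω, ← pow_mul]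
  rw [this]
  exact h3.pow_of_coprime 2 (by norm_num)

theorem omega_cube : ω ^ 3 = 1 := omega_prim.pow_eq_one

theorem omega_rel : ω ^ 2 + ω + 1 = 0 := by
  have h1 : ω ≠ 1 := omega_prim.ne_one (by norm_num)
  have h : (ω - 1) * (ω ^ 2 + ω + 1) = 0 := by linear_combination omega_cube
  rcases mul_eq_zero.1 h with h | h
  · exact absurd (sub_eq_zero.1 h) h1
  · exact h

noncomputable def oz (k : F3) : ℂ := ω ^ k.val

theorem oz_add (a b : F3) : oz (a + b) = oz a * oz b := by
  rw [oz, oz, oz, ← pow_add, ZMod.val_add]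
  exact (pow_eq_pow_mod (a.val + b.val) omega_cube).symm

theorem oz_zero : oz 0 = 1 := by simp [oz]
theorem oz_one : oz 1 = ω := by simp [oz, ZMod.val_one]
theorem oz_two : oz 2 = ω ^ 2 := rfl

theorem oz_ne (a : F3) : oz a ≠ 0 := pow_ne_zero _ (omega_prim.ne_zero (by norm_num))

theorem oz_inj {a b : F3} (h : oz a = oz b) : a = b := by
  have := omega_prim.pow_inj (ZMod.val_lt a) (ZMod.val_lt b) h
  exact ZMod.val_injective 3 this

theorem oz_surj {x : ℂ} (h : x ^ 3 = 1) : ∃ k, x = oz k := by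
  obtain ⟨i, hi, rfl⟩ := omega_prim.eq_pow_of_pow_eq_one h
  exact ⟨(i : F3), by rw [oz, ZMod.val_natCast, Nat.mod_eq_of_lt hi]⟩

/-- The Heisenberg matrix `ω^k S^{v 0} T^{v 1}`. -/
noncomputable def Wm (k : F3) (v : Fin 2 → F3) : Matrix F3 F3 ℂ :=
  Matrix.of fun i j => if j = i + v 1 then oz (k + v 0 * i) else 0

theorem Wm_mul (k l : F3) (v w : Fin 2 → F3) :
    Wm k v * Wm l w = Wm (k + l + w 0 * v 1) (v + w) := by
  ext i j
  rw [Matrix.mul_apply, Finset.sum_eq_single (i + v 1)]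
  · simp only [Wm, Matrix.of_apply, Pi.add_apply, if_true, mul_ite, mul_zero, ← oz_add, add_assoc]
    congr 2
    ring
  · intro b _ hb
    simp [Wm, hb]
  · simp

theorem Wm_zero : Wm 0 0 = 1 := by
  ext i j
  simp [Wm, Matrix.one_apply, oz_zero, eq_comm]

theorem Wm_inv (k : F3) (v : Fin 2 → F3) : Wm k v * Wm (-k + v 0 * v 1) (-v) = 1 := by
  rw [Wm_mul, ← Wm_zero]
  congr 1
  · simp
  · simp

theorem Wm_inv' (k : F3) (v : Fin 2 → F3) : Wm (-k + v 0 * v 1) (-v) * Wm k v = 1 :=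
  mul_eq_one_comm.1 (Wm_inv k v)

noncomputable def E (k : F3) (v : Fin 2 → F3) : GL (Fin 3) ℂ :=
  ⟨Wm k v, Wm (-k + v 0 * v 1) (-v), Wm_inv k v, Wm_inv' k v⟩

theorem E_coe (k : F3) (v : Fin 2 → F3) : ((E k v : GL (Fin 3) ℂ) : Matrix (Fin 3) (Fin 3) ℂ) = Wm k v := rfl

theorem E_mul (k l : F3) (v w : Fin 2 → F3) :
    E k v * E l w = E (k + l + w 0 * v 1) (v + w) := Units.ext (Wm_mul k l v w)

theorem E_one : E 0 0 = 1 := Units.ext Wm_zero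

theorem E_inj {k l : F3} {v w : Fin 2 → F3} (h : E k v = E l w) : k = l ∧ v = w := by
  have h : Wm k v = Wm l w := congrArg Units.val h
  have h0 := congrFun (congrFun h 0) (0 + v 1)
  have h1 := congrFun (congrFun h 1) (1 + v 1)
  simp only [Wm, Matrix.of_apply, if_true] at h0 h1
  split_ifs at h0 with h2
  · simp only [mul_zero, add_zero] at h0
    have hk := oz_inj h0
    have hv : v 1 = w 1 := by simpa using h2
    rw [hv, if_pos rfl] at h1
    have := oz_inj h1
    refine ⟨hk, ?_⟩
    funext i
    fin_cases i
    · simpa [hk] using this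
    · exact hv
  · exact absurd h0 (oz_ne _)

theorem Smat_eq : Smat = Wm 0 ![1, 0] := by
  ext i j
  fin_cases i <;> fin_cases j <;>
    first | rfl | exact oz_zero.symm | exact oz_one.symm | exact oz_two.symm

theorem Tmat_eq : Tmat = Wm 0 ![0, 1] := by
  ext i j
  fin_cases i <;> fin_cases j <;>
    first | rfl | exact oz_zero.symm

noncomputable def VF : Matrix F3 F3 ℂ := Matrix.of fun i j : F3 => (ω - ω ^ 2)⁻¹ * oz (i * j)
noncomputable def UF : Matrix F3 F3 ℂ := Matrix.diagonal fun i : F3 => ε * oz (i - i * i)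

theorem Vmat_eq : Vmat = VF := by
  ext i j
  fin_cases i <;> fin_cases j <;>
    first
    | exact congrArg (fun x => (ω - ω ^ 2)⁻¹ * x) oz_zero.symm
    | exact congrArg (fun x => (ω - ω ^ 2)⁻¹ * x) oz_one.symm
    | exact congrArg (fun x => (ω - ω ^ 2)⁻¹ * x) oz_two.symm

theorem Umat_eq : Umat = UF := by
  ext i j
  fin_cases i <;> fin_cases j <;>
    first
    | rfl
    | exact (mul_one ε).symm.trans (congrArg (fun x => ε * x) oz_zero.symm)
    | exact congrArg (fun x => ε * x) oz_one.symm

theorem V_conj (k : F3) (v : Fin 2 → F3) :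
    VF * Wm k v = Wm (k - v 0 * v 1) (sv.1 *ᵥ v) * VF := by
  have hs : sv.1 *ᵥ v = ![- v 1, v 0] := by
    funext i
    fin_cases i <;> simp [sv, Matrix.mulVec, dotProduct]
  rw [VF, hs]
  ext i j
  have hj : ∀ x : F3, j = x + v 1 ↔ x = j - v 1 := fun x => by
    rw [eq_sub_iff_add_eq, eq_comm]
  simp only [Wm, Matrix.mul_apply, Matrix.of_apply, ite_mul, zero_mul, mul_ite, hj,
    mul_zero, Finset.sum_ite_eq', Finset.sum_ite_eq, Finset.mem_univ, if_true]
  simp only [Matrix.cons_val_zero, Matrix.cons_val_one, Finset.sum_ite_eq', Finset.sum_ite_eq, Finset.mem_univ, if_true]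
  rw [mul_assoc, mul_left_comm (oz (k - _ + _)), ← oz_add, ← oz_add]
  congr 2
  ring

theorem U_conj (k : F3) (v : Fin 2 → F3) :
    UF * Wm k v = Wm (k - (v 1 - v 1 * v 1)) (su.1 *ᵥ v) * UF := by
  have hs : su.1 *ᵥ v = ![v 0 - v 1, v 1] := by
    funext i
    fin_cases i <;> simp [su, Matrix.mulVec, dotProduct, sub_eq_add_neg]
  have hs0 : (su.1 *ᵥ v) 0 = v 0 - v 1 := by rw [hs]; rfl
  have hs1 : (su.1 *ᵥ v) 1 = v 1 := by rw [hs]; rfl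
  generalize su.1 *ᵥ v = w at hs0 hs1
  rw [UF]
  ext i j
  rw [Matrix.diagonal_mul, Matrix.mul_diagonal, Wm, Wm, Matrix.of_apply, Matrix.of_apply, hs0, hs1]
  by_cases h : j = i + v 1
  · subst h
    rw [if_pos rfl, if_pos rfl, mul_assoc, mul_left_comm (oz (k - _ + _)), ← oz_add, ← oz_add]
    congr 2
    generalize v 0 = a
    generalize v 1 = b
    revert k i a b
    decide
  · rw [if_neg h, if_neg h, mul_zero, zero_mul]

theorem omega_sub_ne : ω - ω ^ 2 ≠ 0 := by
  intro h
  have h1 := omega_rel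
  have h2 : (ω - ω ^ 2) ^ 2 = -3 := by grind
  rw [h] at h2
  norm_num at h2

theorem det_S : Smat.det = 1 := by
  simp [Smat, Matrix.det_fin_three]
  linear_combination omega_cube
theorem det_T : Tmat.det = 1 := by
  simp [Tmat, Matrix.det_fin_three]
theorem det_U : Umat.det = 1 := by
  simp [Umat, Matrix.det_fin_three]
  have : ε * ε * (ε * ω) = (ζ₉ ^ 9) ^ 2 := by simp only [ε, ω]; ring
  rw [this, zeta_prim.pow_eq_one]; simp
theorem det_V : Vmat.det = 1 := by
  have h1 := omega_rel
  have h2 := omega_sub_ne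
  rw [Vmat, Matrix.det_smul]
  simp [Matrix.det_fin_three]
  field_simp
  grind

noncomputable def Vg : GL (Fin 3) ℂ :=
  Matrix.GeneralLinearGroup.mkOfDetNeZero Vmat (by rw [det_V]; exact one_ne_zero)
noncomputable def Ug : GL (Fin 3) ℂ :=
  Matrix.GeneralLinearGroup.mkOfDetNeZero Umat (by rw [det_U]; exact one_ne_zero)

/-- `g` normalizes the Heisenberg group and acts as `m` modulo its centre. -/
def R (g : GL (Fin 3) ℂ) (m : SL23) : Prop :=
  ∀ k v, ∃ k', g * E k v = E k' (m.1 *ᵥ v) * g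

theorem Rel_one : R 1 1 := fun k v => ⟨k, by simp⟩

theorem Rel_mul {g h : GL (Fin 3) ℂ} {m n : SL23} (hg : R g m) (hh : R h n) : R (g * h) (m * n) := by
  intro k v
  obtain ⟨a, ha⟩ := hh k v
  obtain ⟨b, hb⟩ := hg a (n.1 *ᵥ v)
  refine ⟨b, ?_⟩
  rw [mul_assoc, ha, ← mul_assoc, hb, mul_assoc, Matrix.mulVec_mulVec,
    Matrix.SpecialLinearGroup.coe_mul]

theorem E_center (k l : F3) (v : Fin 2 → F3) : E (k + l) v = E k 0 * E l v := by
  rw [E_mul]; simp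

theorem E_comm (k : F3) (g : GL (Fin 3) ℂ) : E k 0 * g = g * E k 0 := by
  have h : (E k 0).1 = oz k • (1 : Matrix (Fin 3) (Fin 3) ℂ) := by
    change Wm k 0 = oz k • (1 : Matrix F3 F3 ℂ)
    ext i j
    simp [Wm, Matrix.one_apply, eq_comm]
  apply Units.ext
  rw [Units.val_mul, Units.val_mul, h]
  simp

theorem Rel_inv {g : GL (Fin 3) ℂ} {m : SL23} (hg : R g m) : R g⁻¹ m⁻¹ := by
  intro k v
  obtain ⟨a, ha⟩ := hg 0 ((m⁻¹).1 *ᵥ v)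
  have h1 : m.1 *ᵥ ((m⁻¹).1 *ᵥ v) = v := by
    rw [Matrix.mulVec_mulVec, ← Matrix.SpecialLinearGroup.coe_mul]
    simp
  rw [h1] at ha
  refine ⟨k - a, ?_⟩
  have h2 : E k v = E (k - a) 0 * E a v := by rw [← E_center]; simp
  have h3 : E (k - a) ((m⁻¹).1 *ᵥ v) = E (k - a) 0 * E 0 ((m⁻¹).1 *ᵥ v) := by
    rw [← E_center]; simp
  have h4 : E a v = g * E 0 ((m⁻¹).1 *ᵥ v) * g⁻¹ := by rw [ha]; group
  rw [h2, h3, h4, ← mul_assoc, ← E_comm]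
  group

theorem R_unique {g : GL (Fin 3) ℂ} {m n : SL23} (hm : R g m) (hn : R g n) : m = n := by
  apply Subtype.ext
  apply Matrix.mulVec_injective
  funext v
  obtain ⟨a, ha⟩ := hm 0 v
  obtain ⟨b, hb⟩ := hn 0 v
  exact (E_inj (mul_right_cancel (ha.symm.trans hb))).2

theorem R_E (k : F3) (v : Fin 2 → F3) : R (E k v) 1 := by
  intro l w
  refine ⟨l + w 0 * v 1 - v 0 * w 1, ?_⟩
  rw [E_mul, E_mul]
  congr 1
  · simp; ring
  · simp [add_comm]

theorem R_V (g : GL (Fin 3) ℂ) (hg : g.1 = Vmat) : R g sv := by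
  intro k v
  refine ⟨k - v 0 * v 1, Units.ext ?_⟩
  rw [Units.val_mul, Units.val_mul, hg, Vmat_eq]
  exact V_conj k v

theorem R_U (g : GL (Fin 3) ℂ) (hg : g.1 = Umat) : R g su := by
  intro k v
  refine ⟨k - (v 1 - v 1 * v 1), Units.ext ?_⟩
  rw [Units.val_mul, Units.val_mul, hg, Umat_eq]
  exact U_conj k v

theorem S_eq (g : GL (Fin 3) ℂ) (hg : g.1 = Smat) : g = E 0 ![1, 0] :=
  Units.ext (hg.trans Smat_eq)
theorem T_eq (g : GL (Fin 3) ℂ) (hg : g.1 = Tmat) : g = E 0 ![0, 1] :=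
  Units.ext (hg.trans Tmat_eq)

theorem G_R {g : GL (Fin 3) ℂ} (hg : g ∈ G648) : ∃ m, R g m := by
  induction hg using Subgroup.closure_induction with
  | mem x hx =>
    rcases hx with h | h | h | h
    · rw [S_eq x h]; exact ⟨1, R_E _ _⟩
    · rw [T_eq x h]; exact ⟨1, R_E _ _⟩
    · exact ⟨sv, R_V x h⟩
    · exact ⟨su, R_U x h⟩
  | one => exact ⟨1, Rel_one⟩
  | mul x y _ _ hx hy =>
    obtain ⟨m, hm⟩ := hx
    obtain ⟨n, hn⟩ := hy
    exact ⟨m * n, Rel_mul hm hn⟩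
  | inv x _ hx =>
    obtain ⟨m, hm⟩ := hx
    exact ⟨m⁻¹, Rel_inv hm⟩

theorem G_det {g : GL (Fin 3) ℂ} (hg : g ∈ G648) : g.1.det = 1 := by
  have : G648 ≤ (Matrix.GeneralLinearGroup.det (n := Fin 3) (R := ℂ)).ker := by
    rw [G648, Subgroup.closure_le]
    intro x hx
    apply Units.ext
    change x.1.det = 1
    rcases hx with h | h | h | h <;> rw [h]
    exacts [det_S, det_T, det_V, det_U]
  exact congrArg Units.val (this hg)

theorem E_pow_S (n : ℕ) : (E 0 ![1, 0]) ^ n = E 0 ![(n : F3), 0] := by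
  induction n with
  | zero => rw [pow_zero, ← E_one]; congr 1; ext i; fin_cases i <;> simp
  | succ n ih => rw [pow_succ, ih, E_mul]; congr 1 <;> simp

theorem E_pow_T (n : ℕ) : (E 0 ![0, 1]) ^ n = E 0 ![0, (n : F3)] := by
  induction n with
  | zero => rw [pow_zero, ← E_one]; congr 1; ext i; fin_cases i <;> simp
  | succ n ih => rw [pow_succ, ih, E_mul]; congr 1 <;> simp

theorem E_pow_Z (n : ℕ) : (E 1 0) ^ n = E (n : F3) 0 := by
  induction n with
  | zero => rw [pow_zero, ← E_one]; simp
  | succ n ih => rw [pow_succ, ih, E_mul]; congr 1 <;> simp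

theorem E_S_mem : E 0 ![1, 0] ∈ G648 := Subgroup.subset_closure (Or.inl Smat_eq.symm)
theorem E_T_mem : E 0 ![0, 1] ∈ G648 := Subgroup.subset_closure (Or.inr (Or.inl Tmat_eq.symm))
theorem Vg_mem : Vg ∈ G648 := Subgroup.subset_closure (Or.inr (Or.inr (Or.inl rfl)))
theorem Ug_mem : Ug ∈ G648 := Subgroup.subset_closure (Or.inr (Or.inr (Or.inr rfl)))

theorem E_Z_mem : E 1 0 ∈ G648 := by
  have h : E 0 ![0, 1] * E 0 ![1, 0] = E 1 0 * (E 0 ![1, 0] * E 0 ![0, 1]) := by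
    rw [E_mul, E_mul, E_mul]; congr 1 <;> simp
  rw [← mul_inv_eq_iff_eq_mul] at h
  rw [← h]
  exact mul_mem (mul_mem E_T_mem E_S_mem) (inv_mem (mul_mem E_S_mem E_T_mem))

theorem E_split (k : F3) (v : Fin 2 → F3) :
    E k v = (E 1 0) ^ k.val * ((E 0 ![1, 0]) ^ (v 0).val * (E 0 ![0, 1]) ^ (v 1).val) := by
  rw [E_pow_S, E_pow_T, E_pow_Z, E_mul, E_mul]
  congr 1
  · simp
  · ext i; fin_cases i <;> simp

theorem E_mem (k : F3) (v : Fin 2 → F3) : E k v ∈ G648 := by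
  rw [E_split]
  exact mul_mem (pow_mem E_Z_mem _) (mul_mem (pow_mem E_S_mem _) (pow_mem E_T_mem _))

theorem schur (M : Matrix (Fin 3) (Fin 3) ℂ) (hS : M * Smat = Smat * M) (hT : M * Tmat = Tmat * M)
    (hd : M.det = 1) : ∃ k, M = Wm k 0 := by
  have h1 : ω ≠ 1 := omega_prim.ne_one (by norm_num)
  have h0 : ω ≠ 0 := omega_prim.ne_zero (by norm_num)
  have h2 : ω ^ 2 ≠ 1 := omega_prim.pow_ne_one_of_pos_of_lt (by norm_num) (by norm_num)
  have e (i j) := congrFun (congrFun hS i) j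
  have f (i j) := congrFun (congrFun hT i) j
  simp only [Matrix.mul_apply, Fin.sum_univ_three] at e f
  have e01 := e 0 1
  have e02 := e 0 2
  have e10 := e 1 0
  have e12 := e 1 2
  have e20 := e 2 0
  have e21 := e 2 1
  have f01 := f 0 1
  have f12 := f 1 2
  simp [Smat] at e01 e02 e10 e12 e20 e21
  simp [Tmat] at f01 f12
  have m01 : M 0 1 = 0 := by grind
  have m02 : M 0 2 = 0 := by grind
  have m10 : M 1 0 = 0 := by grind
  have m12 : M 1 2 = 0 := by grind
  have m20 : M 2 0 = 0 := by grind
  have m21 : M 2 1 = 0 := by grind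
  rw [Matrix.det_fin_three, m01, m02, m10, m12, m20, m21, ← f12, ← f01] at hd
  obtain ⟨k, hk⟩ := oz_surj (x := M 0 0) (by linear_combination hd)
  refine ⟨k, ?_⟩
  have hw : Wm k 0 = oz k • (1 : Matrix F3 F3 ℂ) := by
    ext i j
    simp [Wm, Matrix.one_apply, eq_comm]
  rw [hw]
  change M = oz k • (1 : Matrix (Fin 3) (Fin 3) ℂ)
  ext i j
  fin_cases i <;> fin_cases j <;> simp [m01, m02, m10, m12, m20, m21, ← f12, ← f01, hk]

theorem R_ker {g : GL (Fin 3) ℂ} (hg : R g 1) (hd : g.1.det = 1) : ∃ k v, g = E k v := by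
  obtain ⟨a, ha⟩ := hg 0 ![1, 0]
  obtain ⟨b, hb⟩ := hg 0 ![0, 1]
  simp only [Matrix.SpecialLinearGroup.coe_one, Matrix.one_mulVec] at ha hb
  set e := E 0 ![-b, a] with he
  have ea : e * E 0 ![1, 0] = E a ![1, 0] * e := by
    rw [he, E_mul, E_mul]; congr 1 <;> simp [add_comm]
  have eb : e * E 0 ![0, 1] = E b ![0, 1] * e := by
    rw [he, E_mul, E_mul]; congr 1 <;> simp [add_comm]
  have ca : (e⁻¹ * g) * E 0 ![1, 0] = E 0 ![1, 0] * (e⁻¹ * g) := by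
    rw [mul_assoc, ha, inv_mul_eq_iff_eq_mul, ← mul_assoc, ← mul_assoc, ea]; group
  have cb : (e⁻¹ * g) * E 0 ![0, 1] = E 0 ![0, 1] * (e⁻¹ * g) := by
    rw [mul_assoc, hb, inv_mul_eq_iff_eq_mul, ← mul_assoc, ← mul_assoc, eb]; group
  have hdet : (e⁻¹ * g).1.det = 1 := by
    rw [Units.val_mul, Matrix.det_mul, hd, G_det (inv_mem (E_mem _ _)), one_mul]
  obtain ⟨k, hk⟩ := schur (e⁻¹ * g).1
    (by rw [Smat_eq]; exact congrArg Units.val ca) (by rw [Tmat_eq]; exact congrArg Units.val cb)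
    hdet
  have hk : e⁻¹ * g = E k 0 := Units.ext hk
  rw [inv_mul_eq_iff_eq_mul, he, E_mul] at hk
  exact ⟨_, _, hk⟩

noncomputable def phi : G648 →* SL23 :=
  MonoidHom.mk' (fun g => (G_R g.2).choose) (fun g h =>
    R_unique (G_R (g * h).2).choose_spec (Rel_mul (G_R g.2).choose_spec (G_R h.2).choose_spec))

theorem phi_spec (g : G648) : R g.1 (phi g) := (G_R g.2).choose_spec

theorem phi_eq {g : G648} {m : SL23} (h : R g.1 m) : phi g = m := R_unique (phi_spec g) h

theorem phi_surj : Function.Surjective phi := by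
  rw [← MonoidHom.range_eq_top]
  have hu : su ∈ phi.range := ⟨⟨Ug, Ug_mem⟩, phi_eq (R_U _ rfl)⟩
  have hv : sv ∈ phi.range := ⟨⟨Vg, Vg_mem⟩, phi_eq (R_V _ rfl)⟩
  exact SL23_top _ hu (mul_mem (mul_mem hv hu) (inv_mem hv))

noncomputable def EG (k : F3) (v : Fin 2 → F3) : G648 := ⟨E k v, E_mem k v⟩

theorem EG_mul (k l : F3) (v w : Fin 2 → F3) :
    EG k v * EG l w = EG (k + l + w 0 * v 1) (v + w) := Subtype.ext (E_mul k l v w)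

theorem EG_inj {k l : F3} {v w : Fin 2 → F3} (h : EG k v = EG l w) : k = l ∧ v = w :=
  E_inj (congrArg Subtype.val h)

theorem EG_one : EG 0 0 = 1 := Subtype.ext E_one

theorem phi_ker {g : G648} : g ∈ phi.ker ↔ ∃ k v, g = EG k v := by
  constructor
  · intro h
    have h1 := phi_spec g
    rw [MonoidHom.mem_ker.1 h] at h1
    obtain ⟨k, v, h⟩ := R_ker h1 (G_det g.2)
    exact ⟨k, v, Subtype.ext h⟩
  · rintro ⟨k, v, rfl⟩
    exact phi_eq (R_E k v)

theorem ker_card : Nat.card phi.ker = 27 := by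
  have : Function.Bijective
      (fun p : F3 × (Fin 2 → F3) => (⟨EG p.1 p.2, phi_ker.2 ⟨_, _, rfl⟩⟩ : phi.ker)) := by
    constructor
    · rintro ⟨k, v⟩ ⟨l, w⟩ h
      obtain ⟨h1, h2⟩ := EG_inj (congrArg Subtype.val h)
      simp only at h1 h2
      rw [h1, h2]
    · rintro ⟨g, hg⟩
      obtain ⟨k, v, rfl⟩ := phi_ker.1 hg
      exact ⟨(k, v), rfl⟩
  rw [← Nat.card_congr (Equiv.ofBijective _ this), Nat.card_eq_fintype_card]
  simp [ZMod.card]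

theorem G_card : Nat.card G648 = 648 := by
  rw [← Subgroup.card_mul_index phi.ker, Subgroup.index_ker, MonoidHom.range_eq_top.2 phi_surj,
    ker_card, Subgroup.card_top, Nat.card_eq_fintype_card, SL23_card]

theorem phi_conj (g : G648) (k : F3) (v : Fin 2 → F3) :
    ∃ k', g * EG k v * g⁻¹ = EG k' ((phi g).1 *ᵥ v) := by
  obtain ⟨k', h⟩ := phi_spec g k v
  refine ⟨k', ?_⟩
  rw [mul_inv_eq_iff_eq_mul]
  exact Subtype.ext h

/-- A normal subgroup containing a noncentral element of the Heisenberg group contains all of it. -/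
theorem ker_le {H : Subgroup G648} (hH : H.Normal) {k : F3} {u : Fin 2 → F3} (hu : u ≠ 0)
    (h : EG k u ∈ H) : phi.ker ≤ H := by
  have hz1 : ∃ l, l ≠ 0 ∧ EG l 0 ∈ H := by
    have key : ∀ w : Fin 2 → F3, EG (u 0 * w 1 - w 0 * u 1) 0 ∈ H := by
      intro w
      have h1 := H.mul_mem (hH.conj_mem _ h (EG 0 w)) (H.inv_mem h)
      have h2 : EG 0 w * EG k u * (EG 0 w)⁻¹ * (EG k u)⁻¹ = EG (u 0 * w 1 - w 0 * u 1) 0 := by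
        rw [mul_inv_eq_iff_eq_mul, mul_inv_eq_iff_eq_mul, EG_mul, EG_mul, EG_mul]
        congr 1
        · simp; ring
        · simp [add_comm]
      rwa [h2] at h1
    by_cases h0 : u 0 = 0
    · have h1 : u 1 ≠ 0 := fun h1 => hu (by ext i; fin_cases i <;> simp [h0, h1])
      exact ⟨_, by simpa using h1, key ![1, 0]⟩
    · exact ⟨_, by simpa using h0, key ![0, 1]⟩
  have hz : ∀ l, EG l 0 ∈ H := by
    obtain ⟨l, hl, hm⟩ := hz1
    have hm2 : EG (l + l) 0 ∈ H := by
      have := H.mul_mem hm hm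
      rw [EG_mul] at this
      simpa using this
    have hm0 : EG 0 0 ∈ H := by rw [EG_one]; exact H.one_mem
    have dec : ∀ l x : F3, l ≠ 0 → x = 0 ∨ x = l ∨ x = l + l := by decide
    intro x
    rcases dec l x hl with h | h | h <;> rw [h] <;> assumption
  intro g hg
  obtain ⟨a, w, rfl⟩ := phi_ker.1 hg
  by_cases hw : w = 0
  · rw [hw]; exact hz a
  · obtain ⟨m, hm⟩ := SL23_trans u w hu hw
    obtain ⟨g, rfl⟩ := phi_surj m
    obtain ⟨b, hb⟩ := phi_conj g k u
    rw [hm] at hb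
    have h1 := hH.conj_mem _ h g
    rw [hb] at h1
    have h2 := H.mul_mem (hz (a - b)) h1
    rw [EG_mul] at h2
    simpa using h2

theorem normal_card (H : Subgroup G648) (hH : H.Normal) :
    Nat.card H ∈ ({1, 3, 27, 54, 216, 648} : Set ℕ) := by
  by_cases hc : ∀ h ∈ H, ∃ k, h = EG k 0
  · have hle : H ≤ Subgroup.zpowers (EG 1 0) := by
      intro h hh
      obtain ⟨k, rfl⟩ := hc h hh
      refine ⟨k.val, Subtype.ext ?_⟩
      change ((E 1 0) ^ ((k.val : ℕ) : ℤ)) = E k 0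
      rw [zpow_natCast, E_pow_Z]
      simp
    have h := Subgroup.card_dvd_of_le hle
    rw [Nat.card_zpowers] at h
    have h' : orderOf (EG 1 0) ∣ 3 := orderOf_dvd_of_pow_eq_one (Subtype.ext (by
      change (E 1 0) ^ 3 = 1
      rw [E_pow_Z, ← E_one]
      rfl))
    rcases (Nat.dvd_prime Nat.prime_three).1 (h.trans h') with h | h <;> simp [h]
  · push Not at hc
    obtain ⟨h, hh, hc⟩ := hc
    have hker : phi.ker ≤ H := by
      by_cases h1 : h ∈ phi.ker
      · obtain ⟨k, v, rfl⟩ := phi_ker.1 h1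
        exact ker_le hH (fun hv => hc k (by rw [hv])) hh
      · have h2 : ∃ v, (phi h).1 *ᵥ v ≠ v := by
          by_contra! h2
          apply h1
          rw [MonoidHom.mem_ker]
          apply Subtype.ext
          apply Matrix.mulVec_injective
          funext v
          rw [h2 v]; simp
        obtain ⟨v, hv⟩ := h2
        obtain ⟨k, hk⟩ := phi_conj h 0 v
        have h3 : h * (EG 0 v * h⁻¹ * (EG 0 v)⁻¹) ∈ H :=
          H.mul_mem hh (hH.conj_mem _ (H.inv_mem hh) _)
        have h4 : h * (EG 0 v * h⁻¹ * (EG 0 v)⁻¹) =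
            EG (k - ((phi h).1 *ᵥ v - v) 1 * v 0) ((phi h).1 *ᵥ v - v) := by
          rw [← mul_assoc, ← mul_assoc, hk, mul_inv_eq_iff_eq_mul, EG_mul]
          congr 1
          · ring
          · simp
        rw [h4] at h3
        exact ker_le hH (sub_ne_zero.2 hv) h3
    have hN : (H.map phi).Normal := hH.map phi phi_surj
    have hi : (H.map phi).index = H.index := Subgroup.index_map_eq _ phi_surj hker
    have c1 := Subgroup.card_mul_index H
    have c2 := Subgroup.card_mul_index (H.map phi)
    rw [G_card] at c1
    rw [hi, Nat.card_eq_fintype_card (α := SL23), SL23_card] at c2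
    rcases SL23_normal _ hN with h | h | h | h <;> rw [h] at c2
    · have : H.index = 24 := by omega
      rw [this] at c1
      have : Nat.card H = 27 := by omega
      simp [this]
    · have : H.index = 12 := by omega
      rw [this] at c1
      have : Nat.card H = 54 := by omega
      simp [this]
    · have : H.index = 3 := by omega
      rw [this] at c1
      have : Nat.card H = 216 := by omega
      simp [this]
    · have : H.index = 1 := by omega
      rw [this] at c1
      have : Nat.card H = 648 := by omega
      simp [this]

/-- `G₆₄₈` is a finite group of order `648`, and every normal subgroup of `G₆₄₈` has order in
`{1, 3, 27, 54, 216, 648}`; in particular `G₆₄₈` has no normal subgroup of order `81`. -/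
theorem G648_card_and_normal_subgroup_orders :
    Nat.card G648 = 648 ∧
      (∀ H : Subgroup G648, H.Normal →
        Nat.card H ∈ ({1, 3, 27, 54, 216, 648} : Set ℕ)) ∧
      (∀ H : Subgroup G648, H.Normal → Nat.card H ≠ 81) := by
  refine ⟨G_card, normal_card, fun H hH h => ?_⟩
  have := normal_card H hH
  rw [h] at this
  simp at this
end

section
/- The subgroup D₁ = ⟨S, T⟩ is a normal subgroup of G₂₁₆, and the quotient group G₂₁₆/D₁ is isomorphic to the quaternion group Q₈ of order 8. -/
open Matrix
open scoped MatrixGroups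

namespace Hess

lemma zeta_prim : IsPrimitiveRoot ζ₉ 9 := by
  have := Complex.isPrimitiveRoot_exp 9 (by norm_num)
  simpa [ζ₉] using this

lemma om_cube : ω ^ 3 = 1 := by
  have h := zeta_prim.pow_eq_one
  have : ω ^ 3 = (ζ₉ ^ 9) ^ 2 := by rw [ω]; ring
  rw [this, h, one_pow]

lemma om_ne : ω ≠ 1 := by
  intro h
  have := zeta_prim.dvd_of_pow_eq_one 6 h
  omega

lemma om_rel : ω ^ 2 + ω + 1 = 0 := by
  have h : (ω - 1) * (ω ^ 2 + ω + 1) = 0 := by linear_combination om_cube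
  rcases mul_eq_zero.1 h with h | h
  · exact absurd (sub_eq_zero.1 h) om_ne
  · exact h

lemma om_sq : ω ^ 2 = -1 - ω := by linear_combination om_rel

lemma eps_nine : ε ^ 9 = 1 := by
  have h := zeta_prim.pow_eq_one
  have : ε ^ 9 = (ζ₉ ^ 9) ^ 4 := by rw [ε]; ring
  rw [this, h, one_pow]

lemma c_eq : (ω - ω ^ 2)⁻¹ = (-1 - 2 * ω) / 3 := by
  apply inv_eq_of_mul_eq_one_left
  linear_combination (2 * ω / 3 - 1) * om_rel

/-- Entries of `V` as polynomials in `ω`. -/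
lemma V_eq : Vmat = !![(-1 - 2 * ω) / 3, (-1 - 2 * ω) / 3, (-1 - 2 * ω) / 3;
    (-1 - 2 * ω) / 3, (2 + ω) / 3, (-1 + ω) / 3;
    (-1 - 2 * ω) / 3, (-1 + ω) / 3, (2 + ω) / 3] := by
  rw [Vmat, c_eq]
  ext i j
  fin_cases i <;> fin_cases j <;> simp [om_sq] <;> grind [om_rel]

/-- The matrix `U V U⁻¹` written out. -/
noncomputable def Wm : Matrix (Fin 3) (Fin 3) ℂ :=
  !![(-1 - 2 * ω) / 3, (-1 - 2 * ω) / 3, (-1 + ω) / 3;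
    (-1 - 2 * ω) / 3, (2 + ω) / 3, (2 + ω) / 3;
    (2 + ω) / 3, (-1 - 2 * ω) / 3, (2 + ω) / 3]

noncomputable def s : GL (Fin 3) ℂ where
  val := Smat
  inv := Smat * Smat
  val_inv := by
    ext i j
    fin_cases i <;> fin_cases j <;> simp [Smat, Matrix.mul_apply, Fin.sum_univ_three] <;>
      grind [om_cube]
  inv_val := by
    ext i j
    fin_cases i <;> fin_cases j <;> simp [Smat, Matrix.mul_apply, Fin.sum_univ_three] <;>
      grind [om_cube]

noncomputable def t : GL (Fin 3) ℂ where
  val := Tmat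
  inv := Tmat * Tmat
  val_inv := by
    ext i j
    fin_cases i <;> fin_cases j <;> simp [Tmat, Matrix.mul_apply, Fin.sum_univ_three]
  inv_val := by
    ext i j
    fin_cases i <;> fin_cases j <;> simp [Tmat, Matrix.mul_apply, Fin.sum_univ_three]

noncomputable def u : GL (Fin 3) ℂ where
  val := Umat
  inv := !![ε ^ 8, 0, 0; 0, ε ^ 8, 0; 0, 0, ε ^ 8 * ω ^ 2]
  val_inv := by
    ext i j
    fin_cases i <;> fin_cases j <;> simp [Umat, Matrix.mul_apply, Fin.sum_univ_three] <;>
      grind [om_cube, eps_nine]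
  inv_val := by
    ext i j
    fin_cases i <;> fin_cases j <;> simp [Umat, Matrix.mul_apply, Fin.sum_univ_three] <;>
      grind [om_cube, eps_nine]

/-- `V²` is minus the permutation matrix of index negation. -/
lemma V_sq : Vmat * Vmat = !![-1, 0, 0; 0, 0, -1; 0, -1, 0] := by
  rw [V_eq]
  ext i j
  fin_cases i <;> fin_cases j <;> simp [Matrix.mul_apply, Fin.sum_univ_three] <;>
    grind [om_rel]

lemma V_four : (Vmat * Vmat) * (Vmat * Vmat) = 1 := by
  rw [V_sq]
  ext i j
  fin_cases i <;> fin_cases j <;> simp [Matrix.mul_apply, Fin.sum_univ_three]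

noncomputable def v : GL (Fin 3) ℂ where
  val := Vmat
  inv := Vmat * Vmat * Vmat
  val_inv := by rw [← V_four]; simp only [Matrix.mul_assoc]
  inv_val := by rw [← V_four]; simp only [Matrix.mul_assoc]

noncomputable def w : GL (Fin 3) ℂ := u * v * u⁻¹

lemma s_val : (s : Matrix (Fin 3) (Fin 3) ℂ) = Smat := rfl
lemma t_val : (t : Matrix (Fin 3) (Fin 3) ℂ) = Tmat := rfl
lemma u_val : (u : Matrix (Fin 3) (Fin 3) ℂ) = Umat := rfl
lemma v_val : (v : Matrix (Fin 3) (Fin 3) ℂ) = Vmat := rfl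

lemma w_val' : (w : Matrix (Fin 3) (Fin 3) ℂ) = Umat * Vmat * Umat⁻¹ := by
  rw [w, Units.val_mul, Units.val_mul, Matrix.coe_units_inv, u_val, v_val]

lemma w_val : (w : Matrix (Fin 3) (Fin 3) ℂ) = Wm := by
  have h : Wm * (u : Matrix (Fin 3) (Fin 3) ℂ) = u * v := by
    rw [u_val, v_val, V_eq]
    ext i j
    fin_cases i <;> fin_cases j <;>
      simp [Wm, Umat, Matrix.mul_apply, Fin.sum_univ_three] <;>
      grind [om_rel]
  rw [w, Units.val_mul, Units.val_mul, ← h, Matrix.mul_assoc, ← Units.val_mul, mul_inv_cancel]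
  simp

lemma s3 : s * (s * s) = 1 := Units.ext s.val_inv
lemma t3 : t * (t * t) = 1 := Units.ext t.val_inv
lemma v4 : v ^ 4 = 1 := by
  have : v * (v * v * v) = 1 := Units.ext v.val_inv
  rw [← this]; simp only [pow_succ, pow_zero, one_mul, mul_assoc]

lemma vs : v * s = t * v := by
  apply Units.ext
  simp only [Units.val_mul, s_val, t_val, v_val, V_eq]
  ext i j
  fin_cases i <;> fin_cases j <;>
    simp [Smat, Tmat, Matrix.mul_apply, Fin.sum_univ_three] <;> grind [om_rel]

lemma vt : v * t = s * s * v := by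
  apply Units.ext
  simp only [Units.val_mul, s_val, t_val, v_val, V_eq]
  ext i j
  fin_cases i <;> fin_cases j <;>
    simp [Smat, Tmat, Matrix.mul_apply, Fin.sum_univ_three] <;> grind [om_rel]

lemma us : u * s = s * u := by
  apply Units.ext
  simp only [Units.val_mul, s_val, u_val]
  ext i j
  fin_cases i <;> fin_cases j <;>
    simp [Smat, Umat, Matrix.mul_apply, Fin.sum_univ_three] <;> grind [om_rel]

lemma ut : u * t = s * s * t * u := by
  apply Units.ext
  simp only [Units.val_mul, s_val, u_val, t_val]
  ext i j
  fin_cases i <;> fin_cases j <;>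
    simp [Smat, Umat, Tmat, Matrix.mul_apply, Fin.sum_univ_three] <;> grind [om_rel]

lemma wwvv : w * w * (v * v) = s * s := by
  apply Units.ext
  simp only [Units.val_mul, s_val, w_val, v_val, V_sq]
  ext i j
  fin_cases i <;> fin_cases j <;>
    simp [Smat, Wm, Matrix.mul_apply, Fin.sum_univ_three] <;> grind [om_rel]

lemma sdiag : Smat * Tmat * (Smat * Smat) * (Tmat * Tmat) * (Smat * Smat) =
    !![ω ^ 2, 0, 0; 0, ω, 0; 0, 0, 1] := by
  have h4 : ω ^ 4 = ω := by linear_combination ω * om_cube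
  ext i j
  fin_cases i <;> fin_cases j <;>
    simp [Smat, Tmat, Matrix.mul_apply, Fin.sum_univ_three] <;> grind [om_rel]

lemma vwv : v * w * v = (s * t * (s * s) * (t * t) * (s * s)) * w := by
  apply Units.ext
  simp only [Units.val_mul, s_val, w_val, v_val, t_val, sdiag, V_eq]
  ext i j
  fin_cases i <;> fin_cases j <;>
    simp [Wm, Matrix.mul_apply, Fin.sum_univ_three] <;> grind [om_rel]

lemma D1_eq : D1 = Subgroup.closure {s, t} := by
  rw [D1]; congr 1; ext g
  simp only [Set.mem_ofPred_eq, Set.mem_insert_iff, Set.mem_singleton_iff, Units.ext_iff,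
    s_val, t_val]

lemma G216_eq : G216 = Subgroup.closure {s, t, v, w} := by
  rw [G216]; congr 1; ext g
  simp only [Set.mem_ofPred_eq, Set.mem_insert_iff, Set.mem_singleton_iff, Units.ext_iff,
    s_val, t_val, v_val, w_val']

lemma s_mem : s ∈ D1 := by rw [D1_eq]; exact Subgroup.subset_closure (by simp)
lemma t_mem : t ∈ D1 := by rw [D1_eq]; exact Subgroup.subset_closure (by simp)

lemma D1_le_of {H : Subgroup (GL (Fin 3) ℂ)} (hs : s ∈ H) (ht : t ∈ H) : D1 ≤ H := by
  rw [D1_eq, Subgroup.closure_le]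
  rintro x (rfl | rfl) <;> assumption

lemma conj_mem {g : GL (Fin 3) ℂ} (hs : g * s * g⁻¹ ∈ D1) (ht : g * t * g⁻¹ ∈ D1)
    {x : GL (Fin 3) ℂ} (hx : x ∈ D1) : g * x * g⁻¹ ∈ D1 := by
  have : D1 ≤ D1.comap (MulAut.conj g).toMonoidHom := D1_le_of (by simpa using hs) (by simpa using ht)
  simpa using this hx

lemma norm_of {g : GL (Fin 3) ℂ} (hs : g * s * g⁻¹ ∈ D1) (ht : g * t * g⁻¹ ∈ D1)
    (hs' : g⁻¹ * s * g ∈ D1) (ht' : g⁻¹ * t * g ∈ D1) : g ∈ Subgroup.normalizer (D1 : Set (GL (Fin 3) ℂ)) := by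
  rw [Subgroup.mem_normalizer_iff]
  intro x
  refine ⟨conj_mem hs ht, fun h => ?_⟩
  have := conj_mem (g := g⁻¹) (by simpa using hs') (by simpa using ht') h
  simpa [mul_assoc] using this

lemma v_norm : v ∈ Subgroup.normalizer (D1 : Set (GL (Fin 3) ℂ)) := by
  apply norm_of
  · rw [vs, mul_inv_cancel_right]; exact t_mem
  · rw [vt, mul_inv_cancel_right]; exact mul_mem s_mem s_mem
  · have : v⁻¹ * s * v = t * t := by
      rw [mul_assoc, inv_mul_eq_iff_eq_mul, ← mul_assoc, vt, mul_assoc, vt]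
      have := s3
      calc s * v = (s * (s * s)) * s * v := by rw [s3, one_mul]
        _ = _ := by simp only [mul_assoc]
    rw [this]; exact mul_mem t_mem t_mem
  · have : v⁻¹ * t * v = s := by rw [mul_assoc, inv_mul_eq_iff_eq_mul, vs]
    rw [this]; exact s_mem

lemma u_norm : u ∈ Subgroup.normalizer (D1 : Set (GL (Fin 3) ℂ)) := by
  apply norm_of
  · rw [us, mul_inv_cancel_right]; exact s_mem
  · rw [ut, mul_inv_cancel_right]; exact mul_mem (mul_mem s_mem s_mem) t_mem
  · have : u⁻¹ * s * u = s := by rw [mul_assoc, inv_mul_eq_iff_eq_mul, us]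
    rw [this]; exact s_mem
  · have : u⁻¹ * t * u = s * t := by
      rw [mul_assoc, inv_mul_eq_iff_eq_mul, ← mul_assoc, us, mul_assoc, ut]
      calc t * u = (s * (s * s)) * t * u := by rw [s3, one_mul]
        _ = _ := by simp only [mul_assoc]
    rw [this]; exact mul_mem s_mem t_mem

lemma w_norm : w ∈ Subgroup.normalizer (D1 : Set (GL (Fin 3) ℂ)) :=
  mul_mem (mul_mem u_norm v_norm) (inv_mem u_norm)

lemma G216_le : G216 ≤ Subgroup.normalizer (D1 : Set (GL (Fin 3) ℂ)) := by
  rw [G216_eq, Subgroup.closure_le]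
  rintro x (rfl | rfl | rfl | rfl)
  · exact Subgroup.le_normalizer s_mem
  · exact Subgroup.le_normalizer t_mem
  · exact v_norm
  · exact w_norm

lemma D1_le : D1 ≤ G216 := by
  rw [G216_eq]
  exact D1_le_of (Subgroup.subset_closure (by simp)) (Subgroup.subset_closure (by simp))

lemma D1_normal : (D1.subgroupOf G216).Normal :=
  Subgroup.normal_subgroupOf_of_le_normalizer G216_le

lemma v_mem : v ∈ G216 := by rw [G216_eq]; exact Subgroup.subset_closure (by simp)
lemma w_mem : w ∈ G216 := by rw [G216_eq]; exact Subgroup.subset_closure (by simp)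

/-- Matrices in `D₁` are supported on a cyclic shift of the diagonal. -/
lemma D1_shape {g : GL (Fin 3) ℂ} (hg : g ∈ D1) : ∃ k : Fin 3,
    (∀ i j : Fin 3, j ≠ i + k → (g : Matrix (Fin 3) (Fin 3) ℂ) i j = 0) ∧
    (∀ i j : Fin 3, i ≠ j + k → ((g⁻¹ : GL (Fin 3) ℂ) : Matrix (Fin 3) (Fin 3) ℂ) i j = 0) := by
  rw [D1_eq] at hg
  induction hg using Subgroup.closure_induction with
  | mem x hx =>
    rcases hx with rfl | rfl
    · refine ⟨0, ?_, ?_⟩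
      · intro i j
        fin_cases i <;> fin_cases j <;> simp [s_val, Smat]
      · intro i j
        change _ → (Smat * Smat) i j = 0
        fin_cases i <;> fin_cases j <;> simp [Smat, Matrix.mul_apply, Fin.sum_univ_three]
    · refine ⟨1, ?_, ?_⟩
      · intro i j
        fin_cases i <;> fin_cases j <;> simp [t_val, Tmat]
      · intro i j
        change _ → (Tmat * Tmat) i j = 0
        fin_cases i <;> fin_cases j <;> simp [Tmat, Matrix.mul_apply, Fin.sum_univ_three]
  | one => 
    refine ⟨0, ?_, ?_⟩
    · intro i j h
      simp only [Units.val_one]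
      exact Matrix.one_apply_ne (fun e => h (by simp [e]))
    · intro i j h
      simp only [inv_one, Units.val_one]
      exact Matrix.one_apply_ne (fun e => h (by simp [e]))
  | mul x y _ _ hx hy =>
    obtain ⟨k, hk, hk'⟩ := hx
    obtain ⟨l, hl, hl'⟩ := hy
    refine ⟨k + l, ?_, ?_⟩
    · intro i j h
      rw [Units.val_mul, Matrix.mul_apply]
      refine Finset.sum_eq_zero fun m _ => ?_
      by_cases hm : m = i + k
      · rw [hl m j (by rintro rfl; exact h (by rw [hm, add_assoc])), mul_zero]
      · rw [hk i m hm, zero_mul]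
    · intro i j h
      rw [_root_.mul_inv_rev, Units.val_mul, Matrix.mul_apply]
      refine Finset.sum_eq_zero fun m _ => ?_
      by_cases hm : m = j + k
      · rw [hl' i m (by rintro rfl; exact h (by rw [hm, add_assoc])), zero_mul]
      · rw [hk' m j hm, mul_zero]
  | inv x _ hx =>
    obtain ⟨k, hk, hk'⟩ := hx
    refine ⟨-k, ?_, ?_⟩
    · intro i j h
      exact hk' i j (by rintro rfl; exact h (by simp))
    · intro i j h
      rw [_root_.inv_inv]
      exact hk i j (by rintro rfl; exact h (by simp))

lemma vv_not_mem : v * v ∉ D1 := by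
  intro h
  obtain ⟨k, hk, -⟩ := D1_shape h
  rw [Units.val_mul, v_val, V_sq] at hk
  have h0 := hk 0 0
  have h1 := hk 1 2
  fin_cases k
  · simp at h1
  · simp at h0
  · simp at h0

/-- The homomorphism from `Q₈` determined by elements satisfying the defining relations. -/
noncomputable def lift8 {Q : Type*} [Group Q] (A X : Q) (hA : A ^ 4 = 1) (hX : X * X = A * A)
    (hAX : A * X * A = X) : QuaternionGroup 2 →* Q :=
  MonoidHom.mk' (fun q => match q with
    | .a i => A ^ (ZMod.val i)
    | .xa i => X * A ^ (ZMod.val i)) (by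
    have hm : ∀ n, A ^ n = A ^ (n % 4) := fun n => pow_eq_pow_mod n hA
    have h1 : ∀ n, A ^ n * X * A ^ n = X := by
      intro n
      induction n with
      | zero => simp
      | succ n ih =>
        calc A ^ (n + 1) * X * A ^ (n + 1) = A ^ n * (A * X * A) * A ^ n := by
              rw [pow_succ, mul_assoc (A ^ n) A X]
              rw [← pow_succ, pow_succ']; simp only [mul_assoc, ← pow_succ']
          _ = X := by rw [hAX, ih]
    have h2 : ∀ n, n ≤ 4 → A ^ n * X = X * A ^ (4 - n) := by
      intro n hn
      have : A ^ n * A ^ (4 - n) = 1 := by rw [← pow_add, Nat.add_sub_cancel' hn, hA]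
      calc A ^ n * X = A ^ n * X * (A ^ n * A ^ (4 - n)) := by rw [this, mul_one]
        _ = _ := by rw [← mul_assoc, h1]
    have hlt : ∀ i : ZMod (2 * 2), ZMod.val i < 4 := fun i => ZMod.val_lt i
    rintro (i | i) (j | j)
    · change A ^ (ZMod.val (i + j)) = A ^ (ZMod.val i) * A ^ (ZMod.val j)
      rw [← pow_add, hm (_ + _)]
      congr 1
    · change X * A ^ (ZMod.val (j - i)) = A ^ (ZMod.val i) * (X * A ^ (ZMod.val j))
      rw [← mul_assoc, h2 _ (hlt i).le, mul_assoc, ← pow_add, hm (_ + _)]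
      congr 2
    · change X * A ^ (ZMod.val (i + j)) = X * A ^ (ZMod.val i) * A ^ (ZMod.val j)
      rw [mul_assoc, ← pow_add, hm (_ + _)]
      congr 2
    · change A ^ (ZMod.val (((2 : ℕ) : ZMod (2 * 2)) + j - i)) =
        X * A ^ (ZMod.val i) * (X * A ^ (ZMod.val j))
      rw [mul_assoc, ← mul_assoc (A ^ _) X, h2 _ (hlt i).le, mul_assoc, ← mul_assoc X X, hX,
        ← pow_two A, ← pow_add, ← pow_add, hm (_ + _)]
      congr 1; revert i j; decide)

lemma lift8_a {Q : Type*} [Group Q] (A X : Q) (hA : A ^ 4 = 1) (hX : X * X = A * A)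
    (hAX : A * X * A = X) (i : ZMod (2 * 2)) :
    lift8 A X hA hX hAX (.a i) = A ^ (ZMod.val i) := rfl

lemma lift8_xa {Q : Type*} [Group Q] (A X : Q) (hA : A ^ 4 = 1) (hX : X * X = A * A)
    (hAX : A * X * A = X) (i : ZMod (2 * 2)) :
    lift8 A X hA hX hAX (.xa i) = X * A ^ (ZMod.val i) := rfl

/-- Every nontrivial element of `Q₈` is the central involution or squares to it. -/
lemma q8_cases : ∀ q : QuaternionGroup 2, q = 1 ∨ q = .a 2 ∨ q * q = .a 2 := by
  rintro (i | i)
  · revert i; decide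
  · right; right
    rw [QuaternionGroup.xa_mul_xa]; simp

lemma lift8_inj {Q : Type*} [Group Q] (A X : Q) (hA : A ^ 4 = 1) (hX : X * X = A * A)
    (hAX : A * X * A = X) (h : A * A ≠ 1) : Function.Injective (lift8 A X hA hX hAX) := by
  have h2 : lift8 A X hA hX hAX (.a 2) ≠ 1 := by
    rw [lift8_a]
    have : ZMod.val (2 : ZMod (2 * 2)) = 2 := rfl
    rwa [this, pow_two]
  rw [injective_iff_map_eq_one]
  intro q hq
  rcases q8_cases q with h | h | h
  · exact h
  · exact absurd (h ▸ hq) h2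
  · exact absurd (by rw [← h, map_mul, hq, one_mul]) h2

end Hess

open Hess

/-- `D₁ = ⟨S, T⟩` is a normal subgroup of `G₂₁₆` and the quotient `G₂₁₆/D₁` is isomorphic to
the quaternion group `Q₈` of order `8` (expressed via a surjective homomorphism
`G₂₁₆ →* Q₈` with kernel `D₁`). -/
theorem G216_quotient_D1_iso_quaternion :
    D1 ≤ G216 ∧ (D1.subgroupOf G216).Normal ∧
      ∃ φ : G216 →* QuaternionGroup 2,
        Function.Surjective φ ∧ φ.ker = D1.subgroupOf G216 := by
  have hN := D1_normal
  refine ⟨D1_le, hN, ?_⟩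
  let π : G216 →* G216 ⧸ (D1.subgroupOf G216) := QuotientGroup.mk' _
  have hker : ∀ g : G216, π g = 1 ↔ (g : GL (Fin 3) ℂ) ∈ D1 := by
    intro g
    rw [← Subgroup.mem_subgroupOf]
    exact QuotientGroup.eq_one_iff g
  let A := π ⟨v, v_mem⟩
  let X := π ⟨w, w_mem⟩
  have hA : A ^ 4 = 1 := by
    rw [← map_pow, hker]
    change v ^ 4 ∈ D1
    rw [v4]; exact one_mem _
  have hXA : X * X * (A * A) = 1 := by
    rw [← map_mul, ← map_mul, ← map_mul, hker]
    change w * w * (v * v) ∈ D1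
    rw [wwvv]; exact mul_mem s_mem s_mem
  have hX : X * X = A * A := by
    rw [eq_inv_of_mul_eq_one_left hXA]
    apply inv_eq_of_mul_eq_one_left
    rw [← hA]; simp only [pow_succ, pow_zero, one_mul, mul_assoc]
  have hAX : A * X * A = X := by
    rw [← mul_inv_eq_one, ← map_mul, ← map_mul, ← map_inv, ← map_mul, hker]
    change v * w * v * w⁻¹ ∈ D1
    rw [vwv, mul_inv_cancel_right]
    have := s_mem
    have := t_mem
    exact mul_mem (mul_mem (mul_mem (mul_mem s_mem t_mem) (mul_mem s_mem s_mem))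
      (mul_mem t_mem t_mem)) (mul_mem s_mem s_mem)
  have hne : A * A ≠ 1 := by
    rw [← map_mul, Ne, hker]
    exact vv_not_mem
  let f := lift8 A X hA hX hAX
  have hinj : Function.Injective f := lift8_inj A X hA hX hAX hne
  have hmem : ∀ g (hg : g ∈ G216), π ⟨g, hg⟩ ∈ f.range := by
    have hle : G216 ≤ (f.range.comap π).map G216.subtype := by
      conv_lhs => rw [G216_eq]
      rw [Subgroup.closure_le]
      rintro x (rfl | rfl | rfl | rfl)
      · refine ⟨⟨s, D1_le s_mem⟩, ?_, rfl⟩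
        change π _ ∈ f.range
        rw [(hker _).2 s_mem]; exact one_mem _
      · refine ⟨⟨t, D1_le t_mem⟩, ?_, rfl⟩
        change π _ ∈ f.range
        rw [(hker _).2 t_mem]; exact one_mem _
      · exact ⟨⟨v, v_mem⟩, ⟨.a 1, pow_one A⟩, rfl⟩
      · refine ⟨⟨w, w_mem⟩, ⟨.xa 0, ?_⟩, rfl⟩
        change X * A ^ 0 = X
        rw [pow_zero, mul_one]
    intro g hg
    obtain ⟨y, hy, rfl⟩ := hle hg
    exact hy
  have hsurj : Function.Surjective f := by
    intro q
    obtain ⟨g, rfl⟩ := QuotientGroup.mk'_surjective _ q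
    exact hmem g.1 g.2
  let e : QuaternionGroup 2 ≃* _ := MulEquiv.ofBijective f ⟨hinj, hsurj⟩
  refine ⟨e.symm.toMonoidHom.comp π, e.symm.surjective.comp (QuotientGroup.mk'_surjective _), ?_⟩
  ext g
  rw [MonoidHom.mem_ker, Subgroup.mem_subgroupOf, ← hker]
  change e.symm (π g) = 1 ↔ _
  exact map_eq_one_iff e.symm e.symm.injective
end

section
/- The normalizer of G₁₀₈ in SL₃(ℂ) is G₂₁₆: for every g ∈ GL₃(ℂ) with det(g) = 1, the conjugate subgroup g·G₁₀₈·g⁻¹ equals G₁₀₈ if and only if g ∈ G₂₁₆. -/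
open Matrix
open scoped MatrixGroups

namespace N108

theorem zeta_prim : IsPrimitiveRoot ζ₉ 9 := by
  have := Complex.isPrimitiveRoot_exp 9 (by norm_num)
  simpa [ζ₉] using this

theorem om_ne : ω ≠ 1 := by
  intro h
  have := zeta_prim.dvd_of_pow_eq_one 6 h
  omega

theorem om_sq : ω ^ 2 = -1 - ω := by
  have h3 : ω ^ 3 = 1 := by
    have := zeta_prim.pow_eq_one
    unfold ω
    calc (ζ₉ ^ 6) ^ 3 = (ζ₉ ^ 9) ^ 2 := by ring
      _ = 1 := by rw [this]; simp
  have h1 : ω - 1 ≠ 0 := sub_ne_zero.mpr om_ne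
  apply mul_left_cancel₀ h1
  linear_combination h3

theorem om_inv : (ω - ω ^ 2)⁻¹ = (-1 - 2 * ω) / 3 := by
  rw [← inv_inv ((-1 - 2 * ω) / 3), _root_.inv_inj]
  symm
  apply inv_eq_of_mul_eq_one_right
  have := om_sq
  grind

theorem eps_ne : ε ≠ 0 := by
  unfold ε
  exact pow_ne_zero _ (zeta_prim.ne_zero (by norm_num))

theorem V_eq : Vmat = !![(-1 - 2 * ω) / 3, (-1 - 2 * ω) / 3, (-1 - 2 * ω) / 3;
    (-1 - 2 * ω) / 3, (2 + ω) / 3, (ω - 1) / 3;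
    (-1 - 2 * ω) / 3, (ω - 1) / 3, (2 + ω) / 3] := by
  have := om_sq
  unfold Vmat
  rw [om_inv]
  ext i j
  fin_cases i <;> fin_cases j <;> simp <;> grind

/-- Explicit form of `UVU⁻¹`. -/
noncomputable def Wm : Matrix (Fin 3) (Fin 3) ℂ :=
  !![(-1 - 2 * ω) / 3, (-1 - 2 * ω) / 3, (ω - 1) / 3;
    (-1 - 2 * ω) / 3, (2 + ω) / 3, (2 + ω) / 3;
    (2 + ω) / 3, (-1 - 2 * ω) / 3, (2 + ω) / 3]

theorem W_eq : Umat * Vmat * Umat⁻¹ = Wm := by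
  have h2 := om_sq
  have h0 := eps_ne
  have hU : Umat⁻¹ = !![ε⁻¹, 0, 0; 0, ε⁻¹, 0; 0, 0, ε⁻¹ * ω ^ 2] := by
    apply Matrix.inv_eq_right_inv
    unfold Umat
    ext i j
    fin_cases i <;> fin_cases j <;> simp [Matrix.mul_apply, Fin.sum_univ_three, h0] <;> grind
  rw [hU, V_eq]
  unfold Umat Wm
  ext i j
  fin_cases i <;> fin_cases j <;> simp [Matrix.mul_apply, Fin.sum_univ_three] <;> grind

theorem S3 : Smat * Smat ^ 2 = 1 := by
  have h2 := om_sq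
  unfold Smat
  ext i j
  fin_cases i <;> fin_cases j <;> simp [pow_succ, Matrix.mul_apply, Fin.sum_univ_three] <;> grind

theorem T3 : Tmat * Tmat ^ 2 = 1 := by
  unfold Tmat
  ext i j
  fin_cases i <;> fin_cases j <;> simp [pow_succ, Matrix.mul_apply, Fin.sum_univ_three]

/-- `V²`. -/
noncomputable def V2m : Matrix (Fin 3) (Fin 3) ℂ := !![-1, 0, 0; 0, 0, -1; 0, -1, 0]

theorem V2 : Vmat ^ 2 = V2m := by
  have h2 := om_sq
  rw [V_eq, V2m]
  ext i j
  fin_cases i <;> fin_cases j <;> simp [pow_succ, Matrix.mul_apply, Fin.sum_univ_three] <;> grind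

theorem V4 : Vmat * Vmat ^ 3 = 1 := by
  have : Vmat * Vmat ^ 3 = Vmat ^ 2 * Vmat ^ 2 := by
    rw [← pow_succ', ← pow_add]
  rw [this, V2, V2m]
  ext i j
  fin_cases i <;> fin_cases j <;> simp [Matrix.mul_apply, Fin.sum_univ_three]

theorem W4 : Wm * Wm ^ 3 = 1 := by
  have : Wm * Wm ^ 3 = Wm ^ 2 * Wm ^ 2 := by
    rw [← pow_succ', ← pow_add]
  have h2 := om_sq
  have hw : Wm ^ 2 = !![-1, 0, 0; 0, 0, - ω ^ 2; 0, - ω, 0] := by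
    unfold Wm
    ext i j
    fin_cases i <;> fin_cases j <;>
      simp [pow_two, Matrix.mul_apply, Fin.sum_univ_three] <;> grind
  rw [this, hw]
  ext i j
  fin_cases i <;> fin_cases j <;> simp [Matrix.mul_apply, Fin.sum_univ_three] <;> grind

/-- A unit from a right inverse. -/
noncomputable def mk (A B : Matrix (Fin 3) (Fin 3) ℂ) (h : A * B = 1) : GL (Fin 3) ℂ :=
  ⟨A, B, h, mul_eq_one_comm.mp h⟩

noncomputable def s : GL (Fin 3) ℂ := mk Smat (Smat ^ 2) S3
noncomputable def t : GL (Fin 3) ℂ := mk Tmat (Tmat ^ 2) T3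
noncomputable def v : GL (Fin 3) ℂ := mk Vmat (Vmat ^ 3) V4
noncomputable def w : GL (Fin 3) ℂ := mk Wm (Wm ^ 3) W4

theorem Z3 : (ω • (1 : Matrix (Fin 3) (Fin 3) ℂ)) * (ω ^ 2 • (1 : Matrix (Fin 3) (Fin 3) ℂ)) = 1 := by
  have h2 := om_sq
  have : ω * ω ^ 2 = 1 := by grind
  rw [smul_mul_smul_comm, this]; simp

noncomputable def z : GL (Fin 3) ℂ := mk _ _ Z3

theorem sv : (s : Matrix (Fin 3) (Fin 3) ℂ) = Smat := rfl
theorem tv : (t : Matrix (Fin 3) (Fin 3) ℂ) = Tmat := rfl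
theorem vv : (v : Matrix (Fin 3) (Fin 3) ℂ) = Vmat := rfl
theorem wv : (w : Matrix (Fin 3) (Fin 3) ℂ) = Wm := rfl
theorem zv : (z : Matrix (Fin 3) (Fin 3) ℂ) = ω • 1 := rfl

theorem s3 : s ^ 3 = 1 := by
  ext1; rw [Units.val_pow_eq_pow_val, pow_succ', sv]; exact S3
theorem t3 : t ^ 3 = 1 := by
  ext1; rw [Units.val_pow_eq_pow_val, pow_succ', tv]; exact T3
theorem v4 : v ^ 4 = 1 := by
  ext1; rw [Units.val_pow_eq_pow_val, pow_succ', vv]; exact V4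
theorem w4 : w ^ 4 = 1 := by
  ext1; rw [Units.val_pow_eq_pow_val, pow_succ', wv]; exact W4
theorem z3 : z ^ 3 = 1 := by
  have h2 := om_sq
  have : ω ^ 3 = 1 := by grind
  ext1; rw [Units.val_pow_eq_pow_val, zv, smul_pow, this]; simp

theorem zc (g : GL (Fin 3) ℂ) : Commute z g := by
  ext1; simp [zv]

theorem ts : t * s = z * s * t := by
  have h2 := om_sq
  ext i j
  simp only [Units.val_mul, sv, tv, zv, Smat, Tmat]
  fin_cases i <;> fin_cases j <;> simp [Matrix.mul_apply, Fin.sum_univ_three] <;> grind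

theorem vs : v * s = t * v := by
  have h2 := om_sq
  ext i j
  simp only [Units.val_mul, sv, tv, vv, V_eq, Smat, Tmat]
  fin_cases i <;> fin_cases j <;> simp [Matrix.mul_apply, Fin.sum_univ_three] <;> grind

theorem vt : v * t = s ^ 2 * v := by
  have h2 := om_sq
  ext i j
  simp only [Units.val_mul, Units.val_pow_eq_pow_val, sv, tv, vv, V_eq, Smat, Tmat]
  fin_cases i <;> fin_cases j <;> simp [pow_two, Matrix.mul_apply, Fin.sum_univ_three] <;> grind

theorem ws : w * s = s ^ 2 * t * w := by
  have h2 := om_sq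
  ext i j
  simp only [Units.val_mul, Units.val_pow_eq_pow_val, sv, tv, wv, Wm, Smat, Tmat]
  fin_cases i <;> fin_cases j <;> simp [pow_two, Matrix.mul_apply, Fin.sum_univ_three] <;> grind

theorem wt : w * t = z ^ 2 * s * t * w := by
  have h2 := om_sq
  ext i j
  simp only [Units.val_mul, Units.val_pow_eq_pow_val, sv, tv, wv, zv, Wm, Smat, Tmat]
  fin_cases i <;> fin_cases j <;> simp [pow_two, Matrix.mul_apply, Fin.sum_univ_three] <;> grind

theorem wvr : w * v = z ^ 2 * t * v ^ 3 * w := by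
  have h2 := om_sq
  ext i j
  simp only [pow_succ _ 2, Units.val_mul, Units.val_pow_eq_pow_val, tv, wv, zv, vv, V2, V2m, Tmat]
  simp only [V_eq, Wm]
  fin_cases i <;> fin_cases j <;> simp [pow_two, Matrix.mul_apply, Fin.sum_univ_three] <;> grind

theorem vwr : v * w = z * t * v ^ 2 * w * v := by
  have h2 := om_sq
  ext i j
  simp only [Units.val_mul, Units.val_pow_eq_pow_val, tv, wv, zv, vv, V2, V2m, Tmat]
  simp only [V_eq, Wm]
  fin_cases i <;> fin_cases j <;> simp [Matrix.mul_apply, Fin.sum_univ_three] <;> grind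


theorem G108_eq : G108 = Subgroup.closure {s, t, v} := by
  unfold G108
  congr 1
  ext g
  simp [Units.ext_iff, sv, tv, vv]

theorem G216_eq : G216 = Subgroup.closure {s, t, v, w} := by
  unfold G216
  congr 1
  ext g
  simp [Units.ext_iff, sv, tv, vv, wv, W_eq]

theorem D1_eq : D1 = Subgroup.closure {s, t} := by
  unfold D1
  congr 1
  ext g
  simp [Units.ext_iff, sv, tv]

theorem s_D : s ∈ D1 := by rw [D1_eq]; exact Subgroup.subset_closure (by simp)
theorem t_D : t ∈ D1 := by rw [D1_eq]; exact Subgroup.subset_closure (by simp)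
theorem s_G : s ∈ G108 := by rw [G108_eq]; exact Subgroup.subset_closure (by simp)
theorem t_G : t ∈ G108 := by rw [G108_eq]; exact Subgroup.subset_closure (by simp)
theorem v_G : v ∈ G108 := by rw [G108_eq]; exact Subgroup.subset_closure (by simp)
theorem w_H : w ∈ G216 := by rw [G216_eq]; exact Subgroup.subset_closure (by simp)

theorem D_le : D1 ≤ G108 := by
  rw [D1_eq, Subgroup.closure_le]
  rintro x (rfl | rfl)
  exacts [s_G, t_G]

theorem G_le : G108 ≤ G216 := by
  rw [G108_eq, G216_eq]
  apply Subgroup.closure_mono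
  intro x
  simp; tauto

theorem z_D : z ∈ D1 := by
  have : z = t * s * t⁻¹ * s⁻¹ := by rw [ts]; group
  rw [this]
  exact mul_mem (mul_mem (mul_mem t_D s_D) (inv_mem t_D)) (inv_mem s_D)

theorem s_inv : s⁻¹ = s ^ 2 := by
  rw [inv_eq_iff_mul_eq_one, ← pow_succ']; exact s3
theorem t_inv : t⁻¹ = t ^ 2 := by
  rw [inv_eq_iff_mul_eq_one, ← pow_succ']; exact t3
theorem v_inv : v⁻¹ = v ^ 3 := by
  rw [inv_eq_iff_mul_eq_one, ← pow_succ']; exact v4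
theorem w_inv : w⁻¹ = w ^ 3 := by
  rw [inv_eq_iff_mul_eq_one, ← pow_succ']; exact w4

theorem ts_pow (b : ℕ) : t * s ^ b = z ^ b * s ^ b * t := by
  induction b with
  | zero => simp
  | succ n ih =>
    have h1 : Commute z (s ^ n) := zc _
    calc t * s ^ (n + 1) = (t * s ^ n) * s := by rw [pow_succ, mul_assoc]
      _ = z ^ n * s ^ n * (t * s) := by rw [ih]; group
      _ = z ^ n * (s ^ n * z) * s * t := by rw [ts]; simp only [mul_assoc]
      _ = z ^ (n + 1) * s ^ (n + 1) * t := by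
        rw [← h1.eq, pow_succ, pow_succ]; simp only [mul_assoc]

theorem t_pow_s (c : ℕ) : t ^ c * s = z ^ c * s * t ^ c := by
  induction c with
  | zero => simp
  | succ n ih =>
    have h1 : Commute (z ^ n) t := (zc _).pow_left n
    calc t ^ (n + 1) * s = t * (t ^ n * s) := by rw [pow_succ', mul_assoc]
      _ = (t * z ^ n) * s * t ^ n := by rw [ih]; simp only [mul_assoc]
      _ = z ^ n * (t * s) * t ^ n := by rw [← h1.eq]; simp only [mul_assoc]
      _ = z ^ (n + 1) * s * t ^ (n + 1) := by
        rw [ts, pow_succ z, pow_succ' t]; simp only [mul_assoc]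

/-- Normal form in `D1`. -/
def NF (x : GL (Fin 3) ℂ) : Prop := ∃ a b c : ℕ, x = z ^ a * s ^ b * t ^ c

theorem NF_s {x} (h : NF x) : NF (s * x) := by
  obtain ⟨a, b, c, rfl⟩ := h
  refine ⟨a, b + 1, c, ?_⟩
  have h1 : Commute (z ^ a) s := (zc _).pow_left a
  rw [pow_succ' s, ← mul_assoc, ← mul_assoc, ← h1.eq]; simp only [mul_assoc]

theorem NF_t {x} (h : NF x) : NF (t * x) := by
  obtain ⟨a, b, c, rfl⟩ := h
  refine ⟨a + b, b, c + 1, ?_⟩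
  have h1 : Commute (z ^ a) t := (zc _).pow_left a
  calc t * (z ^ a * s ^ b * t ^ c) = z ^ a * (t * s ^ b) * t ^ c := by
        rw [← mul_assoc, ← mul_assoc, ← h1.eq]; simp only [mul_assoc]
    _ = _ := by rw [ts_pow, pow_succ', pow_add]; simp only [mul_assoc]

theorem NF_D {x} (h : x ∈ D1) : NF x := by
  rw [D1_eq] at h
  induction h using Subgroup.closure_induction_left with
  | one => exact ⟨0, 0, 0, by simp⟩
  | mul_left x hx y hy ih =>
    rcases hx with rfl | rfl
    · exact NF_s ih
    · exact NF_t ih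
  | inv_mul_cancel x hx y hy ih =>
    rcases hx with rfl | rfl
    · rw [s_inv, pow_two, mul_assoc]; exact NF_s (NF_s ih)
    · rw [t_inv, pow_two, mul_assoc]; exact NF_t (NF_t ih)

theorem mod3 {x : GL (Fin 3) ℂ} (h : x ^ 3 = 1) (n : ℕ) : x ^ n = x ^ (n % 3) := by
  conv_lhs => rw [← Nat.div_add_mod n 3, pow_add, pow_mul, h, one_pow, one_mul]

/-- Generators conjugated into a subgroup by an element of finite order 4. -/
theorem norm_of {K : Subgroup (GL (Fin 3) ℂ)} {A : Set (GL (Fin 3) ℂ)}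
    (hK : K = Subgroup.closure A) {g : GL (Fin 3) ℂ} (hg : g ^ 4 = 1)
    (h : ∀ x ∈ A, g * x * g⁻¹ ∈ K) (x) : x ∈ K ↔ g * x * g⁻¹ ∈ K := by
  have key : ∀ x ∈ K, g * x * g⁻¹ ∈ K := by
    have : K.map (MulAut.conj g).toMonoidHom ≤ K := by
      conv_lhs => rw [hK]
      rw [MonoidHom.map_closure, Subgroup.closure_le]
      rintro _ ⟨x, hx, rfl⟩
      exact h x hx
    intro x hx
    exact this ⟨x, hx, rfl⟩
  refine ⟨key x, fun hx => ?_⟩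
  have := key _ (key _ (key _ hx))
  have e : g * (g * (g * (g * x * g⁻¹) * g⁻¹) * g⁻¹) * g⁻¹ = g ^ 4 * x * (g ^ 4)⁻¹ := by
    simp [pow_succ, mul_assoc]
  rw [e, hg] at this
  simpa using this

theorem v_norm_D (x) : x ∈ D1 ↔ v * x * v⁻¹ ∈ D1 := by
  refine norm_of D1_eq v4 ?_ x
  rintro x (rfl | rfl)
  · rw [vs]; simpa using t_D
  · rw [vt]; simpa using pow_mem s_D 2

theorem w_norm_G : w ∈ Subgroup.normalizer (G108 : Set (GL (Fin 3) ℂ)) := by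
  rw [Subgroup.mem_normalizer_iff]
  intro x
  refine norm_of G108_eq w4 ?_ x
  have zG := D_le z_D
  rintro x (rfl | rfl | rfl)
  · rw [ws]; simpa using mul_mem (pow_mem s_G 2) t_G
  · rw [wt]; simpa using mul_mem (mul_mem (pow_mem zG 2) s_G) t_G
  · rw [wvr]; simpa using mul_mem (mul_mem (pow_mem zG 2) t_G) (pow_mem v_G 3)

theorem H_le_N : G216 ≤ Subgroup.normalizer (G108 : Set (GL (Fin 3) ℂ)) := by
  rw [G216_eq, Subgroup.closure_le]
  have := Subgroup.le_normalizer (H := G108)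
  rintro x (rfl | rfl | rfl | rfl)
  exacts [this s_G, this t_G, this v_G, w_norm_G]

theorem v_pow_norm (k : ℕ) : ∀ x ∈ D1, v ^ k * x * (v ^ k)⁻¹ ∈ D1 := by
  induction k with
  | zero => simp
  | succ n ih =>
    intro x hx
    have := (v_norm_D _).mp (ih x hx)
    have e : v ^ (n + 1) * x * (v ^ (n + 1))⁻¹ = v * (v ^ n * x * (v ^ n)⁻¹) * v⁻¹ := by
      rw [pow_succ']; simp [mul_assoc]
    rwa [e]

theorem G_form {x} (h : x ∈ G108) : ∃ d ∈ D1, ∃ k : ℕ, x = d * v ^ k := by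
  have hv : ∀ y, (∃ d ∈ D1, ∃ k : ℕ, y = d * v ^ k) → ∃ d ∈ D1, ∃ k : ℕ, v * y = d * v ^ k := by
    rintro _ ⟨d, hd, k, rfl⟩
    exact ⟨_, (v_norm_D d).mp hd, k + 1, by rw [pow_succ']; simp [mul_assoc]⟩
  have hd : ∀ e ∈ D1, ∀ y, (∃ d ∈ D1, ∃ k : ℕ, y = d * v ^ k) →
      ∃ d ∈ D1, ∃ k : ℕ, e * y = d * v ^ k := by
    rintro e he _ ⟨d, hd, k, rfl⟩
    exact ⟨_, mul_mem he hd, k, by rw [mul_assoc]⟩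
  rw [G108_eq] at h
  induction h using Subgroup.closure_induction_left with
  | one => exact ⟨1, one_mem _, 0, by simp⟩
  | mul_left x hx y hy ih =>
    rcases hx with rfl | rfl | rfl
    · exact hd _ s_D _ ih
    · exact hd _ t_D _ ih
    · exact hv _ ih
  | inv_mul_cancel x hx y hy ih =>
    rcases hx with rfl | rfl | rfl
    · exact hd _ (inv_mem s_D) _ ih
    · exact hd _ (inv_mem t_D) _ ih
    · rw [v_inv, show v ^ 3 * y = v * (v * (v * y)) by simp [pow_succ, mul_assoc]]
      exact hv _ (hv _ (hv _ ih))

theorem D_of_cube {x} (h : x ∈ G108) (h3 : x ^ 3 = 1) : x ∈ D1 := by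
  obtain ⟨d, hd, k, hx⟩ := G_form h
  have e1 : x = x ^ 4 := by rw [pow_succ, h3, one_mul]
  have n := v_pow_norm k
  have m1 := n d hd
  have m2 := n _ m1
  have m3 := n _ m2
  have hk : (v ^ k) ^ 4 = 1 := by rw [← pow_mul, mul_comm, pow_mul, v4, one_pow]
  have e2 : x ^ 4 = d * (v ^ k * d * (v ^ k)⁻¹) * (v ^ k * (v ^ k * d * (v ^ k)⁻¹) * (v ^ k)⁻¹) *
      (v ^ k * (v ^ k * (v ^ k * d * (v ^ k)⁻¹) * (v ^ k)⁻¹) * (v ^ k)⁻¹) * (v ^ k) ^ 4 := by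
    rw [hx]
    generalize v ^ k = u
    simp [pow_succ, mul_assoc]
  rw [e1, e2, hk, mul_one]
  exact mul_mem (mul_mem (mul_mem hd m1) m2) m3

theorem s_not_scalar (i j : ℕ) (h : z ^ i * s = z ^ j) : False := by
  have h' := congrArg (fun g : GL (Fin 3) ℂ => (g : Matrix (Fin 3) (Fin 3) ℂ)) h
  have h0 := congrFun (congrFun h' 0) 0
  have h1 := congrFun (congrFun h' 1) 1
  simp [zv, sv, Smat, smul_pow] at h0 h1
  have hz : ω ≠ 0 := by
    intro h
    have := om_sq
    rw [h] at this; norm_num at this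
  have : ω ^ i ≠ 0 := pow_ne_zero _ hz
  rw [← h0] at h1
  exact om_ne (by simpa [this] using h1)

theorem NF_comm (a b c : ℕ) :
    z ^ a * s ^ b * t ^ c * s = z ^ c * s * (z ^ a * s ^ b * t ^ c) := by
  have c1 : Commute (z ^ c) (s ^ b) := (zc _).pow_left c
  have c2 : Commute (z ^ c) (z ^ a) := (zc _).pow_left c
  calc z ^ a * s ^ b * t ^ c * s = z ^ a * s ^ b * (t ^ c * s) := by simp only [mul_assoc]
    _ = z ^ a * (s ^ b * z ^ c) * s * t ^ c := by rw [t_pow_s]; simp only [mul_assoc]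
    _ = (z ^ a * z ^ c) * (s ^ b * s) * t ^ c := by rw [← c1.eq]; simp only [mul_assoc]
    _ = z ^ c * s * (z ^ a * s ^ b * t ^ c) := by
      rw [← c2.eq, ← pow_succ, pow_succ']
      have c3 : Commute (z ^ a) s := (zc _).pow_left a
      simp only [← mul_assoc]
      rw [mul_assoc (z ^ c) s, ← c3.eq]
      simp only [← mul_assoc]

theorem w_not_G : w ∉ G108 := by
  intro h
  obtain ⟨d, hd, k, hx⟩ := G_form h
  have e : v * w * v⁻¹ * w⁻¹ = (v * d * v⁻¹) * d⁻¹ := by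
    rw [hx]
    group
  have e' : v * w * v⁻¹ * w⁻¹ = z * t * v ^ 2 := by rw [vwr]; group
  have m : z * t * v ^ 2 ∈ D1 := by
    rw [← e', e]; exact mul_mem ((v_norm_D d).mp hd) (inv_mem hd)
  have m2 : v ^ 2 ∈ D1 := (Subgroup.mul_mem_cancel_left _ (mul_mem z_D t_D)).mp m
  obtain ⟨a, b, c, hv⟩ := NF_D m2
  have h1 : v ^ 2 * s = s ^ 2 * v ^ 2 := by
    rw [pow_two v, mul_assoc, vs, ← mul_assoc, vt, mul_assoc]
  have h2 : v ^ 2 * s = z ^ c * s * v ^ 2 := by rw [hv]; exact NF_comm a b c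
  rw [h1] at h2
  have h3 := mul_right_cancel h2
  rw [pow_two] at h3
  have h4 := mul_right_cancel h3
  exact s_not_scalar 0 c (by simpa using h4)


/-- `x` is conjugate to `s` under `G216`. -/
def C (x : GL (Fin 3) ℂ) : Prop := ∀ a : ℕ, ∃ h ∈ G216, h * (z ^ a * x) = s * h

theorem C_step {h x y : GL (Fin 3) ℂ} (hh : h ∈ G216) (b : ℕ) (e : h * x = z ^ b * y * h)
    (hy : C y) : C x := by
  intro a
  obtain ⟨k, hk, ek⟩ := hy (a + b)
  refine ⟨k * h, mul_mem hk hh, ?_⟩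
  have c1 : Commute (z ^ a) h := (zc _).pow_left a
  calc k * h * (z ^ a * x) = k * (h * z ^ a) * x := by simp only [mul_assoc]
    _ = k * z ^ a * (h * x) := by rw [← c1.eq]; simp only [mul_assoc]
    _ = k * (z ^ (a + b) * y) * h := by rw [e, pow_add]; simp only [mul_assoc]
    _ = _ := by rw [ek, mul_assoc]

theorem v_H : v ∈ G216 := G_le v_G

theorem C_s : C s := by
  intro a
  refine ⟨t ^ (2 * a), pow_mem (G_le t_G) _, ?_⟩
  have c1 : Commute (z ^ a) (t ^ (2 * a)) := (zc _).pow_left a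
  rw [← mul_assoc, ← c1.eq, mul_assoc, t_pow_s, ← mul_assoc, ← mul_assoc, ← pow_add,
    show a + 2 * a = 3 * a by ring, pow_mul, z3, one_pow, one_mul]

theorem C_t : C t := by
  refine C_step (inv_mem v_H) 0 ?_ C_s
  rw [pow_zero, one_mul, inv_mul_eq_iff_eq_mul, ← mul_assoc, vs]; simp

theorem C_s2 : C (s ^ 2) := by
  refine C_step (inv_mem v_H) 0 ?_ C_t
  rw [pow_zero, one_mul, inv_mul_eq_iff_eq_mul, ← mul_assoc, vt]; simp

theorem C_t2 : C (t ^ 2) := by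
  refine C_step v_H 0 ?_ C_s
  rw [pow_zero, one_mul, pow_two, ← mul_assoc, vt, mul_assoc, vt, ← mul_assoc, ← pow_add,
    show 2 + 2 = 3 + 1 from rfl, pow_succ, s3, one_mul]

theorem C_st : C (s * t) := by
  refine C_step w_H 0 ?_ C_t2
  have h2 := om_sq
  ext i j
  simp only [Units.val_mul, Units.val_pow_eq_pow_val, sv, tv, wv, zv, Wm, Smat, Tmat]
  fin_cases i <;> fin_cases j <;> simp [pow_two, Matrix.mul_apply, Fin.sum_univ_three] <;> grind

theorem C_s2t : C (s ^ 2 * t) := by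
  refine C_step (inv_mem w_H) 0 ?_ C_s
  rw [pow_zero, one_mul, inv_mul_eq_iff_eq_mul, ← mul_assoc, ws]; simp

theorem C_st2 : C (s * t ^ 2) := by
  refine C_step w_H 1 ?_ C_s
  have h2 := om_sq
  ext i j
  simp only [Units.val_mul, Units.val_pow_eq_pow_val, sv, tv, wv, zv, Wm, Smat, Tmat]
  fin_cases i <;> fin_cases j <;> simp [pow_two, Matrix.mul_apply, Fin.sum_univ_three] <;> grind

theorem C_s2t2 : C (s ^ 2 * t ^ 2) := by
  refine C_step v_H 2 ?_ C_st2
  have h2 := om_sq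
  ext i j
  simp only [Units.val_mul, Units.val_pow_eq_pow_val, sv, tv, vv, zv, V_eq, Smat, Tmat]
  fin_cases i <;> fin_cases j <;> simp [pow_two, Matrix.mul_apply, Fin.sum_univ_three] <;> grind

theorem det_H {h : GL (Fin 3) ℂ} (hh : h ∈ G216) : (h : Matrix (Fin 3) (Fin 3) ℂ).det = 1 := by
  have h2 := om_sq
  have : G216 ≤ (Matrix.GeneralLinearGroup.det (n := Fin 3) (R := ℂ)).ker := by
    rw [G216_eq, Subgroup.closure_le]
    rintro x (rfl | rfl | rfl | rfl)
    · apply Units.ext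
      simp [sv, Smat, Matrix.det_fin_three]; grind
    · apply Units.ext
      simp [tv, Tmat, Matrix.det_fin_three]
    · apply Units.ext
      simp [vv, V_eq, Matrix.det_fin_three]; grind
    · apply Units.ext
      simp [wv, Wm, Matrix.det_fin_three]; grind
  have := this hh
  rw [MonoidHom.mem_ker] at this
  simpa using congrArg Units.val this

theorem z_ne : z ≠ 1 := by
  intro h
  have h' := congrArg (fun g : GL (Fin 3) ℂ => (g : Matrix (Fin 3) (Fin 3) ℂ)) h
  have h0 := congrFun (congrFun h' 0) 0
  simp [zv] at h0
  exact om_ne h0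

theorem diag_of_comm {g : GL (Fin 3) ℂ} (h : g * s = s * g) :
    ∃ x y u : ℂ, (g : Matrix (Fin 3) (Fin 3) ℂ) = !![x, 0, 0; 0, y, 0; 0, 0, u] := by
  have h2 := om_sq
  have h1 : ω - 1 ≠ 0 := sub_ne_zero.mpr om_ne
  have h' := congrArg (fun g : GL (Fin 3) ℂ => (g : Matrix (Fin 3) (Fin 3) ℂ)) h
  have e := fun i j => congrFun (congrFun h' i) j
  have e01 := e 0 1
  have e02 := e 0 2
  have e10 := e 1 0
  have e12 := e 1 2
  have e20 := e 2 0
  have e21 := e 2 1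
  simp [sv, Smat, Matrix.mul_apply, Fin.sum_univ_three, -mul_eq_left₀, -mul_eq_right₀,
    -left_eq_mul₀, -right_eq_mul₀] at e01 e02 e10 e12 e20 e21
  refine ⟨g 0 0, g 1 1, g 2 2, ?_⟩
  ext i j
  fin_cases i <;> fin_cases j <;> simp <;> grind

theorem final {g : GL (Fin 3) ℂ} (hd : (g : Matrix (Fin 3) (Fin 3) ℂ).det = 1)
    (hN : g ∈ Subgroup.normalizer (G108 : Set (GL (Fin 3) ℂ)))
    (h1 : g * s = s * g) (b : ℕ) (hb : b < 3) (h2 : g * t = s ^ b * t * g) : g ∈ G216 := by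
  obtain ⟨x, y, u, hg⟩ := diag_of_comm h1
  have o2 := om_sq
  have h' := congrArg (fun g : GL (Fin 3) ℂ => (g : Matrix (Fin 3) (Fin 3) ℂ)) h2
  have e := fun i j => congrFun (congrFun h' i) j
  have e01 := e 0 1
  have e12 := e 1 2
  have e20 := e 2 0
  interval_cases b
  · simp [hg, tv, Tmat, Matrix.mul_apply, Fin.sum_univ_three] at e01 e12 e20
    subst e01 e12
    rw [hg] at hd
    simp [Matrix.det_fin_three] at hd
    have : (x - 1) * (x - ω) * (x - ω ^ 2) = 0 := by grind
    have hz : ∃ k : ℕ, x = ω ^ k := by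
      rcases mul_eq_zero.mp this with h | h
      · rcases mul_eq_zero.mp h with h | h
        · exact ⟨0, by linear_combination h⟩
        · exact ⟨1, by linear_combination h⟩
      · exact ⟨2, by linear_combination h⟩
    obtain ⟨k, rfl⟩ := hz
    have : g = z ^ k := by
      ext i j
      rw [hg]
      simp only [Units.val_pow_eq_pow_val, zv, smul_pow, one_pow]
      fin_cases i <;> fin_cases j <;> simp
    rw [this]
    exact G_le (D_le (pow_mem z_D k))
  · exfalso
    simp [hg, sv, tv, Smat, Tmat, pow_two, Matrix.mul_apply, Fin.sum_univ_three] at e01 e12 e20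
    have : v * g = g * w := by
      ext i j
      simp only [Units.val_mul, hg, vv, wv, V_eq, Wm]
      fin_cases i <;> fin_cases j <;> simp [Matrix.mul_apply, Fin.sum_univ_three] <;> grind
    apply w_not_G
    have e : w = g⁻¹ * v * g := by rw [mul_assoc, this]; simp
    rw [e]
    exact (Subgroup.mem_normalizer_iff''.mp hN v).mp v_G
  · exfalso
    simp [hg, sv, tv, Smat, Tmat, pow_two, Matrix.mul_apply, Fin.sum_univ_three] at e01 e12 e20
    have : g * v = w * g := by
      ext i j
      simp only [Units.val_mul, hg, vv, wv, V_eq, Wm]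
      fin_cases i <;> fin_cases j <;> simp [Matrix.mul_apply, Fin.sum_univ_three] <;> grind
    apply w_not_G
    have e : w = g * v * g⁻¹ := by rw [this]; simp
    rw [e]
    exact (Subgroup.mem_normalizer_iff.mp hN v).mp v_G

theorem conj_D {g x : GL (Fin 3) ℂ} (hN : g ∈ Subgroup.normalizer (G108 : Set (GL (Fin 3) ℂ)))
    (hx : x ∈ G108) (h3 : x ^ 3 = 1) : NF (g * x * g⁻¹) := by
  apply NF_D
  apply D_of_cube ((Subgroup.mem_normalizer_iff.mp hN x).mp hx)
  rw [conj_pow, h3]; simp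

theorem exists_C {g : GL (Fin 3) ℂ} (hN : g ∈ Subgroup.normalizer (G108 : Set (GL (Fin 3) ℂ))) :
    ∃ h ∈ G216, h * (g * s * g⁻¹) = s * h := by
  obtain ⟨a, b, c, e⟩ := conj_D hN s_G s3
  rw [mod3 s3 b, mod3 t3 c] at e
  have hb := Nat.mod_lt b (show 0 < 3 by norm_num)
  have hc := Nat.mod_lt c (show 0 < 3 by norm_num)
  rw [e, mul_assoc]
  revert e
  generalize b % 3 = b at hb ⊢
  generalize c % 3 = c at hc ⊢
  intro e
  interval_cases b <;> interval_cases c <;>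
    try simp only [pow_zero, pow_one, one_mul, mul_one]
  · exfalso
    simp only [pow_zero, mul_one] at e
    have c1 : Commute (z ^ a) g := (zc _).pow_left a
    rw [mul_inv_eq_iff_eq_mul, c1.eq] at e
    exact s_not_scalar 0 a (by simpa using mul_left_cancel e)
  · exact C_t a
  · exact C_t2 a
  · exact C_s a
  · exact C_st a
  · exact C_st2 a
  · exact C_s2 a
  · exact C_s2t a
  · exact C_s2t2 a

theorem forward {g : GL (Fin 3) ℂ} (hd : (g : Matrix (Fin 3) (Fin 3) ℂ).det = 1)
    (hN : g ∈ Subgroup.normalizer (G108 : Set (GL (Fin 3) ℂ))) : g ∈ G216 := by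
  obtain ⟨h, hh, e⟩ := exists_C hN
  rw [← Subgroup.mul_mem_cancel_left _ hh]
  have e1 : h * g * s = s * (h * g) := by
    rw [← mul_assoc, ← e]; simp [mul_assoc]
  have hN1 := mul_mem (H_le_N hh) hN
  have hd1 : ((h * g : GL (Fin 3) ℂ) : Matrix (Fin 3) (Fin 3) ℂ).det = 1 := by
    rw [Units.val_mul, Matrix.det_mul, hd, det_H hh, one_mul]
  generalize h * g = k at *
  obtain ⟨a, b, c, et⟩ := conj_D hN1 t_G t3
  have hzc : z ^ c = z := by
    have x1 := NF_comm a b c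
    rw [← et] at x1
    have x2 : k * t * k⁻¹ * s = z * s * (k * t * k⁻¹) := by
      have y1 : k⁻¹ * s = s * k⁻¹ := by
        rw [inv_mul_eq_iff_eq_mul, ← mul_assoc, e1]; simp
      calc k * t * k⁻¹ * s = k * (t * s) * k⁻¹ := by
            rw [mul_assoc, y1]; simp only [mul_assoc]
        _ = (k * z) * s * t * k⁻¹ := by rw [ts]; simp only [mul_assoc]
        _ = z * (k * s) * t * k⁻¹ := by rw [← (zc k).eq]; simp only [mul_assoc]
        _ = _ := by rw [e1]; simp only [mul_assoc]
    rw [x1] at x2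
    exact mul_right_cancel (mul_right_cancel x2)
  have htc : t ^ c = t := by
    rw [mod3 z3] at hzc
    rw [mod3 t3]
    have hc := Nat.mod_lt c (show 0 < 3 by norm_num)
    generalize c % 3 = c at *
    interval_cases c
    · exact absurd (by simpa using hzc.symm) z_ne
    · simp
    · exact absurd (by simpa [pow_two] using hzc) z_ne
  rw [htc, mod3 s3 b] at et
  rw [← Subgroup.mul_mem_cancel_left _ (pow_mem (G_le s_G) a)]
  refine final ?_ (mul_mem (H_le_N (pow_mem (G_le s_G) a)) hN1) ?_ (b % 3)
    (Nat.mod_lt _ (by norm_num)) ?_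
  · rw [Units.val_mul, Matrix.det_mul, hd1, det_H (pow_mem (G_le s_G) a), one_mul]
  · rw [mul_assoc, e1, ← mul_assoc, ← mul_assoc, ← pow_succ, ← pow_succ']
  · generalize b % 3 = b at *
    rw [mul_inv_eq_iff_eq_mul] at et
    have c1 : Commute (z ^ a) (s ^ a) := (zc _).pow_left a
    have c2 : Commute (z ^ a) (s ^ b) := (zc _).pow_left a
    calc s ^ a * k * t = (s ^ a * z ^ a) * s ^ b * t * k := by
          rw [mul_assoc, et]; simp only [mul_assoc]
      _ = z ^ a * (s ^ a * s ^ b) * t * k := by rw [← c1.eq]; simp only [mul_assoc]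
      _ = (z ^ a * s ^ b) * s ^ a * t * k := by
          rw [← pow_add, add_comm, pow_add]; simp only [mul_assoc]
      _ = s ^ b * (z ^ a * s ^ a * t) * k := by rw [c2.eq]; simp only [mul_assoc]
      _ = _ := by rw [← ts_pow]; simp only [mul_assoc]

end N108

/-- The normalizer of `G₁₀₈` in `SL₃(ℂ)` is `G₂₁₆`: for every `g ∈ GL₃(ℂ)` with `det g = 1`,
one has `g·G₁₀₈·g⁻¹ = G₁₀₈` if and only if `g ∈ G₂₁₆`. -/
theorem normalizer_G108_eq_G216 :
    ∀ g : GL (Fin 3) ℂ, (g : Matrix (Fin 3) (Fin 3) ℂ).det = 1 →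
      (Subgroup.map (MulAut.conj g).toMonoidHom G108 = G108 ↔ g ∈ G216) := by
  intro g hd
  refine Iff.trans Subgroup.mem_normalizer_iff_map_conj_eq.symm ?_
  exact ⟨N108.forward hd, fun h => N108.H_le_N h⟩
end

section
/- The group G₁₀₈ is finite, and in the field ℂ(x) of rational functions one has the Molien-series identity Σ_{g ∈ G₁₀₈} det(I₃ − x·g)⁻¹ = 108·(1 − x³ + x⁶ + x¹² − x¹⁵ + x¹⁸)/((1 − x³)³·(1 + x³)²·(1 + x⁶)). -/
open Matrix
open scoped MatrixGroups

/-- The Molien term `det(I₃ − x·g)⁻¹ ∈ ℂ(x)` of `g ∈ GL₃(ℂ)`. -/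
noncomputable def molienTerm (g : GL (Fin 3) ℂ) : RatFunc ℂ :=
  (Matrix.det ((1 : Matrix (Fin 3) (Fin 3) (RatFunc ℂ)) -
      (g : Matrix (Fin 3) (Fin 3) ℂ).map (fun z => RatFunc.X * RatFunc.C z)))⁻¹


namespace Molien

lemma omega_rel : ω ^ 2 + ω + 1 = 0 := by
  have h : IsPrimitiveRoot ζ₉ 9 := by
    have := Complex.isPrimitiveRoot_exp 9 (by norm_num)
    simpa [ζ₉] using this
  have h3 : IsPrimitiveRoot (ζ₉ ^ 3) 3 := h.pow (by norm_num) (by norm_num)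
  have h9 : ζ₉ ^ 9 = 1 := h.pow_eq_one
  have hne : ζ₉ ^ 3 - 1 ≠ 0 := sub_ne_zero.mpr (h3.ne_one (by norm_num))
  have hz : (ζ₉ ^ 3 - 1) * (ζ₉ ^ 6 + ζ₉ ^ 3 + 1) = 0 := by linear_combination h9
  have hz' := (mul_eq_zero.mp hz).resolve_left hne
  unfold ω
  linear_combination hz' + ζ₉ ^ 3 * h9

lemma omega_cube : ω ^ 3 = 1 := by linear_combination (ω - 1) * omega_rel

lemma omega_ne_zero : ω ≠ 0 := by
  intro h; have := omega_rel; simp [h] at this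

lemma omega_ne_one : ω ≠ 1 := by
  intro h; have := omega_rel; rw [h] at this; norm_num at this

lemma inv_sqrt : (ω - ω ^ 2)⁻¹ = -(1 + 2 * ω) / 3 := by
  apply inv_eq_of_mul_eq_one_left
  linear_combination (-1 + 2 * ω / 3) * omega_rel

/-- Explicit form of `V`. -/
lemma Vmat_eq : Vmat = !![-(1 + 2 * ω) / 3, -(1 + 2 * ω) / 3, -(1 + 2 * ω) / 3;
    -(1 + 2 * ω) / 3, (2 + ω) / 3, (-1 + ω) / 3;
    -(1 + 2 * ω) / 3, (-1 + ω) / 3, (2 + ω) / 3] := by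
  have h := omega_rel
  unfold Vmat
  rw [inv_sqrt]
  ext i j
  fin_cases i <;> fin_cases j <;> simp <;> grind

lemma Smat_sq : Smat ^ 2 = !![1, 0, 0; 0, ω ^ 2, 0; 0, 0, ω] := by
  have h := omega_cube
  rw [pow_two]; unfold Smat
  ext i j
  fin_cases i <;> fin_cases j <;> simp [Matrix.mul_apply, Fin.sum_univ_three] <;> grind

lemma Tmat_sq : Tmat ^ 2 = !![0, 0, 1; 1, 0, 0; 0, 1, 0] := by
  rw [pow_two]; unfold Tmat
  ext i j
  fin_cases i <;> fin_cases j <;> simp [Matrix.mul_apply, Fin.sum_univ_three]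

lemma Vmat_sq : Vmat ^ 2 = !![-1, 0, 0; 0, 0, -1; 0, -1, 0] := by
  have h := omega_rel
  rw [pow_two, Vmat_eq]
  ext i j
  fin_cases i <;> fin_cases j <;> simp [Matrix.mul_apply, Fin.sum_univ_three] <;> grind

lemma Vmat_cube : Vmat ^ 3 = !![(1 + 2 * ω) / 3, (1 + 2 * ω) / 3, (1 + 2 * ω) / 3;
    (1 + 2 * ω) / 3, -(-1 + ω) / 3, -(2 + ω) / 3;
    (1 + 2 * ω) / 3, -(2 + ω) / 3, -(-1 + ω) / 3] := by
  rw [pow_succ, Vmat_sq, Vmat_eq]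
  ext i j
  fin_cases i <;> fin_cases j <;> simp [Matrix.mul_apply, Fin.sum_univ_three] <;> ring

lemma Smat_cube : Smat ^ 3 = 1 := by
  have h := omega_cube
  rw [pow_succ, Smat_sq]; unfold Smat
  ext i j
  fin_cases i <;> fin_cases j <;> simp [Matrix.mul_apply, Fin.sum_univ_three] <;> grind

lemma Tmat_cube : Tmat ^ 3 = 1 := by
  rw [pow_succ, Tmat_sq]; unfold Tmat
  ext i j
  fin_cases i <;> fin_cases j <;> simp [Matrix.mul_apply, Fin.sum_univ_three]

lemma Vmat_four : Vmat ^ 4 = 1 := by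
  rw [show 4 = 2 * 2 from rfl, pow_mul, Vmat_sq, pow_two]
  ext i j
  fin_cases i <;> fin_cases j <;> simp [Matrix.mul_apply, Fin.sum_univ_three]

lemma TS : Tmat * Smat = ω • (Smat * Tmat) := by
  have h := omega_cube
  unfold Tmat Smat
  ext i j
  fin_cases i <;> fin_cases j <;> simp [Matrix.mul_apply, Fin.sum_univ_three] <;> grind

lemma VS : Vmat * Smat = Tmat * Vmat := by
  have h := omega_rel
  rw [Vmat_eq]; unfold Tmat Smat
  ext i j
  fin_cases i <;> fin_cases j <;> simp [Matrix.mul_apply, Fin.sum_univ_three] <;> grind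

lemma VT : Vmat * Tmat = Smat ^ 2 * Vmat := by
  have h := omega_rel
  rw [Vmat_eq, Smat_sq]; unfold Tmat
  ext i j
  fin_cases i <;> fin_cases j <;> simp [Matrix.mul_apply, Fin.sum_univ_three] <;> grind

/-- `S` as an element of `GL₃(ℂ)`. -/
noncomputable def gs : GL (Fin 3) ℂ := Units.ofPowEqOne Smat 3 Smat_cube (by norm_num)
/-- `T` as an element of `GL₃(ℂ)`. -/
noncomputable def gt : GL (Fin 3) ℂ := Units.ofPowEqOne Tmat 3 Tmat_cube (by norm_num)
/-- `V` as an element of `GL₃(ℂ)`. -/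
noncomputable def gv : GL (Fin 3) ℂ := Units.ofPowEqOne Vmat 4 Vmat_four (by norm_num)
/-- The scalar matrix `ω` as an element of `GL₃(ℂ)`. -/
noncomputable def gz : GL (Fin 3) ℂ :=
  Units.ofPowEqOne (ω • (1 : Matrix (Fin 3) (Fin 3) ℂ)) 3
    (by rw [smul_pow, omega_cube, one_pow, one_smul]) (by norm_num)

lemma gs3 : gs ^ 3 = 1 := Units.ext Smat_cube
lemma gt3 : gt ^ 3 = 1 := Units.ext Tmat_cube
lemma gv4 : gv ^ 4 = 1 := Units.ext Vmat_four
lemma gz3 : gz ^ 3 = 1 := Units.pow_ofPowEqOne _ _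

lemma gz_comm (g : GL (Fin 3) ℂ) : Commute gz g := by
  apply Units.ext; simp [gz]

lemma ts : gt * gs = gz * (gs * gt) := by
  apply Units.ext; simp [gz, gt, gs, TS]
lemma vs : gv * gs = gt * gv := Units.ext VS
lemma vt : gv * gt = gs ^ 2 * gv := Units.ext VT

lemma ts_pow (a : ℕ) : gt * gs ^ a = gz ^ a * (gs ^ a * gt) := by
  induction a with
  | zero => simp
  | succ n ih =>
    have h1 : gs ^ n * gz = gz * gs ^ n := ((gz_comm gs).pow_right n).eq.symm
    calc gt * gs ^ (n + 1) = (gt * gs ^ n) * gs := by rw [pow_succ, mul_assoc]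
      _ = gz ^ n * (gs ^ n * (gt * gs)) := by rw [ih]; simp only [mul_assoc]
      _ = gz ^ n * ((gs ^ n * gz) * (gs * gt)) := by rw [ts]; simp only [mul_assoc]
      _ = _ := by rw [h1, pow_succ, pow_succ]; simp only [mul_assoc]

lemma vs_pow (a : ℕ) : gv * gs ^ a = gt ^ a * gv :=
  (show SemiconjBy gv gs gt from vs).pow_right a
lemma vt_pow (a : ℕ) : gv * gt ^ a = gs ^ (2 * a) * gv := by
  rw [pow_mul]; exact (show SemiconjBy gv gt (gs ^ 2) from vt).pow_right a

lemma tt_pow (b a : ℕ) : gt ^ b * gs ^ a = gz ^ (b * a) * (gs ^ a * gt ^ b) := by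
  induction b with
  | zero => simp
  | succ n ih =>
    have h1 : gt * gz ^ (n * a) = gz ^ (n * a) * gt := ((gz_comm gt).pow_left _).eq.symm
    calc gt ^ (n + 1) * gs ^ a = gt * (gt ^ n * gs ^ a) := by rw [pow_succ', mul_assoc]
      _ = (gt * gz ^ (n * a)) * (gs ^ a * gt ^ n) := by rw [ih, mul_assoc]
      _ = gz ^ (n * a) * ((gt * gs ^ a) * gt ^ n) := by rw [h1]; simp only [mul_assoc]
      _ = _ := by
        rw [ts_pow, pow_succ', add_mul, pow_add, one_mul]; simp only [mul_assoc]

/-- The normal form `ω^c S^a T^b V^k`. -/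
noncomputable def nf (a b c k : ℕ) : GL (Fin 3) ℂ := gz ^ c * (gs ^ a * (gt ^ b * gv ^ k))

lemma s_nf (a b c k : ℕ) : gs * nf a b c k = nf (a + 1) b c k := by
  unfold nf
  rw [← mul_assoc, ← ((gz_comm gs).pow_left c).eq, pow_succ']; simp only [mul_assoc]

lemma t_nf (a b c k : ℕ) : gt * nf a b c k = nf a (b + 1) (c + a) k := by
  unfold nf
  rw [← mul_assoc, ← ((gz_comm gt).pow_left c).eq, pow_succ', pow_add, mul_assoc,
    ← mul_assoc gt, ts_pow]; simp only [mul_assoc]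

lemma v_nf (a b c k : ℕ) : gv * nf a b c k = nf (2 * b) a (c + a * (2 * b)) (k + 1) := by
  unfold nf
  rw [← mul_assoc, ← ((gz_comm gv).pow_left c).eq, pow_succ', pow_add, mul_assoc,
    ← mul_assoc gv, vs_pow, mul_assoc, ← mul_assoc gv, vt_pow, mul_assoc, ← mul_assoc (gt ^ a),
    tt_pow]; simp only [mul_assoc]

lemma inv_eq_pow {g : GL (Fin 3) ℂ} {n : ℕ} (h : g ^ (n + 1) = 1) : g⁻¹ = g ^ n :=
  inv_eq_of_mul_eq_one_right (by rw [← pow_succ', h])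

lemma mem_nf {g : GL (Fin 3) ℂ} (hg : g ∈ G108) : ∃ a b c k, g = nf a b c k := by
  have hS : ∀ y : GL (Fin 3) ℂ, (∃ a b c k, y = nf a b c k) → ∃ a b c k, gs * y = nf a b c k := by
    rintro _ ⟨a, b, c, k, rfl⟩; exact ⟨_, _, _, _, s_nf a b c k⟩
  have hT : ∀ y : GL (Fin 3) ℂ, (∃ a b c k, y = nf a b c k) → ∃ a b c k, gt * y = nf a b c k := by
    rintro _ ⟨a, b, c, k, rfl⟩; exact ⟨_, _, _, _, t_nf a b c k⟩
  have hV : ∀ y : GL (Fin 3) ℂ, (∃ a b c k, y = nf a b c k) → ∃ a b c k, gv * y = nf a b c k := by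
    rintro _ ⟨a, b, c, k, rfl⟩; exact ⟨_, _, _, _, v_nf a b c k⟩
  have key : ∀ x : GL (Fin 3) ℂ, ((x : Matrix (Fin 3) (Fin 3) ℂ) = Smat ∨
      (x : Matrix (Fin 3) (Fin 3) ℂ) = Tmat ∨ (x : Matrix (Fin 3) (Fin 3) ℂ) = Vmat) →
      x = gs ∨ x = gt ∨ x = gv := by
    rintro x (h | h | h)
    · exact Or.inl (Units.ext h)
    · exact Or.inr (Or.inl (Units.ext h))
    · exact Or.inr (Or.inr (Units.ext h))
  unfold G108 at hg
  induction hg using Subgroup.closure_induction_left with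
  | one => exact ⟨0, 0, 0, 0, by simp [nf]⟩
  | mul_left x hx y hy ih =>
    rcases key x hx with rfl | rfl | rfl
    · exact hS y ih
    · exact hT y ih
    · exact hV y ih
  | inv_mul_cancel x hx y hy ih =>
    rcases key x hx with rfl | rfl | rfl
    · rw [inv_eq_pow gs3, pow_two, mul_assoc]; exact hS _ (hS _ ih)
    · rw [inv_eq_pow gt3, pow_two, mul_assoc]; exact hT _ (hT _ ih)
    · rw [inv_eq_pow gv4, pow_succ, pow_two, mul_assoc, mul_assoc]; exact hV _ (hV _ (hV _ ih))

lemma gs_mem : gs ∈ G108 := Subgroup.subset_closure (Or.inl rfl)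
lemma gt_mem : gt ∈ G108 := Subgroup.subset_closure (Or.inr (Or.inl rfl))
lemma gv_mem : gv ∈ G108 := Subgroup.subset_closure (Or.inr (Or.inr rfl))
lemma gz_mem : gz ∈ G108 := by
  have : gz = (gt * gs) * (gs * gt)⁻¹ := by rw [ts, mul_inv_cancel_right]
  rw [this]
  exact mul_mem (mul_mem gt_mem gs_mem) (inv_mem (mul_mem gs_mem gt_mem))

/-- The parametrization of `G₁₀₈`. -/
noncomputable def φ (p : Fin 4 × Fin 3 × Fin 3 × Fin 3) : GL (Fin 3) ℂ :=
  nf p.2.1 p.2.2.1 p.2.2.2 p.1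

lemma range_φ : Set.range φ = (G108 : Set (GL (Fin 3) ℂ)) := by
  ext g
  constructor
  · rintro ⟨p, rfl⟩
    exact mul_mem (pow_mem gz_mem _) (mul_mem (pow_mem gs_mem _)
      (mul_mem (pow_mem gt_mem _) (pow_mem gv_mem _)))
  · intro hg
    obtain ⟨a, b, c, k, rfl⟩ := mem_nf hg
    refine ⟨(⟨k % 4, Nat.mod_lt _ (by norm_num)⟩, ⟨a % 3, Nat.mod_lt _ (by norm_num)⟩,
      ⟨b % 3, Nat.mod_lt _ (by norm_num)⟩, ⟨c % 3, Nat.mod_lt _ (by norm_num)⟩), ?_⟩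
    simp only [φ, nf]
    rw [← pow_eq_pow_mod c gz3, ← pow_eq_pow_mod a gs3, ← pow_eq_pow_mod b gt3,
      ← pow_eq_pow_mod k gv4]

/-- The matrix `S^a T^b V^k`. -/
noncomputable def mat (k : Fin 4) (a b : Fin 3) : Matrix (Fin 3) (Fin 3) ℂ :=
  Smat ^ (a : ℕ) * Tmat ^ (b : ℕ) * Vmat ^ (k : ℕ)

lemma φ_coe (k : Fin 4) (a b c : Fin 3) :
    (φ (k, a, b, c) : Matrix (Fin 3) (Fin 3) ℂ) = ω ^ (c : ℕ) • mat k a b := by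
  simp [φ, nf, mat, gz, gs, gt, gv, smul_pow, mul_assoc]

/-- Explicit diagonal matrix `S^a`. -/
lemma Smat_pow (a : ℕ) : Smat ^ a = !![1, 0, 0; 0, ω ^ a, 0; 0, 0, ω ^ (2 * a)] := by
  have : Smat = Matrix.diagonal ![1, ω, ω ^ 2] := by
    unfold Smat; ext i j; fin_cases i <;> fin_cases j <;> simp
  rw [this, Matrix.diagonal_pow]
  ext i j; fin_cases i <;> fin_cases j <;> simp [pow_mul]

lemma molienTerm_smul (g : GL (Fin 3) ℂ) (q : ℂ) (M : Matrix (Fin 3) (Fin 3) ℂ)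
    (hg : (g : Matrix (Fin 3) (Fin 3) ℂ) = q • M) (t e d : ℂ)
    (ht : M 0 0 + M 1 1 + M 2 2 = t)
    (he : M 0 0 * M 1 1 - M 0 1 * M 1 0 + (M 0 0 * M 2 2 - M 0 2 * M 2 0) +
      (M 1 1 * M 2 2 - M 1 2 * M 2 1) = e)
    (hd : M.det = d) :
    molienTerm g = (1 - RatFunc.C t * (RatFunc.C q * RatFunc.X) +
      RatFunc.C e * (RatFunc.C q * RatFunc.X) ^ 2 -
      RatFunc.C d * (RatFunc.C q * RatFunc.X) ^ 3)⁻¹ := by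
  subst ht he hd
  unfold molienTerm
  rw [hg]
  congr 1
  rw [Matrix.det_fin_three, Matrix.det_fin_three]
  simp
  ring

/-- Explicit powers of `T`. -/
def tp : ℕ → Matrix (Fin 3) (Fin 3) ℂ
  | 0 => 1
  | 1 => !![0, 1, 0; 0, 0, 1; 1, 0, 0]
  | _ => !![0, 0, 1; 1, 0, 0; 0, 1, 0]

lemma Tmat_pow {b : ℕ} (hb : b < 3) : Tmat ^ b = tp b := by
  interval_cases b
  · simp [tp]
  · simp [tp, Tmat]
  · simp [tp, Tmat_sq]

lemma omega_prim : IsPrimitiveRoot ω 3 :=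
  IsPrimitiveRoot.mk_of_lt _ (by norm_num) omega_cube (by
    intro l h0 h3 h
    interval_cases l
    · exact omega_ne_one (by simpa using h)
    · apply omega_ne_one
      have := omega_cube
      linear_combination this - ω * h)

lemma one_add_two_omega : (1 + 2 * ω) ≠ 0 := by
  intro h
  have h1 : (3 : ℂ) = 0 := by linear_combination 4 * omega_rel - (1 + 2 * ω) * h
  norm_num at h1

lemma nf_coe (a b c k : ℕ) : (nf a b c k : Matrix (Fin 3) (Fin 3) ℂ) =
    ω ^ c • (Smat ^ a * Tmat ^ b * Vmat ^ k) := by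
  simp [nf, gz, gs, gt, gv, smul_pow, mul_assoc]

lemma nf_mod (a b c k : ℕ) : nf a b c k = nf a (b % 3) c (k % 4) := by
  simp only [nf]
  rw [← pow_eq_pow_mod b gt3, ← pow_eq_pow_mod k gv4]

lemma neg_omega_pow (c : ℕ) : -ω ^ c ≠ 1 := by
  intro h
  have h1 : (-ω ^ c) ^ 3 = -1 := by
    rw [neg_pow, ← pow_mul, mul_comm c, pow_mul, omega_cube]; norm_num
  rw [h] at h1
  norm_num at h1

lemma nf_eq_one {a b c k : ℕ} (h : nf a b c k = 1) : 3 ∣ a ∧ 3 ∣ b ∧ 3 ∣ c ∧ 4 ∣ k := by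
  rw [nf_mod] at h
  rw [Nat.dvd_iff_mod_eq_zero (n := b), Nat.dvd_iff_mod_eq_zero (n := k)]
  have hb : b % 3 < 3 := Nat.mod_lt _ (by norm_num)
  have hk : k % 4 < 4 := Nat.mod_lt _ (by norm_num)
  generalize b % 3 = b' at *
  generalize k % 4 = k' at *
  have h' : (nf a b' c k' : Matrix (Fin 3) (Fin 3) ℂ) = 1 := by rw [h]; rfl
  rw [nf_coe, Smat_pow, Tmat_pow hb] at h'
  have h0 : ω ≠ 0 := omega_ne_zero
  have hs := one_add_two_omega
  have e00 := congrFun (congrFun h' 0) 0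
  have e01 := congrFun (congrFun h' 0) 1
  have e02 := congrFun (congrFun h' 0) 2
  have e11 := congrFun (congrFun h' 1) 1
  clear h h'
  have hn := neg_omega_pow c
  interval_cases k'
  · interval_cases b'
    · simp [tp] at e00 e11
      rw [e00, one_mul] at e11
      rw [omega_prim.pow_eq_one_iff_dvd] at e00 e11
      exact ⟨e11, rfl, e00, rfl⟩
    · exfalso; simp [tp, h0] at e01
    · exfalso; simp [tp, h0] at e02
  · exfalso
    have e : (!![1, 0, 0; 0, ω ^ a, 0; 0, 0, ω ^ (2 * a)] * tp b' * Vmat) 0 1 = 0 := by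
      simpa [h0] using e01
    have e' : (!![1, 0, 0; 0, ω ^ a, 0; 0, 0, ω ^ (2 * a)] * tp b' * Vmat) 0 2 = 0 := by
      simpa [h0] using e02
    have hr := omega_rel
    interval_cases b' <;>
      simp [tp, Vmat_eq, Matrix.mul_apply, Fin.sum_univ_three] at e e' <;>
      grind
  · exfalso
    interval_cases b' <;>
      simp [tp, Vmat_sq] at e00 e01 e02
    exact hn e00
  · exfalso
    have e : (!![1, 0, 0; 0, ω ^ a, 0; 0, 0, ω ^ (2 * a)] * tp b' * Vmat ^ 3) 0 1 = 0 := by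
      simpa [h0] using e01
    have e' : (!![1, 0, 0; 0, ω ^ a, 0; 0, 0, ω ^ (2 * a)] * tp b' * Vmat ^ 3) 0 2 = 0 := by
      simpa [h0] using e02
    have hr := omega_rel
    interval_cases b' <;>
      simp [tp, Vmat_cube, Matrix.mul_apply, Fin.sum_univ_three] at e e' <;>
      grind

lemma quot_nf (a b c k a' b' c' k' : ℕ) (h : nf a b c k = nf a' b' c' k') :
    nf (2 * a' + a) (2 * b' + b) (2 * c' + c + 2 * b' * (2 * a' + a)) (k + 3 * k') = 1 := by
  have h1 : gt ^ (2 * b') * gs ^ (2 * a') * gz ^ (2 * c') * nf a b c k * gv ^ (3 * k') =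
      nf (2 * a' + a) (2 * b' + b) (2 * c' + c + 2 * b' * (2 * a' + a)) (k + 3 * k') := by
    have hz : ∀ (n : ℕ) (g : GL (Fin 3) ℂ), g * gz ^ n = gz ^ n * g := fun n g =>
      ((gz_comm g).pow_left n).eq.symm
    calc _ = (gt ^ (2 * b') * gs ^ (2 * a')) * gz ^ (2 * c' + c) *
          (gs ^ a * gt ^ b) * gv ^ (k + 3 * k') := by
            unfold nf; simp only [mul_assoc, pow_add]
      _ = gz ^ (2 * c' + c) * (gt ^ (2 * b') * gs ^ (2 * a' + a)) * (gt ^ b * gv ^ (k + 3 * k')) := by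
            rw [hz]; simp only [mul_assoc, pow_add]
      _ = _ := by rw [tt_pow]; unfold nf; simp only [mul_assoc, pow_add]
  have h3s : gs ^ (2 * a') * gs ^ a' = 1 := by
    rw [← pow_add, show 2 * a' + a' = 3 * a' by ring, pow_mul, gs3, one_pow]
  have h3t : gt ^ (2 * b') * gt ^ b' = 1 := by
    rw [← pow_add, show 2 * b' + b' = 3 * b' by ring, pow_mul, gt3, one_pow]
  have h3z : gz ^ (2 * c') * gz ^ c' = 1 := by
    rw [← pow_add, show 2 * c' + c' = 3 * c' by ring, pow_mul, gz3, one_pow]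
  have h4v : gv ^ k' * gv ^ (3 * k') = 1 := by
    rw [← pow_add, show k' + 3 * k' = 4 * k' by ring, pow_mul, gv4, one_pow]
  rw [← h1, h]
  calc _ = gt ^ (2 * b') * (gs ^ (2 * a') * ((gz ^ (2 * c') * gz ^ c') * gs ^ a')) * gt ^ b' *
        (gv ^ k' * gv ^ (3 * k')) := by unfold nf; simp only [mul_assoc]
    _ = 1 := by rw [h3z, one_mul, h3s, mul_one, h3t, h4v, one_mul]

lemma φ_inj : Function.Injective φ := by
  rintro ⟨k, a, b, c⟩ ⟨k', a', b', c'⟩ h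
  have h1 := nf_eq_one (quot_nf _ _ _ _ _ _ _ _ h)
  simp only at h1
  obtain ⟨ha, hb, hc, hk⟩ := h1
  have ha' : a = a' := by ext; omega
  have hb' : b = b' := by ext; omega
  have hk' : k = k' := by ext; omega
  subst ha' hb' hk'
  have e : 2 * (b : ℕ) * (2 * (a : ℕ) + a) = 3 * (2 * (b : ℕ) * a) := by ring
  rw [e] at hc
  have hc' : c = c' := by ext; omega
  rw [hc']

lemma det_mat (k : Fin 4) (a b : Fin 3) : (mat k a b).det = 1 := by
  have hr := omega_rel
  have h1 : Smat.det = 1 := by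
    rw [Matrix.det_fin_three]; simp [Smat]; linear_combination (ω - 1) * hr
  have h2 : Tmat.det = 1 := by
    rw [Matrix.det_fin_three]; simp [Tmat]
  have h3 : Vmat.det = 1 := by
    rw [Matrix.det_fin_three, Vmat_eq]; simp; grind
  simp [mat, h1, h2, h3]

/-- The second elementary symmetric function of the eigenvalues. -/
def e2 (M : Matrix (Fin 3) (Fin 3) ℂ) : ℂ :=
  M 0 0 * M 1 1 - M 0 1 * M 1 0 + (M 0 0 * M 2 2 - M 0 2 * M 2 0) +
      (M 1 1 * M 2 2 - M 1 2 * M 2 1)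

/-- The trace, written out. -/
def e1 (M : Matrix (Fin 3) (Fin 3) ℂ) : ℂ := M 0 0 + M 1 1 + M 2 2

lemma inv1 (a b : Fin 3) : e1 (mat 1 a b) = ω ^ (2 * (a + b : ℕ) ^ 2) ∧
    e2 (mat 1 a b) = (ω ^ (2 * (a + b : ℕ) ^ 2)) ^ 2 := by
  have hr := omega_rel
  have h3 := omega_cube
  simp only [e1, e2, mat, Smat_pow, Tmat_pow b.isLt]
  fin_cases a <;> fin_cases b <;>
    simp [tp, Vmat_eq, Matrix.mul_apply,
      Fin.sum_univ_three] <;> constructor <;> grind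

lemma inv2 (a b : Fin 3) : e1 (mat 2 a b) = - ω ^ (a * b : ℕ) ∧
    e2 (mat 2 a b) = - (ω ^ (a * b : ℕ)) ^ 2 := by
  have hr := omega_rel
  have h3 := omega_cube
  simp only [e1, e2, mat, Smat_pow, Tmat_pow b.isLt]
  fin_cases a <;> fin_cases b <;>
    simp [tp, Vmat_sq, Matrix.mul_apply,
      Fin.sum_univ_three] <;> grind

lemma inv3 (a b : Fin 3) : e1 (mat 3 a b) = ω ^ ((a + 2 * b : ℕ) ^ 2) ∧
    e2 (mat 3 a b) = (ω ^ ((a + 2 * b : ℕ) ^ 2)) ^ 2 := by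
  have hr := omega_rel
  have h3 := omega_cube
  simp only [e1, e2, mat, Smat_pow, Tmat_pow b.isLt]
  fin_cases a <;> fin_cases b <;>
    simp [tp, Vmat_cube, Matrix.mul_apply,
      Fin.sum_univ_three] <;> constructor <;> grind

lemma inv0 (a b : Fin 3) (hab : (a, b) ≠ (0, 0)) : e1 (mat 0 a b) = 0 ∧
    e2 (mat 0 a b) = 0 := by
  have hr := omega_rel
  have h3 := omega_cube
  simp only [e1, e2, mat, Smat_pow, Tmat_pow b.isLt]
  fin_cases a <;> fin_cases b <;>
    simp [tp, Matrix.mul_apply,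
      Fin.sum_univ_three] at hab ⊢ <;> grind

lemma inv00 : e1 (mat 0 0 0) = 3 ∧ e2 (mat 0 0 0) = 3 := by
  simp [e1, e2, mat]; norm_num

section field
variable {K : Type*} [Field K]

lemma inv_of_mul {D N E : K} (hE : E ≠ 0) (h : D * N = E) : D⁻¹ = N / E := by
  have hD : D ≠ 0 := by rintro rfl; exact hE (by rw [← h, zero_mul])
  rw [eq_div_iff hE, ← h, inv_mul_cancel_left₀ hD]

lemma termA {x y : K} (hy : y ^ 3 = x ^ 3) (h1 : 1 - x ^ 3 ≠ 0) :
    (1 - 3 * y + 3 * y ^ 2 - 1 * y ^ 3)⁻¹ = (1 + y + y ^ 2) ^ 3 / (1 - x ^ 3) ^ 3 := by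
  apply inv_of_mul (pow_ne_zero _ h1)
  rw [← hy]; ring

lemma sumA {w x : K} (hw : w ^ 2 + w + 1 = 0) (h1 : 1 - x ^ 3 ≠ 0) :
    (1 - 3 * x + 3 * x ^ 2 - 1 * x ^ 3)⁻¹ +
    (1 - 3 * (w * x) + 3 * (w * x) ^ 2 - 1 * (w * x) ^ 3)⁻¹ +
    (1 - 3 * (w ^ 2 * x) + 3 * (w ^ 2 * x) ^ 2 - 1 * (w ^ 2 * x) ^ 3)⁻¹ =
      3 * (1 + 7 * x ^ 3 + x ^ 6) / (1 - x ^ 3) ^ 3 := by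
  have h3 : w ^ 3 = 1 := by linear_combination (w - 1) * hw
  rw [termA rfl h1, termA (x := x) (by rw [mul_pow, h3, one_mul]) h1,
    termA (x := x) (by rw [mul_pow, ← pow_mul, pow_mul' w 2 3, h3]; ring) h1, ← add_div, ← add_div]
  congr 1
  have hw2 : w ^ 2 = -1 - w := by linear_combination hw
  rw [hw2]
  grind

lemma termB {x y : K} (hy : y ^ 3 = x ^ 3) (h1 : 1 - x ^ 3 ≠ 0) (h2 : 1 + x ^ 3 ≠ 0) :
    (1 + y - y ^ 2 - y ^ 3)⁻¹ =
      (1 - y + y ^ 2) ^ 2 * (1 + y + y ^ 2) / ((1 + x ^ 3) ^ 2 * (1 - x ^ 3)) := by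
  apply inv_of_mul (mul_ne_zero (pow_ne_zero _ h2) h1)
  rw [← hy]; ring

lemma sumB {w x : K} (hw : w ^ 2 + w + 1 = 0) (h1 : 1 - x ^ 3 ≠ 0) (h2 : 1 + x ^ 3 ≠ 0) :
    (1 + x - x ^ 2 - x ^ 3)⁻¹ +
    (1 + (w * x) - (w * x) ^ 2 - (w * x) ^ 3)⁻¹ +
    (1 + (w ^ 2 * x) - (w ^ 2 * x) ^ 2 - (w ^ 2 * x) ^ 3)⁻¹ =
      3 * (1 - x ^ 3 + x ^ 6) / ((1 + x ^ 3) ^ 2 * (1 - x ^ 3)) := by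
  have h3 : w ^ 3 = 1 := by linear_combination (w - 1) * hw
  rw [termB rfl h1 h2, termB (x := x) (by rw [mul_pow, h3, one_mul]) h1 h2,
    termB (x := x) (by rw [mul_pow, ← pow_mul, pow_mul' w 2 3, h3]; ring) h1 h2,
    ← add_div, ← add_div]
  congr 1
  have hw2 : w ^ 2 = -1 - w := by linear_combination hw
  rw [hw2]
  grind

lemma termC {x y : K} (hy : y ^ 3 = x ^ 3) (h1 : 1 - x ^ 3 ≠ 0) (h2 : 1 + x ^ 6 ≠ 0) :
    (1 - y + y ^ 2 - y ^ 3)⁻¹ =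
      (1 - y ^ 2 + y ^ 4) * (1 + y + y ^ 2) / ((1 + x ^ 6) * (1 - x ^ 3)) := by
  apply inv_of_mul (mul_ne_zero h2 h1)
  rw [show x ^ 6 = (x ^ 3) ^ 2 by ring, ← hy]; ring

lemma sumC {w x : K} (hw : w ^ 2 + w + 1 = 0) (h1 : 1 - x ^ 3 ≠ 0) (h2 : 1 + x ^ 6 ≠ 0) :
    (1 - x + x ^ 2 - x ^ 3)⁻¹ +
    (1 - (w * x) + (w * x) ^ 2 - (w * x) ^ 3)⁻¹ +
    (1 - (w ^ 2 * x) + (w ^ 2 * x) ^ 2 - (w ^ 2 * x) ^ 3)⁻¹ =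
      3 * (1 - x ^ 3 + x ^ 6) / ((1 + x ^ 6) * (1 - x ^ 3)) := by
  have h3 : w ^ 3 = 1 := by linear_combination (w - 1) * hw
  rw [termC rfl h1 h2, termC (x := x) (by rw [mul_pow, h3, one_mul]) h1 h2,
    termC (x := x) (by rw [mul_pow, ← pow_mul, pow_mul' w 2 3, h3]; ring) h1 h2,
    ← add_div, ← add_div]
  congr 1
  have hw2 : w ^ 2 = -1 - w := by linear_combination hw
  rw [hw2]
  grind

end field

open RatFunc in
lemma poly_ne (p : Polynomial ℂ) (hp : p.coeff 0 ≠ 0) :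
    algebraMap (Polynomial ℂ) (RatFunc ℂ) p ≠ 0 := by
  intro h
  have : p = 0 := RatFunc.algebraMap_injective ℂ (by rw [h, map_zero])
  rw [this] at hp; simp at hp

lemma ne1 : (1 - RatFunc.X ^ 3 : RatFunc ℂ) ≠ 0 := by
  have := poly_ne (1 - Polynomial.X ^ 3) (by simp)
  simpa using this
lemma ne2 : (1 + RatFunc.X ^ 3 : RatFunc ℂ) ≠ 0 := by
  have := poly_ne (1 + Polynomial.X ^ 3) (by simp)
  simpa using this
lemma ne3 : (1 + RatFunc.X ^ 6 : RatFunc ℂ) ≠ 0 := by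
  have := poly_ne (1 + Polynomial.X ^ 6) (by simp)
  simpa using this

lemma term_eq (k : Fin 4) (a b c : Fin 3) : molienTerm (φ (k, a, b, c)) =
    (1 - RatFunc.C (e1 (mat k a b)) * (RatFunc.C ω ^ (c : ℕ) * RatFunc.X) +
      RatFunc.C (e2 (mat k a b)) * (RatFunc.C ω ^ (c : ℕ) * RatFunc.X) ^ 2 -
      1 * (RatFunc.C ω ^ (c : ℕ) * RatFunc.X) ^ 3)⁻¹ := by
  rw [molienTerm_smul _ _ _ (φ_coe k a b c) _ _ _ rfl rfl (det_mat k a b)]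
  simp [e1, e2]

lemma C_rel : (RatFunc.C ω : RatFunc ℂ) ^ 2 + RatFunc.C ω + 1 = 0 := by
  have := congrArg (RatFunc.C (K := ℂ)) omega_rel
  simpa using this

lemma C_cube : (RatFunc.C ω : RatFunc ℂ) ^ 3 = 1 := by
  rw [← map_pow, omega_cube, map_one]

lemma sum00 : ∑ c, molienTerm (φ (0, 0, 0, c)) =
    3 * (1 + 7 * RatFunc.X ^ 3 + RatFunc.X ^ 6) / (1 - RatFunc.X ^ 3) ^ 3 := by
  rw [← sumA C_rel ne1, Fin.sum_univ_three]
  have hC : (RatFunc.C 3 : RatFunc ℂ) = 3 := map_ofNat _ 3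
  simp only [term_eq, inv00, hC]
  simp

lemma sum0 (a b : Fin 3) (hab : (a, b) ≠ (0, 0)) : ∑ c, molienTerm (φ (0, a, b, c)) =
    3 / (1 - RatFunc.X ^ 3) := by
  have h3 := C_cube
  have h6 : (RatFunc.C ω : RatFunc ℂ) ^ (2 * 3) = 1 := by rw [pow_mul', h3, one_pow]
  rw [Fin.sum_univ_three]
  simp only [term_eq, inv0 a b hab]
  simp [mul_pow, h3, ← pow_mul, h6]
  field_simp [ne1]
  norm_num

lemma cube_pow (n : ℕ) : ((RatFunc.C ω : RatFunc ℂ) ^ n) ^ 3 = 1 := by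
  rw [← pow_mul, mul_comm, pow_mul, C_cube, one_pow]

lemma sum1' (k : Fin 4) (a b : Fin 3) (n : ℕ) (h : e1 (mat k a b) = ω ^ n ∧
    e2 (mat k a b) = (ω ^ n) ^ 2) : ∑ c, molienTerm (φ (k, a, b, c)) =
    3 * (1 - RatFunc.X ^ 3 + RatFunc.X ^ 6) / ((1 + RatFunc.X ^ 6) * (1 - RatFunc.X ^ 3)) := by
  have hu := cube_pow n
  have hx3 : (RatFunc.C ω ^ n * RatFunc.X) ^ 3 = (RatFunc.X : RatFunc ℂ) ^ 3 := by
    rw [mul_pow, hu, one_mul]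
  have hx6 : (RatFunc.C ω ^ n * RatFunc.X) ^ 6 = (RatFunc.X : RatFunc ℂ) ^ 6 := by
    rw [pow_mul _ 3 2, hx3]; ring
  have key := sumC (x := RatFunc.C ω ^ n * RatFunc.X) C_rel (by rw [hx3]; exact ne1)
    (by rw [hx6]; exact ne3)
  rw [hx6] at key
  rw [Fin.sum_univ_three]
  simp only [term_eq, h, map_pow]
  generalize RatFunc.C ω ^ n = u at *
  generalize RatFunc.C ω = w at *
  rw [hx3] at key
  rw [← key]
  congr 1
  · congr 1
    · congr 1; simp; ring
    · congr 1; simp; linear_combination (w ^ 3 * RatFunc.X ^ 3) * hu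
  · congr 1; simp; linear_combination (w ^ 6 * RatFunc.X ^ 3) * hu

lemma sum2' (a b : Fin 3) : ∑ c, molienTerm (φ (2, a, b, c)) =
    3 * (1 - RatFunc.X ^ 3 + RatFunc.X ^ 6) /
      ((1 + RatFunc.X ^ 3) ^ 2 * (1 - RatFunc.X ^ 3)) := by
  have h := inv2 a b
  generalize (a * b : ℕ) = n at h
  have hu := cube_pow n
  have hx3 : (RatFunc.C ω ^ n * RatFunc.X) ^ 3 = (RatFunc.X : RatFunc ℂ) ^ 3 := by
    rw [mul_pow, hu, one_mul]
  have hx6 : (RatFunc.C ω ^ n * RatFunc.X) ^ 6 = (RatFunc.X : RatFunc ℂ) ^ 6 := by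
    rw [pow_mul _ 3 2, hx3]; ring
  have key := sumB (x := RatFunc.C ω ^ n * RatFunc.X) C_rel (by rw [hx3]; exact ne1)
    (by rw [hx3]; exact ne2)
  rw [hx6] at key
  rw [Fin.sum_univ_three]
  simp only [term_eq, h, map_pow, map_neg]
  generalize RatFunc.C ω ^ n = u at *
  generalize RatFunc.C ω = w at *
  rw [hx3] at key
  rw [← key]
  congr 1
  · congr 1
    · congr 1; simp; ring
    · congr 1; simp; linear_combination (w ^ 3 * RatFunc.X ^ 3) * hu
  · congr 1; simp; linear_combination (w ^ 6 * RatFunc.X ^ 3) * hu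

end Molien

/-- `G₁₀₈` is finite and in `ℂ(x)` one has the Molien-series identity
`Σ_{g ∈ G₁₀₈} det(I₃ − x·g)⁻¹
  = 108·(1 − x³ + x⁶ + x¹² − x¹⁵ + x¹⁸)/((1 − x³)³·(1 + x³)²·(1 + x⁶))`. -/
theorem molien_series_G108 :
    (G108 : Set (GL (Fin 3) ℂ)).Finite ∧
      ∑ᶠ g ∈ (G108 : Set (GL (Fin 3) ℂ)), molienTerm g =
        108 * (1 - RatFunc.X ^ 3 + RatFunc.X ^ 6 + RatFunc.X ^ 12 - RatFunc.X ^ 15 +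
            RatFunc.X ^ 18) /
          ((1 - RatFunc.X ^ 3) ^ 3 * (1 + RatFunc.X ^ 3) ^ 2 *
            (1 + RatFunc.X ^ 6)) := by
  rw [← Molien.range_φ]
  refine ⟨Set.finite_range _, ?_⟩
  rw [finsum_mem_range Molien.φ_inj, finsum_eq_sum_of_fintype, Fintype.sum_prod_type]
  simp only [Fintype.sum_prod_type]
  have h1 := Molien.ne1
  have h2 := Molien.ne2
  have h3 := Molien.ne3
  have s0 : ∑ a, ∑ b, ∑ c, molienTerm (Molien.φ (0, a, b, c)) =
      3 * (1 + 7 * RatFunc.X ^ 3 + RatFunc.X ^ 6) / (1 - RatFunc.X ^ 3) ^ 3 +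
        24 / (1 - RatFunc.X ^ 3) := by
    rw [Fin.sum_univ_three]
    simp only [Fin.sum_univ_three (fun b => ∑ c, molienTerm (Molien.φ (0, _, b, c)))]
    rw [Molien.sum00]
    simp only [Molien.sum0 0 1 (by decide), Molien.sum0 0 2 (by decide),
      Molien.sum0 1 0 (by decide), Molien.sum0 1 1 (by decide), Molien.sum0 1 2 (by decide),
      Molien.sum0 2 0 (by decide), Molien.sum0 2 1 (by decide), Molien.sum0 2 2 (by decide)]
    ring
  rw [Fin.sum_univ_four, s0]
  simp only [Molien.sum1' 1 _ _ _ (Molien.inv1 _ _), Molien.sum2',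
    Molien.sum1' 3 _ _ _ (Molien.inv3 _ _), Finset.sum_const, Finset.card_univ, Fintype.card_fin,
    nsmul_eq_mul]
  push_cast
  generalize (RatFunc.X : RatFunc ℂ) = x at *
  field_simp
  ring
end
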